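/- arXiv:1808.01579 — 5 statements merged into one kernel-verified Lean document; each statement's English description precedes it below -/
import Mathlib

section
/- Let F be a field and let p ∈ F[t] be a monic polynomial with N(p) = 1 or N(p) = −1, of degree d ≥ 1. Then for every k ∈ {0, 1, 2}, the companion matrix C(p) is the product of k U2-matrices and 3 − k involutions of GL_d(F). Moreover, if N(p) = 1 then C(p) is the product of three U2-matrices. -/
open Matrix Polynomial

/-- The companion matrix of a monic polynomial `p = tᵈ − Σ_{k<d} aₖ tᵏ`: ones on the
subdiagonal and the coefficients `aₖ = −p.coeff k` in the last column. -/
noncomputable def companion {F : Type*} [Field F] (p : Polynomial F) :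
    Matrix (Fin p.natDegree) (Fin p.natDegree) F :=
  Matrix.of fun i j =>
    (if (i : ℕ) = (j : ℕ) + 1 then (1 : F) else 0) +
    (if (j : ℕ) = p.natDegree - 1 then -(p.coeff (i : ℕ)) else 0)

/-- The norm `N(p) = (−1)^{d−1} a₀` of a monic polynomial `p = tᵈ − Σ_{k<d} aₖ tᵏ`. -/
noncomputable def polyNorm {F : Type*} [Field F] (p : Polynomial F) : F :=
  (-1) ^ (p.natDegree - 1) * (-(p.coeff 0))

section CompanionShape

variable {F : Type*} [Field F] {n : ℕ}

/-- Every basis vector except the last one is sent to the next basis vector. -/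
def IsCompanionShape (C : Matrix (Fin (n + 1)) (Fin (n + 1)) F) : Prop :=
  ∀ i j : Fin (n + 1), (j : ℕ) < n → C i j = if (i : ℕ) = j + 1 then 1 else 0

lemma IsCompanionShape.apply_zero {C : Matrix (Fin (n + 1)) (Fin (n + 1)) F}
    (hC : IsCompanionShape C) {j : Fin (n + 1)} (hj : (j : ℕ) < n) : C 0 j = 0 := by
  rw [hC 0 j hj, if_neg (by simp)]

lemma IsCompanionShape.det_eq {C : Matrix (Fin (n + 1)) (Fin (n + 1)) F}
    (hC : IsCompanionShape C) : C.det = (-1) ^ n * C 0 (Fin.last n) := by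
  have hsub : C.submatrix Fin.succ (Fin.last n).succAbove = 1 := by
    ext i j
    simp only [submatrix_apply, Fin.succAbove_last]
    rw [hC _ _ (by simp), Matrix.one_apply]
    simp [Fin.ext_iff]
  rw [det_succ_row_zero, Fin.sum_univ_castSucc, Finset.sum_eq_zero, hsub]
  · simp
  · intro j _
    rw [hC.apply_zero (by simp)]
    simp

/-- Two invertible matrices of companion shape differ by a left factor `1 + N` with `N` of rank
at most one. -/
lemma IsCompanionShape.exists_factor {C D : Matrix (Fin (n + 1)) (Fin (n + 1)) F}
    (hC : IsCompanionShape C) (hD : IsCompanionShape D) {l : F} (hC0 : C.det ≠ 0)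
    (hdet : D.det = l * C.det) :
    ∃ N : Matrix (Fin (n + 1)) (Fin (n + 1)) F, N * N = (l - 1) • N ∧ D = (1 + N) * C := by
  rw [hC.det_eq] at hC0
  have hc : C 0 (Fin.last n) ≠ 0 := right_ne_zero_of_mul hC0
  have hs : ((-1) ^ n : F) ≠ 0 := left_ne_zero_of_mul hC0
  have hl : D 0 (Fin.last n) = l * C 0 (Fin.last n) := by
    rw [hC.det_eq, hD.det_eq] at hdet
    apply mul_left_cancel₀ hs
    rw [hdet]
    ring
  let w : Fin (n + 1) → F := fun i =>
    (D i (Fin.last n) - C i (Fin.last n)) / C 0 (Fin.last n)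
  have hw : w 0 = l - 1 := by
    simp only [w, hl]
    field_simp
  refine ⟨vecMulVec w (Pi.single 0 1), ?_, ?_⟩
  · rw [vecMulVec_mul_vecMulVec, single_one_dotProduct, hw, vecMulVec_smul]
  · ext i j
    have hN : (vecMulVec w (Pi.single 0 (1 : F)) * C : Matrix _ _ F) i j = w i * C 0 j := by
      rw [vecMulVec_mul, single_one_vecMul]
      rfl
    rw [add_mul, one_mul, Matrix.add_apply, hN]
    rcases Nat.lt_or_ge j n with hj | hj
    · rw [hC.apply_zero hj, hC i j hj, hD i j hj, mul_zero, add_zero]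
    · obtain rfl : j = Fin.last n := Fin.ext (by have := j.2; simp; omega)
      simp only [w]
      field_simp
      ring

/-- An upper Hessenberg matrix with nonzero subdiagonal entries is similar to a matrix of
companion shape. -/
lemma exists_conj_isCompanionShape (Q : Matrix (Fin (n + 1)) (Fin (n + 1)) F)
    (hz : ∀ i j : Fin (n + 1), (j : ℕ) + 1 < i → Q i j = 0)
    (hs : ∀ i j : Fin (n + 1), (i : ℕ) = j + 1 → Q i j ≠ 0) :
    ∃ G H : Matrix (Fin (n + 1)) (Fin (n + 1)) F,
      G * H = 1 ∧ IsCompanionShape (H * Q * G) := by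
  let v : ℕ → Fin (n + 1) → F := fun k => (Q ^ k) *ᵥ Pi.single 0 1
  have hv : ∀ k, v (k + 1) = Q *ᵥ v k := fun k => by
    simp only [v, pow_succ', mulVec_mulVec]
  have hlow : ∀ k : ℕ, ∀ i : Fin (n + 1), k < i → v k i = 0 := by
    intro k
    induction k with
    | zero =>
      intro i hi
      have : i ≠ 0 := by rintro rfl; simp at hi
      simp [v, this]
    | succ k ih =>
      intro i hi
      rw [hv]
      change ∑ j, Q i j * v k j = 0
      refine Finset.sum_eq_zero fun j _ => ?_
      rcases Nat.lt_or_ge k j with hj | hj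
      · rw [ih j hj, mul_zero]
      · rw [hz i j (by omega), zero_mul]
  have hdiag : ∀ k : ℕ, ∀ i : Fin (n + 1), (i : ℕ) = k → v k i ≠ 0 := by
    intro k
    induction k with
    | zero =>
      intro i hi
      obtain rfl : i = 0 := Fin.ext hi
      simp [v]
    | succ k ih =>
      intro i hi
      have hk : k < n + 1 := by omega
      rw [hv]
      have : (Q *ᵥ v k) i = Q i ⟨k, hk⟩ * v k ⟨k, hk⟩ := by
        change ∑ j, Q i j * v k j = _
        refine Finset.sum_eq_single (⟨k, hk⟩ : Fin (n + 1)) (fun j _ hj => ?_)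
          fun h => absurd (Finset.mem_univ _) h
        rcases Nat.lt_or_ge k j with h | h
        · rw [hlow k j h, mul_zero]
        · have : (j : ℕ) ≠ k := fun h => hj (Fin.ext h)
          rw [hz i j (by omega), zero_mul]
      rw [this]
      exact mul_ne_zero (hs _ _ hi) (ih _ rfl)
  let G : Matrix (Fin (n + 1)) (Fin (n + 1)) F := Matrix.of fun i j => v j i
  have hG : IsUnit G.det := by
    rw [det_of_isUpperTriangular (M := G) (fun i j hij => hlow j i hij)]
    exact IsUnit.mk0 _ (Finset.prod_ne_zero_iff.2 fun i _ => hdiag _ i rfl)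
  refine ⟨G, G⁻¹, mul_nonsing_inv G hG, fun i j hj => ?_⟩
  have hcol : (Q * G).col j = G.col ⟨j + 1, by omega⟩ := by
    ext i
    exact (congrFun (hv j) i).symm
  have : (G⁻¹ * Q * G).col j = (G⁻¹ * G).col ⟨j + 1, by omega⟩ := by
    ext i
    have h := congrArg (fun u => (G⁻¹ *ᵥ u) i) hcol
    rw [mul_assoc]
    exact h
  rw [nonsing_inv_mul G hG] at this
  have h := congrFun this i
  simp only [col_apply, Matrix.one_apply, Fin.ext_iff] at h
  exact h

/-- The matrix of the endomorphism `e_j ↦ f j • e_{π j} + g j • e_j`. -/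
def pairing {m : ℕ} (π : Fin m → Fin m) (f g : Fin m → F) : Matrix (Fin m) (Fin m) F :=
  Matrix.of fun i j => (if i = π j then f j else 0) + (if i = j then g j else 0)

lemma mul_pairing_apply {m : ℕ} (M : Matrix (Fin m) (Fin m) F) (π : Fin m → Fin m)
    (f g : Fin m → F) (i j : Fin m) :
    (M * pairing π f g) i j = M i (π j) * f j + M i j * g j := by
  simp [Matrix.mul_apply, pairing, mul_add, Finset.sum_add_distrib]

lemma pairing_sub_one {m : ℕ} (π : Fin m → Fin m) (f g : Fin m → F) :
    pairing π f g - 1 = pairing π f (g - 1) := by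
  ext i j
  simp only [pairing, Matrix.sub_apply, Matrix.one_apply, of_apply, Pi.sub_apply, Pi.one_apply]
  split_ifs <;> ring

lemma pairing_mul_self {m : ℕ} {π : Fin m → Fin m} (hπ : Function.Involutive π)
    {f g : Fin m → F} (c : F) (h1 : ∀ j, f (π j) * f j + g j * g j = c)
    (h2 : ∀ j, f j * (g (π j) + g j) = 0) :
    pairing π f g * pairing π f g = c • 1 := by
  ext i j
  rw [mul_pairing_apply]
  simp only [pairing, of_apply, hπ j, Matrix.smul_apply, Matrix.one_apply, smul_eq_mul]
  have h1 := h1 j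
  have h2 := h2 j
  split_ifs
  · linear_combination h1 + h2
  · linear_combination h1
  · linear_combination h2
  · ring

/-- The reflection of `{1, …, n}` fixing `0`. -/
def revFixZero (n : ℕ) (j : Fin (n + 1)) : Fin (n + 1) :=
  ⟨if (j : ℕ) = 0 then 0 else n + 1 - j, by split_ifs <;> omega⟩

lemma revFixZero_involutive (n : ℕ) : Function.Involutive (revFixZero n) := by
  intro j
  ext
  simp only [revFixZero]
  split_ifs <;> omega

/-- Acts on each plane spanned by `e_j` and `e_{n-j}`, for `2 * j < n`, by
`e_j ↦ e_{n-j}` and `e_{n-j} ↦ ε e_j + τ e_{n-j}`. -/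
def outerPairing (n : ℕ) (ε τ : F) : Matrix (Fin (n + 1)) (Fin (n + 1)) F :=
  pairing Fin.rev
    (fun j => if 2 * (j : ℕ) < n then 1 else if 2 * (j : ℕ) = n then 0 else ε)
    (fun j => if 2 * (j : ℕ) < n then 0 else if 2 * (j : ℕ) = n then 1 else τ)

/-- Maps `e_0` to `σ e_0` and acts on each plane spanned by `e_j` and `e_{n+1-j}`, for
`2 * j > n + 1`, by `e_j ↦ e_{n+1-j}` and `e_{n+1-j} ↦ ε e_j + τ e_{n+1-j}`. -/
def innerPairing (n : ℕ) (σ ε τ : F) : Matrix (Fin (n + 1)) (Fin (n + 1)) F :=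
  pairing (revFixZero n)
    (fun j => if (j : ℕ) = 0 then 0 else if n + 1 < 2 * (j : ℕ) then 1 else
      if 2 * (j : ℕ) = n + 1 then 0 else ε)
    (fun j => if (j : ℕ) = 0 then σ else if n + 1 < 2 * (j : ℕ) then 0 else
      if 2 * (j : ℕ) = n + 1 then 1 else τ)

lemma outerPairing_mul_self (n : ℕ) :
    outerPairing n (1 : F) 0 * outerPairing n (1 : F) 0 = 1 := by
  rw [outerPairing, pairing_mul_self Fin.rev_involutive 1, one_smul] <;> intro j <;>
    simp only [Fin.val_rev] <;> split_ifs <;> first | omega | ring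

lemma outerPairing_sub_one_mul_self (n : ℕ) :
    (outerPairing n (-1 : F) 2 - 1) * (outerPairing n (-1 : F) 2 - 1) = 0 := by
  rw [outerPairing, pairing_sub_one, pairing_mul_self Fin.rev_involutive 0, zero_smul] <;>
    intro j <;> simp only [Fin.val_rev, Pi.sub_apply, Pi.one_apply] <;> split_ifs <;>
    first | omega | ring

lemma innerPairing_mul_self (n : ℕ) {σ : F} (hσ : σ * σ = 1) :
    innerPairing n σ 1 0 * innerPairing n σ 1 0 = 1 := by
  rw [innerPairing, pairing_mul_self (revFixZero_involutive n) 1, one_smul] <;> intro j <;>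
    simp only [revFixZero] <;> split_ifs <;> first | omega | linear_combination hσ | ring

lemma innerPairing_sub_one_mul_self (n : ℕ) :
    (innerPairing n 1 (-1 : F) 2 - 1) * (innerPairing n 1 (-1 : F) 2 - 1) = 0 := by
  rw [innerPairing, pairing_sub_one, pairing_mul_self (revFixZero_involutive n) 0, zero_smul] <;>
    intro j <;> simp only [revFixZero, Pi.sub_apply, Pi.one_apply] <;> split_ifs <;>
    first | omega | ring

lemma det_innerPairing (n : ℕ) (σ ε τ : F) :
    (innerPairing n σ ε τ).det = σ * (innerPairing n 1 ε τ).det := by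
  have : innerPairing n σ ε τ =
      innerPairing n 1 ε τ * diagonal (fun j : Fin (n + 1) => if j = 0 then σ else 1) := by
    ext i j
    rw [mul_diagonal]
    simp only [innerPairing, pairing, of_apply, Fin.ext_iff, Fin.val_zero]
    split_ifs <;> ring
  rw [this, det_mul, det_diagonal]
  simp [mul_comm]

lemma innerPairing_apply_of_le (σ ε τ : F) (i : Fin (n + 1)) {k : Fin (n + 1)}
    (hk : n + 1 ≤ 2 * (k : ℕ)) :
    innerPairing n σ ε τ i k = if (i : ℕ) + k = n + 1 then 1 else 0 := by
  simp only [innerPairing, pairing, of_apply, Fin.ext_iff, revFixZero]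
  split_ifs <;> first | omega | ring

lemma innerPairing_apply_of_lt (σ ε τ : F) (i : Fin (n + 1)) {k : Fin (n + 1)}
    (h0 : 0 < (k : ℕ)) (hk : 2 * (k : ℕ) < n + 1) :
    innerPairing n σ ε τ i k =
      (if (i : ℕ) + k = n + 1 then ε else 0) + (if i = k then τ else 0) := by
  simp only [innerPairing, pairing, of_apply, Fin.ext_iff, revFixZero]
  split_ifs <;> first | omega | ring

lemma mul_outerPairing_apply_of_lt (M : Matrix (Fin (n + 1)) (Fin (n + 1)) F) (ε τ : F)
    (i : Fin (n + 1)) {j : Fin (n + 1)} (hj : 2 * (j : ℕ) < n) :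
    (M * outerPairing n ε τ) i j = M i j.rev := by
  rw [outerPairing, mul_pairing_apply]
  simp [hj]

lemma mul_outerPairing_apply_of_eq (M : Matrix (Fin (n + 1)) (Fin (n + 1)) F) (ε τ : F)
    (i : Fin (n + 1)) {j : Fin (n + 1)} (hj : 2 * (j : ℕ) = n) :
    (M * outerPairing n ε τ) i j = M i j := by
  rw [outerPairing, mul_pairing_apply]
  simp [hj]

lemma mul_outerPairing_apply_of_gt (M : Matrix (Fin (n + 1)) (Fin (n + 1)) F) (ε τ : F)
    (i : Fin (n + 1)) {j : Fin (n + 1)} (hj : n < 2 * (j : ℕ)) :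
    (M * outerPairing n ε τ) i j = M i j.rev * ε + M i j * τ := by
  rw [outerPairing, mul_pairing_apply]
  simp [hj.not_gt, hj.ne']

lemma innerPairing_mul_outerPairing_eq_zero (σ ε τ ε' τ' : F) (i j : Fin (n + 1))
    (h : (j : ℕ) + 1 < i) : (innerPairing n σ ε τ * outerPairing n ε' τ') i j = 0 := by
  have hi := i.2
  have hr : (j.rev : ℕ) = n - j := by rw [Fin.val_rev]; omega
  rcases lt_trichotomy (2 * (j : ℕ)) n with hj | hj | hj
  · rw [mul_outerPairing_apply_of_lt _ _ _ _ hj,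
      innerPairing_apply_of_le _ _ _ _ (by omega),
      if_neg (by omega)]
  · rw [mul_outerPairing_apply_of_eq _ _ _ _ hj,
      innerPairing_apply_of_lt _ _ _ _ (by omega) (by omega),
      if_neg (by omega), if_neg (by omega), add_zero]
  · rw [mul_outerPairing_apply_of_gt _ _ _ _ hj,
      innerPairing_apply_of_le _ _ _ _ (k := j) (by omega),
      innerPairing_apply_of_lt _ _ _ _ (by omega) (by omega), if_neg (by omega),
      if_neg (by omega), if_neg (by omega)]
    ring

lemma innerPairing_mul_outerPairing_ne_zero {σ ε τ ε' τ' : F} (hε : ε ≠ 0) (hε' : ε' ≠ 0)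
    (i j : Fin (n + 1)) (h : (i : ℕ) = j + 1) :
    (innerPairing n σ ε τ * outerPairing n ε' τ') i j ≠ 0 := by
  have hi := i.2
  have hr : (j.rev : ℕ) = n - j := by rw [Fin.val_rev]; omega
  rcases lt_trichotomy (2 * (j : ℕ)) n with hj | hj | hj
  · rw [mul_outerPairing_apply_of_lt _ _ _ _ hj,
      innerPairing_apply_of_le _ _ _ _ (by omega),
      if_pos (by omega)]
    exact one_ne_zero
  · rw [mul_outerPairing_apply_of_eq _ _ _ _ hj,
      innerPairing_apply_of_lt _ _ _ _ (by omega) (by omega),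
      if_pos (by omega), if_neg (by omega), add_zero]
    exact hε
  · rw [mul_outerPairing_apply_of_gt _ _ _ _ hj,
      innerPairing_apply_of_le _ _ _ _ (k := j) (by omega),
      innerPairing_apply_of_lt _ _ _ _ (by omega) (by omega), if_pos (by omega),
      if_neg (by omega), if_neg (by omega)]
    simpa using ⟨hε, hε'⟩

lemma det_eq_one_or_neg_one {m : ℕ} {S : Matrix (Fin m) (Fin m) F} (h : S * S = 1) :
    S.det = 1 ∨ S.det = -1 := by
  rw [← mul_self_eq_one_iff, ← det_mul, h, det_one]

lemma det_eq_one_of_sub_one_mul_self {m : ℕ} {U : Matrix (Fin m) (Fin m) F}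
    (h : (U - 1) * (U - 1) = 0) : U.det = 1 := by
  have hN : IsNilpotent (1 - U) := ⟨2, by rw [pow_two, ← h]; noncomm_ring⟩
  have hX := (isNilpotent_charpoly_sub_pow_of_isNilpotent hN).eq_zero
  have h1 := congrArg (Polynomial.eval 1) hX
  rw [Polynomial.eval_sub, eval_charpoly] at h1
  simpa [sub_eq_zero] using h1

lemma conj_mul_self {m : ℕ} {A G H : Matrix (Fin m) (Fin m) F} (hGH : G * H = 1) :
    (H * A * G) * (H * A * G) = H * (A * A) * G := by
  calc _ = H * A * (G * H) * A * G := by simp only [mul_assoc]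
    _ = _ := by rw [hGH]; simp only [mul_assoc, mul_one]

lemma conj_involution {m : ℕ} {A G H : Matrix (Fin m) (Fin m) F} (hGH : G * H = 1)
    (hA : A * A = 1) : (H * A * G) * (H * A * G) = 1 := by
  rw [conj_mul_self hGH, hA, mul_one, mul_eq_one_comm.1 hGH]

lemma conj_sub_one_mul_self {m : ℕ} {A G H : Matrix (Fin m) (Fin m) F} (hGH : G * H = 1)
    (hA : (A - 1) * (A - 1) = 0) : (H * A * G - 1) * (H * A * G - 1) = 0 := by
  have : H * A * G - 1 = H * (A - 1) * G := by
    rw [mul_sub, sub_mul, mul_one, mul_eq_one_comm.1 hGH]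
  rw [this, conj_mul_self hGH, hA, mul_zero, zero_mul]

/-- An invertible matrix of companion shape splits off conjugates of an inner and an outer
pairing. -/
lemma IsCompanionShape.exists_factorization {D : Matrix (Fin (n + 1)) (Fin (n + 1)) F}
    (hD : IsCompanionShape D) (hD0 : D.det ≠ 0) {l σ ε τ ε' τ' : F} (hε : ε ≠ 0) (hε' : ε' ≠ 0)
    (hdet : D.det = l * ((innerPairing n σ ε τ).det * (outerPairing n ε' τ').det)) :
    ∃ N G H : Matrix (Fin (n + 1)) (Fin (n + 1)) F, N * N = (l - 1) • N ∧ G * H = 1 ∧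
      D = (1 + N) * (H * innerPairing n σ ε τ * G) * (H * outerPairing n ε' τ' * G) := by
  obtain ⟨G, H, hGH, hC⟩ := exists_conj_isCompanionShape
    (innerPairing n σ ε τ * outerPairing n ε' τ')
    (innerPairing_mul_outerPairing_eq_zero σ ε τ ε' τ')
    (innerPairing_mul_outerPairing_ne_zero hε hε')
  have hdetC : (H * (innerPairing n σ ε τ * outerPairing n ε' τ') * G).det =
      (innerPairing n σ ε τ).det * (outerPairing n ε' τ').det := by
    rw [det_mul_right_comm, mul_eq_one_comm.1 hGH, one_mul, det_mul]
  obtain ⟨N, hN, hDN⟩ := hC.exists_factor (l := l) hD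
    (by rw [hdetC]; exact right_ne_zero_of_mul (hdet ▸ hD0)) (by rw [hdetC, hdet])
  refine ⟨N, G, H, hN, hGH, hDN.trans ?_⟩
  have : H * (innerPairing n σ ε τ * outerPairing n ε' τ') * G =
      H * innerPairing n σ ε τ * (G * H) * outerPairing n ε' τ' * G := by
    rw [hGH]; simp only [mul_assoc, one_mul]
  rw [this]
  simp only [mul_assoc]

lemma IsCompanionShape.exists_U2_or_involution_factorization
    {D : Matrix (Fin (n + 1)) (Fin (n + 1)) F} (hD : IsCompanionShape D)
    (hdet : D.det = 1 ∨ D.det = -1) {l ε' τ' : F} (hl : l = 1 ∨ l = -1) (hε' : ε' ≠ 0)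
    (hB : (outerPairing n ε' τ').det = 1 ∨ (outerPairing n ε' τ').det = -1) :
    ∃ N G H S : Matrix (Fin (n + 1)) (Fin (n + 1)) F, N * N = (l - 1) • N ∧ G * H = 1 ∧
      S * S = 1 ∧ D = (1 + N) * S * (H * outerPairing n ε' τ' * G) := by
  have hA := det_eq_one_or_neg_one (innerPairing_mul_self n (F := F) (mul_one 1))
  rw [← mul_self_eq_one_iff] at hA hB hl hdet
  set a := (innerPairing n 1 (1 : F) 0).det with ha
  set b := (outerPairing n ε' τ').det with hb
  have hσ : (D.det * l * a * b) * (D.det * l * a * b) = 1 := by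
    linear_combination (l * a * b) ^ 2 * hdet + (a * b) ^ 2 * hl + b ^ 2 * hA + hB
  obtain ⟨N, G, H, hN, hGH, hDN⟩ := hD.exists_factorization (l := l)
    (σ := D.det * l * a * b) (ε := 1) (τ := 0) (ε' := ε') (τ' := τ')
    (left_ne_zero_of_mul (hdet ▸ one_ne_zero)) one_ne_zero hε' (by
      rw [det_innerPairing, ← ha, ← hb]
      linear_combination -D.det * (a * a * b * b * hl + b * b * hA + hB))
  exact ⟨N, G, H, _, hN, hGH, conj_involution hGH (innerPairing_mul_self n hσ), hDN⟩

theorem IsCompanionShape.exists_products {D : Matrix (Fin (n + 1)) (Fin (n + 1)) F}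
    (hD : IsCompanionShape D) (hdet : D.det = 1 ∨ D.det = -1) :
    (∀ k : ℕ, k ∈ ({0, 1, 2} : Set ℕ) →
      ∃ (B : Fin 3 → Matrix (Fin (n + 1)) (Fin (n + 1)) F) (s : Finset (Fin 3)),
        s.card = k ∧
        (∀ j ∈ s, (B j - 1) * (B j - 1) = 0) ∧
        (∀ j ∉ s, B j * B j = 1) ∧
        D = B 0 * B 1 * B 2) ∧
    (D.det = 1 →
      ∃ U₁ U₂ U₃ : Matrix (Fin (n + 1)) (Fin (n + 1)) F,
        (U₁ - 1) * (U₁ - 1) = 0 ∧ (U₂ - 1) * (U₂ - 1) = 0 ∧ (U₃ - 1) * (U₃ - 1) = 0 ∧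
        D = U₁ * U₂ * U₃) := by
  have hinv := outerPairing_mul_self (F := F) n
  have hU := outerPairing_sub_one_mul_self (F := F) n
  have hneg : (-1 : F) ≠ 0 := neg_ne_zero.2 one_ne_zero
  refine ⟨?_, fun h1 => ?_⟩
  · rintro k (rfl | rfl | rfl)
    · obtain ⟨N, G, H, S, hN, hGH, hS, h⟩ := hD.exists_U2_or_involution_factorization hdet
        (Or.inr rfl) one_ne_zero (det_eq_one_or_neg_one hinv)
      refine ⟨![1 + N, S, _], ∅, rfl, by simp, ?_, h⟩
      have hL : (1 + N) * (1 + N) = 1 := by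
        have : (1 + N) * (1 + N) = 1 + (2 : F) • N + N * N := by
          rw [two_smul]; noncomm_ring
        rw [this, hN]
        module
      simp [Fin.forall_fin_succ, hL, hS, conj_involution hGH hinv]
    · obtain ⟨N, G, H, S, hN, hGH, hS, h⟩ := hD.exists_U2_or_involution_factorization hdet
        (Or.inl rfl) one_ne_zero (det_eq_one_or_neg_one hinv)
      refine ⟨![1 + N, S, _], {0}, rfl, ?_, ?_, h⟩
      · simpa using hN
      · simp [Fin.forall_fin_succ, hS, conj_involution hGH hinv]
    · obtain ⟨N, G, H, S, hN, hGH, hS, h⟩ := hD.exists_U2_or_involution_factorization hdet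
        (Or.inl rfl) hneg (Or.inl (det_eq_one_of_sub_one_mul_self hU))
      refine ⟨![1 + N, S, _], {0, 2}, rfl, ?_, ?_, h⟩
      · simpa [conj_sub_one_mul_self hGH hU] using hN
      · simp [Fin.forall_fin_succ, hS]
  · have hV := innerPairing_sub_one_mul_self (F := F) n
    obtain ⟨N, G, H, hN, hGH, h⟩ := hD.exists_factorization (l := 1) (σ := 1) (ε := -1) (τ := 2)
      (ε' := -1) (τ' := 2) (h1 ▸ one_ne_zero) hneg hneg (by
        rw [h1, det_eq_one_of_sub_one_mul_self hU, det_eq_one_of_sub_one_mul_self hV]; simp)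
    exact ⟨_, _, _, by simpa using hN, conj_sub_one_mul_self hGH hV,
      conj_sub_one_mul_self hGH hU, h⟩

end CompanionShape

/-- **Proposition `cyclicdecomp`.**
Let `p` be a monic polynomial of degree `d ≥ 1` with norm `±1`. Then for every
`k ∈ {0, 1, 2}`, the companion matrix `C(p)` is a product of `k` U2-matrices and `3 − k`
involutions; moreover, if `N(p) = 1` then `C(p)` is a product of three U2-matrices. -/
theorem stmt13 {F : Type*} [Field F] (p : Polynomial F) (hp : p.Monic)
    (hd : 1 ≤ p.natDegree) (hnorm : polyNorm p = 1 ∨ polyNorm p = -1) :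
    (∀ k : ℕ, k ∈ ({0, 1, 2} : Set ℕ) →
      ∃ (B : Fin 3 → Matrix (Fin p.natDegree) (Fin p.natDegree) F) (s : Finset (Fin 3)),
        s.card = k ∧
        (∀ j ∈ s, (B j - 1) * (B j - 1) = 0) ∧
        (∀ j ∉ s, B j * B j = 1) ∧
        companion p = B 0 * B 1 * B 2) ∧
    (polyNorm p = 1 →
      ∃ U₁ U₂ U₃ : Matrix (Fin p.natDegree) (Fin p.natDegree) F,
        (U₁ - 1) * (U₁ - 1) = 0 ∧ (U₂ - 1) * (U₂ - 1) = 0 ∧ (U₃ - 1) * (U₃ - 1) = 0 ∧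
        companion p = U₁ * U₂ * U₃) := by
  have key : ∀ (d : ℕ) (a : ℕ → F) (M : Matrix (Fin d) (Fin d) F), 1 ≤ d →
      (∀ i j, M i j = (if (i : ℕ) = (j : ℕ) + 1 then (1 : F) else 0) +
        (if (j : ℕ) = d - 1 then -(a (i : ℕ)) else 0)) →
      (-1) ^ (d - 1) * (-(a 0)) = 1 ∨ (-1) ^ (d - 1) * (-(a 0)) = -1 →
      (∀ k : ℕ, k ∈ ({0, 1, 2} : Set ℕ) →
        ∃ (B : Fin 3 → Matrix (Fin d) (Fin d) F) (s : Finset (Fin 3)),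
          s.card = k ∧
          (∀ j ∈ s, (B j - 1) * (B j - 1) = 0) ∧
          (∀ j ∉ s, B j * B j = 1) ∧
          M = B 0 * B 1 * B 2) ∧
      ((-1) ^ (d - 1) * (-(a 0)) = 1 →
        ∃ U₁ U₂ U₃ : Matrix (Fin d) (Fin d) F,
          (U₁ - 1) * (U₁ - 1) = 0 ∧ (U₂ - 1) * (U₂ - 1) = 0 ∧ (U₃ - 1) * (U₃ - 1) = 0 ∧
          M = U₁ * U₂ * U₃) := by
    intro d a M hd hM ha
    obtain ⟨n, rfl⟩ := Nat.exists_eq_add_of_le' hd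
    have hshape : IsCompanionShape M := fun i j hj => by
      rw [hM, if_neg (by omega : ¬ (j : ℕ) = n + 1 - 1), add_zero]
    have hdet : M.det = (-1) ^ (n + 1 - 1) * (-(a 0)) := by
      rw [hshape.det_eq, hM]
      simp
    rw [← hdet] at ha ⊢
    exact hshape.exists_products ha
  exact key p.natDegree p.coeff (companion p) hd (fun _ _ => rfl) hnorm
end

section
/- Let F be a field and let A ∈ GL_n(F) with det A = 1 or det A = −1. Assume A is similar to a well-partitioned matrix. Then for every k ∈ {0, 1, 2}, the matrix A is the product of k U2-matrices and 3 − k involutions of GL_n(F). Moreover, if det A = 1 then A is the product of three U2-matrices. -/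
open Matrix Polynomial

/-- Similarity of square matrices: `B = P⁻¹ * A * P` for some invertible `P`. -/
def SimilarMat {F : Type*} [Field F] {ι : Type*} [Fintype ι] [DecidableEq ι]
    (A B : Matrix ι ι F) : Prop :=
  ∃ P : Matrix ι ι F, IsUnit P ∧ A * P = P * B

/-- Splitting off the first summand of a sigma type over `Fin (m + 1)`. -/
def sigmaFinSuccEquiv {m : ℕ} (d : Fin (m + 1) → ℕ) :
    (Σ i : Fin (m + 1), Fin (d i)) ≃ (Fin (d 0) ⊕ Σ i : Fin m, Fin (d i.succ)) where
  toFun x := Fin.cases (motive := fun i => Fin (d i) → Fin (d 0) ⊕ Σ i : Fin m, Fin (d i.succ))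
      Sum.inl (fun i j => Sum.inr ⟨i, j⟩) x.1 x.2
  invFun y := y.elim (fun j => ⟨0, j⟩) (fun z => ⟨z.1.succ, z.2⟩)
  left_inv := by
    rintro ⟨i, j⟩
    induction i using Fin.cases with
    | zero => rfl
    | succ i => simp
  right_inv := by
    rintro (j | ⟨i, j⟩)
    · rfl
    · simp

/-- The canonical (order-preserving) equivalence `(Σ i : Fin m, Fin (d i)) ≃ Fin (Σᵢ d i)`. -/
noncomputable def finSigmaEquiv : ∀ {m : ℕ} (d : Fin m → ℕ), (Σ i, Fin (d i)) ≃ Fin (∑ i, d i)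
  | 0, d =>
      (Equiv.equivOfIsEmpty (Σ i : Fin 0, Fin (d i)) (Fin 0)).trans
        (finCongr (by simp))
  | (m + 1), d =>
      (sigmaFinSuccEquiv d).trans <|
        ((Equiv.refl (Fin (d 0))).sumCongr (finSigmaEquiv fun i => d i.succ)).trans <|
          finSumFinEquiv.trans (finCongr (Fin.sum_univ_succ d).symm)

/-- The block-diagonal direct sum `C(p₁) ⊕ ⋯ ⊕ C(p_r) ⊕ C(q₁) ⊕ ⋯ ⊕ C(q_s)` of the companion
matrices of the polynomials `p i` and `q j`, indexed by `Fin` of the total degree, with the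
blocks in their natural order. -/
noncomputable def companionDirectSum {F : Type*} [Field F] {r s : ℕ}
    (p : Fin r → Polynomial F) (q : Fin s → Polynomial F) :
    Matrix (Fin (∑ k : Fin (r + s), (Fin.append p q k).natDegree))
           (Fin (∑ k : Fin (r + s), (Fin.append p q k).natDegree)) F :=
  Matrix.reindex (finSigmaEquiv _) (finSigmaEquiv _)
    (Matrix.blockDiagonal' fun k => companion (Fin.append p q k))

/-- A matrix `M` is well-partitioned when
`M = C(p₁) ⊕ ⋯ ⊕ C(p_r) ⊕ C(q₁) ⊕ ⋯ ⊕ C(q_s)` where `r, s ≥ 1`, the `pᵢ` and `qⱼ` are monic,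
`deg pᵢ ≥ 2` for `i ≥ 2`, `deg qⱼ ≥ 2` for `j ≤ s − 1`, and each `pᵢ` is coprime to
each `qⱼ`. -/
def IsWellPartitioned {F : Type*} [Field F] {n : ℕ} (M : Matrix (Fin n) (Fin n) F) : Prop :=
  ∃ (r s : ℕ) (_ : 1 ≤ r) (_ : 1 ≤ s)
    (p : Fin r → Polynomial F) (q : Fin s → Polynomial F),
      (∀ i, (p i).Monic) ∧ (∀ j, (q j).Monic) ∧
      (∀ i : Fin r, (i : ℕ) ≠ 0 → 2 ≤ (p i).natDegree) ∧
      (∀ j : Fin s, (j : ℕ) + 1 ≠ s → 2 ≤ (q j).natDegree) ∧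
      (∀ i j, IsCoprime (p i) (q j)) ∧
      ∃ hn : (∑ k : Fin (r + s), (Fin.append p q k).natDegree) = n,
        M = Matrix.reindex (finCongr hn) (finCongr hn) (companionDirectSum p q)

/-- A matrix `M` is very-well-partitioned when it is well-partitioned and, in addition, at
most one of `p₁` and `q_s` has degree `1`. -/
def IsVeryWellPartitioned {F : Type*} [Field F] {n : ℕ} (M : Matrix (Fin n) (Fin n) F) : Prop :=
  ∃ (r s : ℕ) (hr : 1 ≤ r) (hs : 1 ≤ s)
    (p : Fin r → Polynomial F) (q : Fin s → Polynomial F),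
      (∀ i, (p i).Monic) ∧ (∀ j, (q j).Monic) ∧
      (∀ i : Fin r, (i : ℕ) ≠ 0 → 2 ≤ (p i).natDegree) ∧
      (∀ j : Fin s, (j : ℕ) + 1 ≠ s → 2 ≤ (q j).natDegree) ∧
      (∀ i j, IsCoprime (p i) (q j)) ∧
      ¬((p ⟨0, hr⟩).natDegree = 1 ∧ (q ⟨s - 1, by omega⟩).natDegree = 1) ∧
      ∃ hn : (∑ k : Fin (r + s), (Fin.append p q k).natDegree) = n,
        M = Matrix.reindex (finCongr hn) (finCongr hn) (companionDirectSum p q)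

section Quadratic

variable {F : Type*} [Field F]

/-- `x` is annihilated by `(t - 1) * (t - ε)`: for `ε = 1` this says that `x` is a U2-element,
for `ε = -1` that `x` is an involution. -/
def IsQuad {R : Type*} [Ring R] [Algebra F R] (ε : F) (x : R) : Prop :=
  (x - 1) * (x - algebraMap F R ε) = 0

/-- `x` is a product of three quadratic elements with prescribed second roots `a`, `b`, `c`. -/
def IsTripleProd {R : Type*} [Ring R] [Algebra F R] (a b c : F) (x : R) : Prop :=
  ∃ y₁ y₂ y₃ : R, IsQuad a y₁ ∧ IsQuad b y₂ ∧ IsQuad c y₃ ∧ x = y₁ * y₂ * y₃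

/-- `x` is a product of two quadratic elements with prescribed second roots `a`, `b`. -/
def IsDoubleProd {R : Type*} [Ring R] [Algebra F R] (a b : F) (x : R) : Prop :=
  ∃ y₁ y₂ : R, IsQuad a y₁ ∧ IsQuad b y₂ ∧ x = y₁ * y₂

variable {R S : Type*} [Ring R] [Algebra F R] [Ring S] [Algebra F S]

lemma IsQuad.map {ε : F} {x : R} (h : IsQuad ε x) (φ : R →ₐ[F] S) : IsQuad ε (φ x) := by
  have := congrArg φ h
  simpa [IsQuad] using this

lemma IsDoubleProd.map {a b : F} {x : R} (h : IsDoubleProd a b x) (φ : R →ₐ[F] S) :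
    IsDoubleProd a b (φ x) := by
  obtain ⟨y₁, y₂, h₁, h₂, rfl⟩ := h
  exact ⟨φ y₁, φ y₂, h₁.map φ, h₂.map φ, map_mul _ _ _⟩

lemma IsTripleProd.map {a b c : F} {x : R} (h : IsTripleProd a b c x) (φ : R →ₐ[F] S) :
    IsTripleProd a b c (φ x) := by
  obtain ⟨y₁, y₂, y₃, h₁, h₂, h₃, rfl⟩ := h
  exact ⟨φ y₁, φ y₂, φ y₃, h₁.map φ, h₂.map φ, h₃.map φ, by simp only [map_mul]⟩

lemma isQuad_one_iff {x : R} : IsQuad (1 : F) x ↔ (x - 1) * (x - 1) = 0 := by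
  simp [IsQuad]

lemma isQuad_neg_one_iff {x : R} : IsQuad (-1 : F) x ↔ x * x = 1 := by
  rw [IsQuad, map_neg, map_one, ← sub_eq_zero (a := x * x)]
  constructor <;> intro h <;> rw [← h] <;> noncomm_ring

end Quadratic

section Cyclic

variable {F : Type*} [Field F]

open Module

/-- Multiplication by `X` modulo the monic polynomial `q` of degree `d`, as an endomorphism of the
space of polynomials of degree less than `d`. -/
noncomputable def shiftMod {d : ℕ} (q : F[X]) (hq : q.Monic) (hd : q.natDegree = d) :
    End F (degreeLT F d) where
  toFun p := ⟨X * (p : F[X]) - C ((p : F[X]).coeff (d - 1)) * q, by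
    rw [mem_degreeLT, degree_lt_iff_coeff_zero]
    intro m hm
    have hp : ∀ k, d ≤ k → (p : F[X]).coeff k = 0 :=
      (degree_lt_iff_coeff_zero _ _).1 (mem_degreeLT.1 p.2)
    rw [coeff_sub, coeff_C_mul]
    rcases Nat.eq_zero_or_pos d with h0 | h0
    · subst h0
      have : (p : F[X]) = 0 := by ext k; simpa using hp k (Nat.zero_le k)
      simp [this]
    · obtain ⟨k, rfl⟩ : ∃ k, m = k + 1 := ⟨m - 1, by omega⟩
      rw [coeff_X_mul]
      rcases hm.lt_or_eq with h | h
      · rw [hp k (by omega), coeff_eq_zero_of_natDegree_lt (p := q) (by omega)]; simp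
      · have h1 : q.coeff (k + 1) = 1 := by rw [← h, ← hd]; exact hq
        have h2 : k = d - 1 := by omega
        rw [h1, h2]; simp⟩
  map_add' p r := by ext1; simp; ring
  map_smul' c p := by ext1; simp [smul_eq_C_mul]; ring

lemma shiftMod_coe {d : ℕ} (q : F[X]) (hq : q.Monic) (hd : q.natDegree = d) (p : degreeLT F d) :
    (shiftMod q hq hd p : F[X]) = X * (p : F[X]) - C ((p : F[X]).coeff (d - 1)) * q := rfl

variable {V V' : Type*} [AddCommGroup V] [Module F V] [AddCommGroup V'] [Module F V']

/-- `v` is a cyclic vector of `B`, and the monic polynomial `f` of degree `dim V` kills `v`. -/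
structure HasCyclicVector (B : End F V) (v : V) (f : F[X]) : Prop where
  monic : f.Monic
  natDegree_eq : f.natDegree = finrank F V
  aeval_eq_zero : aeval B f v = 0
  eq_top : ∀ M : Submodule F V, v ∈ M → (∀ x ∈ M, B x ∈ M) → M = ⊤

lemma aeval_mem_of_invariant {B : End F V} {M : Submodule F V} (hM : ∀ x ∈ M, B x ∈ M)
    {v : V} (hv : v ∈ M) (p : F[X]) : aeval B p v ∈ M := by
  induction p using Polynomial.induction_on' with
  | add p q hp hq => simpa using M.add_mem hp hq
  | monomial n a =>
    rw [aeval_monomial]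
    have : ∀ n, (B ^ n) v ∈ M := by
      intro n
      induction n with
      | zero => simpa
      | succ n ih => rw [pow_succ']; exact hM _ ih
    simpa [Module.algebraMap_end_apply] using M.smul_mem a (this n)

lemma aeval_X_mul_apply (B : End F V) (p : F[X]) (v : V) :
    aeval B (X * p) v = B (aeval B p v) := by simp

lemma aeval_mul_apply (B : End F V) (p q : F[X]) (v : V) :
    aeval B (p * q) v = aeval B p (aeval B q v) := by simp

lemma aeval_apply_comm (B : End F V) (p : F[X]) (v : V) :
    aeval B p (B v) = B (aeval B p v) := by
  rw [← aeval_X_mul_apply, mul_comm, aeval_mul_apply, aeval_X]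

lemma HasCyclicVector.exists_equiv_shiftMod [FiniteDimensional F V] {B : End F V} {v : V}
    {f : F[X]} (h : HasCyclicVector B v f) {d : ℕ} (hd : f.natDegree = d) :
    ∃ e : degreeLT F d ≃ₗ[F] V, ∀ p, e (shiftMod f h.monic hd p) = B (e p) := by
  let φ : F[X] →ₗ[F] V := (LinearMap.applyₗ v).comp (aeval B).toLinearMap
  have hφ : ∀ p, φ p = aeval B p v := fun p => rfl
  have hf : ∀ p, φ (p * f) = 0 := fun p => by
    rw [hφ, aeval_mul_apply, h.aeval_eq_zero, map_zero]
  let ψ : degreeLT F d →ₗ[F] V := φ.domRestrict _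
  have hψ : ∀ p : degreeLT F d, ψ p = φ p := fun p => rfl
  have hsurj : Function.Surjective ψ := by
    have htop : φ.range = ⊤ := by
      refine h.eq_top _ ⟨1, by simp [hφ]⟩ ?_
      rintro _ ⟨p, rfl⟩
      exact ⟨X * p, by simp [hφ]⟩
    intro x
    obtain ⟨p, rfl⟩ : x ∈ φ.range := by rw [htop]; trivial
    have hmem : p %ₘ f ∈ degreeLT F d := by
      rw [mem_degreeLT, ← hd, ← degree_eq_natDegree h.monic.ne_zero]
      exact degree_modByMonic_lt _ h.monic
    refine ⟨⟨p %ₘ f, hmem⟩, ?_⟩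
    rw [hψ]
    conv_rhs => rw [← modByMonic_add_div p f]
    rw [map_add, mul_comm f, hf, add_zero]
  have hfin : finrank F (degreeLT F d) = finrank F V := by
    rw [(degreeLTEquiv F d).finrank_eq, finrank_fin_fun, ← h.natDegree_eq, hd]
  have : FiniteDimensional F (degreeLT F d) :=
    Module.Finite.equiv (degreeLTEquiv F d).symm
  have hinj : Function.Injective ψ :=
    (LinearMap.injective_iff_surjective_of_finrank_eq_finrank hfin).2 hsurj
  refine ⟨LinearEquiv.ofBijective ψ ⟨hinj, hsurj⟩, fun p => ?_⟩
  change φ (shiftMod f h.monic hd p : F[X]) = B (φ p)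
  rw [shiftMod_coe, map_sub, hf, sub_zero, hφ, hφ, aeval_X_mul_apply]

lemma HasCyclicVector.exists_equiv [FiniteDimensional F V] [FiniteDimensional F V']
    {B : End F V} {v : V} {B' : End F V'} {v' : V'} {f : F[X]}
    (h : HasCyclicVector B v f) (h' : HasCyclicVector B' v' f) :
    ∃ e : V ≃ₗ[F] V', ∀ x, e (B x) = B' (e x) := by
  obtain ⟨e, he⟩ := h.exists_equiv_shiftMod rfl
  obtain ⟨e', he'⟩ := h'.exists_equiv_shiftMod rfl
  refine ⟨e.symm.trans e', fun x => ?_⟩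
  obtain ⟨p, rfl⟩ := e.surjective x
  simp [← he, ← he']

lemma mem_of_apply_mem_of_injective [FiniteDimensional F V] {B : End F V}
    (hB : Function.Injective B) {M : Submodule F V} (hM : ∀ x ∈ M, B x ∈ M) {x : V}
    (hx : B x ∈ M) : x ∈ M := by
  have hs : Function.Surjective (B.restrict hM) :=
    LinearMap.injective_iff_surjective.1 fun a b hab => Subtype.ext (hB (congrArg Subtype.val hab))
  obtain ⟨y, hy⟩ := hs ⟨B x, hx⟩
  have := hB (congrArg Subtype.val hy : B y = B x)
  exact this ▸ y.2

lemma aeval_shiftMod_one {d : ℕ} (q : F[X]) (hq : q.Monic) (hd : q.natDegree = d)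
    (one : degreeLT F d) (hone : (one : F[X]) = 1 %ₘ q) (p : F[X]) :
    ((aeval (shiftMod q hq hd) p one : degreeLT F d) : F[X]) = p %ₘ q := by
  induction p using Polynomial.induction_on' with
  | add p r hp hr => simp [hp, hr, add_modByMonic]
  | monomial n a =>
    induction n with
    | zero =>
      rw [monomial_zero_left, aeval_C, Module.algebraMap_end_apply, Submodule.coe_smul, hone,
        ← smul_modByMonic, smul_eq_C_mul, mul_one]
    | succ n ih =>
      have : (monomial (n + 1) a : F[X]) = X * monomial n a := by
        rw [X_mul_monomial]
      rw [this, aeval_X_mul_apply, shiftMod_coe, ih]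
      refine ((div_modByMonic_unique (C ((monomial n a %ₘ q).coeff (d - 1)) +
        X * (monomial n a /ₘ q)) _ hq ⟨?_, ?_⟩).2).symm
      · conv_rhs => rw [← modByMonic_add_div (monomial n a) q]
        ring
      · rw [← ih, ← shiftMod_coe q hq hd, degree_eq_natDegree hq.ne_zero, hd]
        exact mem_degreeLT.1 (Subtype.property _)

lemma hasCyclicVector_shiftMod {d : ℕ} (q : F[X]) (hq : q.Monic) (hd : q.natDegree = d)
    (one : degreeLT F d) (hone : (one : F[X]) = 1 %ₘ q) :
    HasCyclicVector (shiftMod q hq hd) one q where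
  monic := hq
  natDegree_eq := by rw [(degreeLTEquiv F d).finrank_eq, finrank_fin_fun, hd]
  aeval_eq_zero := by ext1; rw [aeval_shiftMod_one q hq hd one hone]; simp [modByMonic_self hq]
  eq_top M hM hinv := by
    rw [eq_top_iff]
    intro p _
    have : aeval (shiftMod q hq hd) (p : F[X]) one = p := by
      ext1
      rw [aeval_shiftMod_one q hq hd one hone, (modByMonic_eq_self_iff hq).2]
      rw [degree_eq_natDegree hq.ne_zero, hd]
      exact mem_degreeLT.1 p.2
    rw [← this]
    exact aeval_mem_of_invariant hinv hM _

end Cyclic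

section Peeling

variable {F : Type*} [Field F] {V V' : Type*} [AddCommGroup V] [Module F V]
  [AddCommGroup V'] [Module F V']

open Module

/-- `B` is a cyclic automorphism agreeing with `A` on `H` and such that the image of `A - ε B` is
contained in `B H`. Then `A * B⁻¹` is annihilated by `(t - 1) * (t - ε)`. -/
structure IsPeeling (ε : F) (A B : End F V) (H : Submodule F V) (v : V) (f : F[X]) : Prop where
  injective : Function.Injective B
  eq_on : ∀ x ∈ H, A x = B x
  defect : ∀ x, ∃ h ∈ H, A x - ε • B x = B h
  cyclic : HasCyclicVector B v f

lemma IsPeeling.isTripleProd [FiniteDimensional F V] [FiniteDimensional F V']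
    {ε : F} {A B : End F V} {H : Submodule F V} {v : V} {f : F[X]}
    (h : IsPeeling ε A B H v f) {T : End F V'} {w : V'} (hT : HasCyclicVector T w f)
    {b c : F} (hT' : IsDoubleProd b c T) : IsTripleProd ε b c A := by
  obtain ⟨e, he⟩ := hT.exists_equiv h.cyclic
  have hB : e.conjAlgEquiv F T = B := by
    ext x
    obtain ⟨y, rfl⟩ := e.surjective x
    simp [he]
  have hB2 : IsDoubleProd b c B := hB ▸ hT'.map (e.conjAlgEquiv F).toAlgHom
  obtain ⟨y₁, y₂, h₁, h₂, hy⟩ := hB2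
  let E := LinearEquiv.ofInjectiveEndo B h.injective
  have hE : ∀ x, E x = B x := fun x => rfl
  refine ⟨A * (E.symm : End F V), y₁, y₂, ?_, h₁, h₂, ?_⟩
  · ext x
    obtain ⟨y, rfl⟩ := E.surjective x
    obtain ⟨z, hz, hyz⟩ := h.defect y
    have h1 : (A * (E.symm : End F V) - algebraMap F (End F V) ε) (E y) = E z := by
      simp [hE, ← hyz, Module.algebraMap_end_apply]
      rw [← hE, LinearEquiv.symm_apply_apply]
    rw [Module.End.mul_apply, h1]
    simp [hE]
    rw [← hE, LinearEquiv.symm_apply_apply, h.eq_on z hz, ← hE, sub_self]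
  · rw [mul_assoc, ← hy]
    ext x
    simp [← hE]

lemma IsPeeling.of_equiv {ε : F} {A B : End F V} {H : Submodule F V} {v : V} {f : F[X]}
    (h : IsPeeling ε A B H v f) (e : V' ≃ₗ[F] V) {A' : End F V'}
    (he : ∀ x, e (A' x) = A (e x)) :
    IsPeeling ε A' (e.symm.conjAlgEquiv F B) (H.comap e.toLinearMap) (e.symm v) f where
  injective := by
    intro x y hxy
    simpa using h.injective (e.symm.injective hxy)
  eq_on x hx := by
    apply e.injective
    have := h.eq_on (e x) hx
    rw [he, this]
    simp
  defect x := by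
    obtain ⟨z, hz, hxz⟩ := h.defect (e x)
    refine ⟨e.symm z, by simpa using hz, e.injective ?_⟩
    simp [he, hxz]
  cyclic := by
    have hc : ∀ p : F[X], aeval (e.symm.conjAlgEquiv F B) p = e.symm.conjAlgEquiv F (aeval B p) :=
      fun p => aeval_algHom_apply (e.symm.conjAlgEquiv F).toAlgHom B p
    refine ⟨h.cyclic.monic, by rw [h.cyclic.natDegree_eq, e.finrank_eq], ?_, ?_⟩
    · rw [hc]
      simp [h.cyclic.aeval_eq_zero]
    · intro M hM hinv
      have := h.cyclic.eq_top (M.comap e.symm.toLinearMap) hM (fun x hx => by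
        have := hinv _ hx
        simpa using this)
      rw [eq_top_iff]
      intro x _
      have hx : e x ∈ M.comap e.symm.toLinearMap := by rw [this]; trivial
      simpa using hx

lemma isPeeling_of_subsingleton [Subsingleton V] (ε : F) (A : End F V) :
    IsPeeling ε A 1 ⊤ 0 1 where
  injective x y _ := Subsingleton.elim _ _
  eq_on x _ := Subsingleton.elim _ _
  defect x := ⟨0, trivial, Subsingleton.elim _ _⟩
  cyclic :=
    { monic := monic_one
      natDegree_eq := by simp [finrank_zero_of_subsingleton]
      aeval_eq_zero := Subsingleton.elim _ _
      eq_top := fun M _ _ => Subsingleton.elim _ _ }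

/-- The coefficient of `X ^ (d - 1)`, as a linear form. -/
noncomputable def topCoeff (F : Type*) [Field F] (d : ℕ) : degreeLT F d →ₗ[F] F :=
  (lcoeff F (d - 1)).domRestrict _

lemma topCoeff_apply {d : ℕ} (p : degreeLT F d) :
    topCoeff F d p = (p : F[X]).coeff (d - 1) := rfl

lemma shiftMod_injective {d : ℕ} {g : F[X]} (hg : g.Monic) (hd : g.natDegree = d)
    (hg0 : g.coeff 0 ≠ 0) : Function.Injective (shiftMod g hg hd) := by
  rw [injective_iff_map_eq_zero]
  intro x hx
  have hx' : X * (x : F[X]) - C ((x : F[X]).coeff (d - 1)) * g = 0 := by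
    rw [← shiftMod_coe g hg hd, hx]; rfl
  have h0 := congrArg (fun p => coeff p 0) hx'
  have h1 : (x : F[X]).coeff (d - 1) = 0 := by
    simpa [hg0] using h0
  ext1
  simpa [h1] using hx'

lemma divX_mem_degreeLT {n : ℕ} {p : F[X]} (hp : p ∈ degreeLT F (n + 1)) :
    divX p ∈ degreeLT F n := by
  rw [mem_degreeLT, degree_lt_iff_coeff_zero] at *
  intro m hm
  rw [coeff_divX]
  exact hp _ (by omega)

lemma mem_degreeLT_succ {d : ℕ} {p : F[X]} (hp : p.natDegree ≤ d) :
    p ∈ degreeLT F (d + 1) := by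
  rw [mem_degreeLT, degree_lt_iff_coeff_zero]
  intro m hm
  exact coeff_eq_zero_of_natDegree_lt (by omega)

/-- The endomorphism `(x, w) ↦ (X x mod g, B (w + ℓ(x) v))` where `ℓ` is the top coefficient. -/
noncomputable def glueEnd {d : ℕ} (g : F[X]) (hg : g.Monic) (hd : g.natDegree = d)
    (B : End F V) (v : V) : End F (degreeLT F d × V) :=
  (shiftMod g hg hd).prodMap B +
    (LinearMap.inr F _ _).comp (((topCoeff F d).smulRight (B v)).comp (LinearMap.fst F _ _))

lemma glueEnd_apply {d : ℕ} {g : F[X]} (hg : g.Monic) (hd : g.natDegree = d)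
    (B : End F V) (v : V) (x : degreeLT F d) (w : V) :
    glueEnd g hg hd B v (x, w) =
      (shiftMod g hg hd x, B w + (x : F[X]).coeff (d - 1) • B v) := by
  simp [glueEnd, topCoeff_apply]

lemma aeval_glueEnd_of_mem {d : ℕ} {g : F[X]} (hg : g.Monic) (hd : g.natDegree = d)
    (B : End F V) (v : V) (one : degreeLT F d) (hone : (one : F[X]) = 1) (n : ℕ) (hn : n ≤ d) :
    ∀ p : F[X], p ∈ degreeLT F n → ∀ hp' : p ∈ degreeLT F d,
      aeval (glueEnd g hg hd B v) p (one, 0) = (⟨p, hp'⟩, 0) := by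
  induction n with
  | zero =>
    intro p hp hp'
    have : p = 0 := by
      rw [mem_degreeLT, degree_lt_iff_coeff_zero] at hp
      ext k; simpa using hp k (Nat.zero_le k)
    subst this
    simp only [map_zero]; rfl
  | succ n ih =>
    intro p hp hp'
    have hd1 := divX_mem_degreeLT hp
    have hd2 : divX p ∈ degreeLT F d := degreeLT_mono (by omega) hd1
    have h1 : (divX p).coeff (d - 1) = 0 := by
      rw [mem_degreeLT, degree_lt_iff_coeff_zero] at hd1
      exact hd1 _ (by omega)
    conv_lhs => rw [← X_mul_divX_add p]
    rw [map_add, LinearMap.add_apply, aeval_X_mul_apply, ih (by omega) _ hd1 hd2, glueEnd_apply,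
      aeval_C, Module.algebraMap_end_apply]
    ext1
    · ext1
      simp only [Prod.fst_add, Prod.smul_fst, Submodule.coe_add, Submodule.coe_smul, shiftMod_coe,
        h1, hone]
      conv_rhs => rw [← X_mul_divX_add p]
      simp [smul_eq_C_mul]
    · simp [h1]

lemma aeval_glueEnd_self {d : ℕ} (hd0 : 0 < d) {g : F[X]} (hg : g.Monic) (hd : g.natDegree = d)
    (B : End F V) (v : V) (one : degreeLT F d) (hone : (one : F[X]) = 1) :
    aeval (glueEnd g hg hd B v) g (one, 0) = (0, B v) := by
  obtain ⟨n, rfl⟩ : ∃ n, d = n + 1 := ⟨d - 1, by omega⟩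
  have hd2 : divX g ∈ degreeLT F (n + 1) := divX_mem_degreeLT (mem_degreeLT_succ hd.le)
  have h1 : (divX g).coeff (n + 1 - 1) = 1 := by
    rw [coeff_divX, Nat.add_sub_cancel, ← hd]; exact hg
  conv_lhs => enter [1, 2]; rw [← X_mul_divX_add g]
  rw [map_add, LinearMap.add_apply, aeval_X_mul_apply,
    aeval_glueEnd_of_mem hg hd B v one hone _ le_rfl _ hd2 hd2, glueEnd_apply,
    aeval_C, Module.algebraMap_end_apply]
  ext1
  · ext1
    simp only [Prod.fst_add, Prod.smul_fst, Submodule.coe_add, Submodule.coe_smul, shiftMod_coe,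
      h1, hone]
    have := X_mul_divX_add g
    simp only [smul_eq_C_mul, mul_one, map_one, one_mul, Submodule.coe_zero]
    linear_combination this
  · simp only [Prod.snd_add, h1]; simp

lemma IsPeeling.prodMap [FiniteDimensional F V] {ε : F} (hε : ε * ε = 1)
    {A B : End F V} {H : Submodule F V} {v : V}
    {f : F[X]} (h : IsPeeling ε A B H v f) (hv : v ∈ H) {d : ℕ} (hd0 : 0 < d) {q g : F[X]}
    (hq : q.Monic) (hqd : q.natDegree = d) (hg : g.Monic) (hgd : g.natDegree = d)
    (hgq : g.coeff 0 = ε * q.coeff 0) (hq0 : q.coeff 0 ≠ 0)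
    (one : degreeLT F d) (hone : (one : F[X]) = 1) :
    IsPeeling ε ((shiftMod q hq hqd).prodMap A) (glueEnd g hg hgd B v)
      ((topCoeff F d).ker.prod H) (one, 0) (g * f) where
  injective := by
    have hε0 : ε ≠ 0 := left_ne_zero_of_mul_eq_one hε
    have hg0 : g.coeff 0 ≠ 0 := by rw [hgq]; exact mul_ne_zero hε0 hq0
    rw [injective_iff_map_eq_zero]
    rintro ⟨x, w⟩ hxw
    rw [glueEnd_apply, Prod.mk_eq_zero] at hxw
    have hx : x = 0 := shiftMod_injective hg hgd hg0 (by rw [hxw.1, map_zero])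
    subst hx
    have hw : B w = 0 := by simpa using hxw.2
    rw [Prod.mk_eq_zero]
    exact ⟨rfl, h.injective (by rw [hw, map_zero])⟩
  eq_on := by
    rintro ⟨x, w⟩ ⟨hx, hw⟩
    have hx' : (x : F[X]).coeff (d - 1) = 0 := hx
    rw [glueEnd_apply, hx', LinearMap.prodMap_apply, h.eq_on w hw]
    ext1
    · ext1; simp [shiftMod_coe, hx']
    · simp
  defect := by
    rintro ⟨x, w⟩
    obtain ⟨z, hz, hwz⟩ := h.defect w
    obtain ⟨n, rfl⟩ : ∃ n, d = n + 1 := ⟨d - 1, by omega⟩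
    set l := (x : F[X]).coeff (n + 1 - 1) with hl
    have hr : divX (q - C ε * g) ∈ degreeLT F (n + 1) := by
      refine divX_mem_degreeLT (mem_degreeLT_succ ?_)
      refine (natDegree_sub_le _ _).trans (max_le hqd.le ((natDegree_C_mul_le _ _).trans hgd.le))
    let y : degreeLT F (n + 1) := (1 - ε) • x - l • ⟨divX (q - C ε * g), hr⟩
    have hy : (y : F[X]) = C (1 - ε) * (x : F[X]) - C l * divX (q - C ε * g) := by
      simp [y, smul_eq_C_mul]
    have hq1 : q.coeff (n + 1) = 1 := by rw [← hqd]; exact hq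
    have hg1 : g.coeff (n + 1) = 1 := by rw [← hgd]; exact hg
    have hyl : (y : F[X]).coeff (n + 1 - 1) = 0 := by
      rw [hy, coeff_sub, coeff_C_mul, coeff_C_mul, ← hl, coeff_divX, Nat.add_sub_cancel]
      simp only [coeff_sub, coeff_C_mul, hq1, hg1]
      ring
    have hX : X * divX (q - C ε * g) = q - C ε * g := by
      have := X_mul_divX_add (q - C ε * g)
      have h0 : (q - C ε * g).coeff 0 = 0 := by
        simp only [coeff_sub, coeff_C_mul, hgq]
        linear_combination -(q.coeff 0) * hε
      rwa [h0, map_zero, add_zero] at this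
    refine ⟨(y, z - (ε * l) • v), ⟨hyl, H.sub_mem hz (H.smul_mem _ hv)⟩, ?_⟩
    rw [glueEnd_apply, glueEnd_apply, LinearMap.prodMap_apply, ← hl, hyl]
    ext1
    · ext1
      simp only [Prod.smul_mk, Prod.fst_sub, Submodule.coe_sub, Submodule.coe_smul, shiftMod_coe,
        ← hl, hyl, smul_eq_C_mul, map_zero, zero_mul, sub_zero]
      rw [hy]
      simp only [map_sub, map_one]
      linear_combination C l * hX
    · simp only [Prod.smul_mk, Prod.snd_sub, zero_smul, add_zero, map_sub, map_smul, ← hwz]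
      module
  cyclic :=
    { monic := hg.mul h.cyclic.monic
      natDegree_eq := by
        have : FiniteDimensional F (degreeLT F d) := Module.Finite.equiv (degreeLTEquiv F d).symm
        rw [hg.natDegree_mul h.cyclic.monic, finrank_prod, h.cyclic.natDegree_eq,
          (degreeLTEquiv F d).finrank_eq, finrank_fin_fun, hgd]
      aeval_eq_zero := by
        have hinr : ∀ (p : F[X]) (w : V),
            aeval (glueEnd g hg hgd B v) p (0, w) = (0, aeval B p w) := by
          intro p w
          induction p using Polynomial.induction_on' with
          | add p r hp hr => simp [hp, hr]
          | monomial n a =>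
            induction n with
            | zero => simp [monomial_zero_left, Module.algebraMap_end_apply]
            | succ n ih =>
              rw [← X_mul_monomial, aeval_X_mul_apply, ih, glueEnd_apply, aeval_X_mul_apply]
              simp
        rw [mul_comm, aeval_mul_apply, aeval_glueEnd_self hd0 hg hgd B v one hone, hinr,
          aeval_apply_comm, h.cyclic.aeval_eq_zero, map_zero]
        rfl
      eq_top := by
        intro M hM hinv
        have h1 : ∀ p : degreeLT F d, (p, (0 : V)) ∈ M := fun p => by
          rw [← aeval_glueEnd_of_mem hg hgd B v one hone d le_rfl p p.2 p.2]
          exact aeval_mem_of_invariant hinv hM _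
        have h2 : ((0 : degreeLT F d), B v) ∈ M := by
          rw [← aeval_glueEnd_self hd0 hg hgd B v one hone]
          exact aeval_mem_of_invariant hinv hM _
        have h3 : M.comap (LinearMap.inr F (degreeLT F d) V) = ⊤ := by
          have hinv' : ∀ x ∈ M.comap (LinearMap.inr F (degreeLT F d) V),
              B x ∈ M.comap (LinearMap.inr F (degreeLT F d) V) := fun x hx => by
            have := hinv _ hx
            rw [LinearMap.inr_apply, glueEnd_apply] at this
            simpa using this
          exact h.cyclic.eq_top _ (mem_of_apply_mem_of_injective h.injective hinv' h2) hinv'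
        rw [eq_top_iff]
        rintro ⟨x, w⟩ _
        have h4 : w ∈ M.comap (LinearMap.inr F (degreeLT F d) V) := by rw [h3]; trivial
        simpa using M.add_mem (h1 x) h4 }

end Peeling

section Choice

variable {F : Type*} [Field F]

open Module

/-- The product of the polynomials `X ^ 2 - τ X + κ` for `τ` in the list `L`. -/
noncomputable def quadProd (κ : F) (L : List F) : F[X] :=
  (L.map fun τ => X ^ 2 - C τ * X + C κ).prod

lemma quadProd_cons (κ τ : F) (L : List F) :
    quadProd κ (τ :: L) = (X ^ 2 - C τ * X + C κ) * quadProd κ L := by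
  simp [quadProd]

lemma quadProd_append (κ : F) (L L' : List F) :
    quadProd κ (L ++ L') = quadProd κ L * quadProd κ L' := by
  simp [quadProd]

lemma monic_monicQuadratic (κ τ : F) : (X ^ 2 - C τ * X + C κ).Monic := by
  monicity!

lemma natDegree_monicQuadratic (κ τ : F) : (X ^ 2 - C τ * X + C κ).natDegree = 2 := by
  compute_degree!

lemma monic_quadProd (κ : F) (L : List F) : (quadProd κ L).Monic := by
  induction L with
  | nil => simp [quadProd]
  | cons τ L ih => rw [quadProd_cons]; exact (monic_monicQuadratic κ τ).mul ih

lemma natDegree_quadProd (κ : F) (L : List F) : (quadProd κ L).natDegree = 2 * L.length := by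
  induction L with
  | nil => simp [quadProd]
  | cons τ L ih =>
    rw [quadProd_cons, (monic_monicQuadratic κ τ).natDegree_mul (monic_quadProd κ L), ih,
      natDegree_monicQuadratic, List.length_cons]
    ring

lemma monic_linProd (L : List F) (μ : F → F) : (L.map fun τ => X - C (μ τ)).prod.Monic := by
  induction L with
  | nil => simp
  | cons τ L ih => rw [List.map_cons, List.prod_cons]; exact (monic_X_sub_C _).mul ih

lemma natDegree_linProd (L : List F) (μ : F → F) :
    (L.map fun τ => X - C (μ τ)).prod.natDegree = L.length := by
  induction L with
  | nil => simp
  | cons τ L ih =>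
    rw [List.map_cons, List.prod_cons, (monic_X_sub_C _).natDegree_mul (monic_linProd L μ), ih,
      natDegree_X_sub_C, List.length_cons, add_comm]

lemma exists_filler (κ : F) (d p : ℕ) (hp : p ≤ 1) :
    ∃ (h : F[X]) (L : List F) (p' j : ℕ), p' ≤ 1 ∧ h.Monic ∧ h.natDegree = d ∧
      h.coeff 0 = (-1) ^ d * κ ^ j ∧ (X - 1) ^ p * h = quadProd κ L * (X - 1) ^ p' := by
  induction d with
  | zero => exact ⟨1, [], p, 0, hp, monic_one, by simp, by simp, by simp [quadProd]⟩
  | succ d ih =>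
    obtain ⟨h, L, p', j, hp', hm, hd, h0, heq⟩ := ih
    have hXC : ∀ c : F, (h * (X - C c)).Monic ∧ (h * (X - C c)).natDegree = d + 1 :=
      fun c => ⟨hm.mul (monic_X_sub_C c), by
        rw [hm.natDegree_mul (monic_X_sub_C c), natDegree_X_sub_C, hd]⟩
    rcases Nat.le_one_iff_eq_zero_or_eq_one.1 hp' with rfl | rfl
    · refine ⟨h * (X - C 1), L, 1, j, le_rfl, (hXC 1).1, (hXC 1).2, ?_, ?_⟩
      · simp [mul_coeff_zero, h0]; ring
      · rw [← mul_assoc, heq]; simp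
    · refine ⟨h * (X - C κ), (1 + κ) :: L, 0, j + 1, zero_le_one, (hXC κ).1, (hXC κ).2, ?_, ?_⟩
      · simp [mul_coeff_zero, h0]; ring
      · rw [← mul_assoc, heq, quadProd_cons]
        simp only [map_add, map_one]
        ring

/-- The block-diagonal endomorphism with blocks `shiftMod (q i)`. -/
noncomputable def blockShift {n : ℕ} (q : Fin n → F[X]) (hq : ∀ i, (q i).Monic) :
    End F (∀ i, degreeLT F (q i).natDegree) :=
  LinearMap.pi fun i => (shiftMod (q i) (hq i) rfl).comp (LinearMap.proj i)

/-- Splitting off the component of index `p`. -/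
noncomputable def piSuccAboveEquiv (F : Type*) [Field F] {n : ℕ} (M : Fin (n + 1) → Type*)
    [∀ i, AddCommGroup (M i)] [∀ i, Module F (M i)] (p : Fin (n + 1)) :
    (∀ i, M i) ≃ₗ[F] M p × (∀ i, M (p.succAbove i)) :=
  { (Fin.insertNthEquiv M p).symm with
    map_add' := fun _ _ => rfl
    map_smul' := fun _ _ => rfl }

lemma piSuccAboveEquiv_blockShift {n : ℕ} (q : Fin (n + 1) → F[X]) (hq : ∀ i, (q i).Monic)
    (p : Fin (n + 1)) (x : ∀ i, degreeLT F (q i).natDegree) :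
    piSuccAboveEquiv F (fun i => ↥(degreeLT F (q i).natDegree)) p (blockShift q hq x) =
      (shiftMod (q p) (hq p) rfl).prodMap
        (blockShift (fun i => q (p.succAbove i)) fun _ => hq _)
        (piSuccAboveEquiv F (fun i => ↥(degreeLT F (q i).natDegree)) p x) := rfl

lemma one_mem_degreeLT {d : ℕ} (hd : 0 < d) : (1 : F[X]) ∈ degreeLT F d := by
  rw [mem_degreeLT, degree_one]
  exact_mod_cast hd

lemma exists_isPeeling_blockShift {ε κ : F} (hε : ε * ε = 1) (hκ : κ * κ = 1) (n : ℕ)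
    (q : Fin n → F[X]) (hq : ∀ i, (q i).Monic) (hdeg : ∀ i, 2 ≤ (q i).natDegree)
    (h0 : ∀ i, (q i).coeff 0 ≠ 0) :
    ∃ p i : ℕ, p ≤ 1 ∧ ∀ b : F, b ≠ 0 → ∃ f L B H v, IsPeeling ε (blockShift q hq) B H v f ∧
      v ∈ H ∧ f * (X - C b) =
        (X - C (κ ^ i * (∏ j, ε * ((-1) ^ (q j).natDegree * (q j).coeff 0)) * b)) *
          quadProd κ L * (X - 1) ^ p := by
  induction n with
  | zero =>
    refine ⟨0, 0, zero_le_one, fun b _ => ⟨1, [], 1, ⊤, 0, isPeeling_of_subsingleton _ _, trivial,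
      by simp [quadProd]⟩⟩
  | succ n ih =>
    obtain ⟨p, i, hp, hP⟩ := ih (fun j => q ((0 : Fin (n + 1)).succAbove j)) (fun j => hq _)
      (fun j => hdeg _) (fun j => h0 _)
    obtain ⟨h, L', p', k, hp', hm, hd, hc, heq⟩ :=
      exists_filler κ ((q 0).natDegree - 2) p hp
    refine ⟨p', k + 1 + i, hp', fun b hb => ?_⟩
    obtain ⟨f, L, B, H, v, hpeel, hv, hf⟩ := hP b hb
    have hε0 : ε ≠ 0 := left_ne_zero_of_mul_eq_one hε
    have hκ0 : κ ≠ 0 := left_ne_zero_of_mul_eq_one hκ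
    set e := κ ^ i * (∏ j, ε * ((-1) ^ (q ((0 : Fin (n + 1)).succAbove j)).natDegree *
      (q ((0 : Fin (n + 1)).succAbove j)).coeff 0)) * b with he
    have he0 : e ≠ 0 := by
      refine mul_ne_zero (mul_ne_zero (pow_ne_zero _ hκ0) (Finset.prod_ne_zero_iff.2 fun j _ => ?_))
        hb
      exact mul_ne_zero hε0 (mul_ne_zero (by simp) (h0 _))
    set e' := κ ^ (k + 1) * (ε * ((-1) ^ (q 0).natDegree * (q 0).coeff 0)) * e with he'
    set g : F[X] := (X - C (κ / e)) * (X - C e') * h with hg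
    have hgm : g.Monic := ((monic_X_sub_C _).mul (monic_X_sub_C _)).mul hm
    have hgd : g.natDegree = (q 0).natDegree := by
      rw [hg, ((monic_X_sub_C _).mul (monic_X_sub_C _)).natDegree_mul hm,
        (monic_X_sub_C _).natDegree_mul (monic_X_sub_C _), natDegree_X_sub_C, natDegree_X_sub_C, hd]
      have := hdeg 0
      omega
    have hg0 : g.coeff 0 = ε * (q 0).coeff 0 := by
      obtain ⟨m, hm⟩ : ∃ m, (q 0).natDegree = m + 2 := ⟨(q 0).natDegree - 2, by
        have := hdeg 0; omega⟩
      have hκk : κ ^ k * κ ^ k = 1 := by rw [← mul_pow, hκ, one_pow]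
      have h1m : ((-1 : F) ^ m) * (-1) ^ m = 1 := by rw [← mul_pow]; simp
      rw [hg, mul_coeff_zero, mul_coeff_zero, hc, he', hm]
      simp only [coeff_sub, coeff_X_zero, coeff_C_zero, zero_sub, Nat.add_sub_cancel, pow_succ]
      calc _ = (κ / e * e) * κ * (κ ^ k * κ ^ k) * (((-1 : F) ^ m) * (-1) ^ m) *
            (ε * (q 0).coeff 0) := by
            ring
        _ = _ := by rw [div_mul_cancel₀ _ he0, hκ, hκk, h1m]; ring
    have hq0 : 0 < (q 0).natDegree := by have := hdeg 0; omega
    have hpeel' := hpeel.prodMap hε hv hq0 (hq 0) rfl hgm hgd hg0 (h0 0)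
      ⟨1, one_mem_degreeLT hq0⟩ rfl
    have := hpeel'.of_equiv (piSuccAboveEquiv F (fun i => ↥(degreeLT F (q i).natDegree)) 0)
      (piSuccAboveEquiv_blockShift q hq 0)
    refine ⟨_, (e + κ / e) :: (L ++ L'), _, _, _, this, ?_, ?_⟩
    · rw [Submodule.mem_comap]
      refine ⟨?_, ?_⟩
      · change (1 : F[X]).coeff ((q 0).natDegree - 1) = 0
        rw [coeff_one, if_neg]
        have := hdeg 0
        omega
      · exact H.zero_mem
    · have hprod : κ ^ (k + 1 + i) *
          (∏ j, ε * ((-1) ^ (q j).natDegree * (q j).coeff 0)) * b = e' := by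
        rw [he', he, Fin.prod_univ_succ, pow_add _ (k + 1)]
        simp only [Fin.zero_succAbove]
        ring
      rw [hprod, quadProd_cons, quadProd_append, mul_assoc g, hf, hg]
      have hC : (C e : F[X]) * C (κ / e) = C κ := by
        rw [← C_mul, mul_div_cancel₀ _ he0]
      rw [map_add, ← hC]
      linear_combination (X - C (κ / e)) * (X - C e') * (X - C e) * quadProd κ L * heq

lemma exists_isPeeling_prodMap {ε κ : F} (hε : ε * ε = 1) (hκ : κ * κ = 1) {n : ℕ}
    (q : Fin n → F[X]) (hq : ∀ i, (q i).Monic) (hdeg : ∀ i, 2 ≤ (q i).natDegree)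
    (h0 : ∀ i, (q i).coeff 0 ≠ 0) {q₀ : F[X]} (hq₀ : q₀.Monic) (hdeg₀ : 0 < q₀.natDegree)
    (h0₀ : q₀.coeff 0 ≠ 0) :
    ∃ p i L B H v, p ≤ 1 ∧
      IsPeeling ε ((shiftMod q₀ hq₀ rfl).prodMap (blockShift q hq)) B H v
        ((X - C (κ ^ i * (ε * ((-1) ^ q₀.natDegree * q₀.coeff 0) *
          ∏ j, ε * ((-1) ^ (q j).natDegree * (q j).coeff 0)))) *
          quadProd κ L * (X - 1) ^ p) := by
  obtain ⟨p, i, hp, hP⟩ := exists_isPeeling_blockShift hε hκ n q hq hdeg h0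
  obtain ⟨h, L', p', k, hp', hm, hd, hc, heq⟩ := exists_filler κ (q₀.natDegree - 1) p hp
  have hε0 : ε ≠ 0 := left_ne_zero_of_mul_eq_one hε
  have hκ0 : κ ≠ 0 := left_ne_zero_of_mul_eq_one hκ
  set b := κ ^ k * (ε * ((-1) ^ q₀.natDegree * q₀.coeff 0)) with hb
  have hb0 : b ≠ 0 :=
    mul_ne_zero (pow_ne_zero _ hκ0) (mul_ne_zero hε0 (mul_ne_zero (by simp) h0₀))
  obtain ⟨f, L, B, H, v, hpeel, hv, hf⟩ := hP b hb0
  have hgm : ((X - C b) * h).Monic := (monic_X_sub_C _).mul hm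
  have hgd : ((X - C b) * h).natDegree = q₀.natDegree := by
    rw [(monic_X_sub_C _).natDegree_mul hm, natDegree_X_sub_C, hd]
    omega
  have hg0 : ((X - C b) * h).coeff 0 = ε * q₀.coeff 0 := by
    obtain ⟨m, hm⟩ : ∃ m, q₀.natDegree = m + 1 := ⟨q₀.natDegree - 1, by omega⟩
    have hκk : κ ^ k * κ ^ k = 1 := by rw [← mul_pow, hκ, one_pow]
    have h1m : ((-1 : F) ^ m) * (-1) ^ m = 1 := by rw [← mul_pow]; simp
    rw [mul_coeff_zero, hc, hb, hm]
    simp only [coeff_sub, coeff_X_zero, coeff_C_zero, zero_sub, Nat.add_sub_cancel, pow_succ]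
    calc _ = (κ ^ k * κ ^ k) * (((-1 : F) ^ m) * (-1) ^ m) * (ε * q₀.coeff 0) := by ring
      _ = _ := by rw [hκk, h1m]; ring
  have hpeel' := hpeel.prodMap hε hv hdeg₀ hq₀ rfl hgm hgd hg0 h0₀
      ⟨1, one_mem_degreeLT hdeg₀⟩ rfl
  have hprod : κ ^ (k + i) * (ε * ((-1) ^ q₀.natDegree * q₀.coeff 0) *
      ∏ j, ε * ((-1) ^ (q j).natDegree * (q j).coeff 0)) =
      κ ^ i * (∏ j, ε * ((-1) ^ (q j).natDegree * (q j).coeff 0)) * b := by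
    rw [hb, pow_add]; ring
  have hpoly : (X - C b) * h * f = (X - C (κ ^ (k + i) *
      (ε * ((-1) ^ q₀.natDegree * q₀.coeff 0) *
        ∏ j, ε * ((-1) ^ (q j).natDegree * (q j).coeff 0)))) *
          quadProd κ (L ++ L') * (X - 1) ^ p' := by
    rw [quadProd_append, hprod]
    linear_combination h * hf + (X - C (κ ^ i *
      (∏ j, ε * ((-1) ^ (q j).natDegree * (q j).coeff 0)) * b)) * quadProd κ L * heq
  exact ⟨p', k + i, L ++ L', _, _, _, hp', hpoly ▸ hpeel'⟩

end Choice

section Models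

variable {F : Type*} [Field F]

open Module

/-- The residue class of the polynomial `r` modulo `P`. -/
noncomputable def quotMk (P r : F[X]) : F[X] ⧸ Ideal.span {P} :=
  Ideal.Quotient.mk (Ideal.span {P}) r

lemma quotMk_surjective (P : F[X]) : Function.Surjective (quotMk P) :=
  Ideal.Quotient.mk_surjective

lemma quotMk_add (P r s : F[X]) : quotMk P (r + s) = quotMk P r + quotMk P s := rfl

lemma quotMk_sub (P r s : F[X]) : quotMk P (r - s) = quotMk P r - quotMk P s := rfl

lemma smul_quotMk (P r : F[X]) (a : F) : a • quotMk P r = quotMk P (C a * r) := by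
  rw [← smul_eq_C_mul]; rfl

lemma quotMk_eq_zero_iff (P r : F[X]) : quotMk P r = 0 ↔ P ∣ r := by
  rw [quotMk, Ideal.Quotient.eq_zero_iff_dvd]

lemma quotMk_zero (P : F[X]) : quotMk P 0 = 0 := rfl

/-- Multiplication by `b`, from polynomials modulo `P` to polynomials modulo `Q`. -/
noncomputable def quotMul (P Q b : F[X]) (h : Q ∣ b * P) :
    (F[X] ⧸ Ideal.span {P}) →ₗ[F] (F[X] ⧸ Ideal.span {Q}) :=
  (Submodule.mapQ (Ideal.span {P}) (Ideal.span {Q}) (LinearMap.mulLeft F[X] b) (by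
    rw [Ideal.span, Submodule.span_le, Set.singleton_subset_iff]
    simpa [Ideal.mem_span_singleton] using h)).restrictScalars F

lemma quotMul_mk (P Q b : F[X]) (h : Q ∣ b * P) (r : F[X]) :
    quotMul P Q b h (quotMk P r) = quotMk Q (b * r) := rfl

/-- The action of the polynomial matrix `!![a, b; c, d]` on pairs of polynomials modulo `Q`
and `P`. -/
noncomputable def polyBlock (P Q a b c d : F[X]) (hb : Q ∣ b * P) (hc : P ∣ c * Q) :
    End F ((F[X] ⧸ Ideal.span {Q}) × (F[X] ⧸ Ideal.span {P})) :=
  LinearMap.prod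
    ((quotMul Q Q a (dvd_mul_left _ _)).coprod (quotMul P Q b hb))
    ((quotMul Q P c hc).coprod (quotMul P P d (dvd_mul_left _ _)))

lemma polyBlock_mk (P Q a b c d : F[X]) (hb : Q ∣ b * P) (hc : P ∣ c * Q) (r s : F[X]) :
    polyBlock P Q a b c d hb hc (quotMk Q r, quotMk P s) =
      (quotMk Q (a * r + b * s), quotMk P (c * r + d * s)) := by
  simp [polyBlock, quotMul_mk, quotMk_add]

lemma finiteDimensional_quotient {P : F[X]} (hP : P.Monic) :
    FiniteDimensional F (F[X] ⧸ Ideal.span {P}) := hP.finite_quotient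

lemma end_prod_quotient_ext {P Q : F[X]} {V : Type*} [AddCommGroup V] [Module F V]
    {S T : ((F[X] ⧸ Ideal.span {Q}) × (F[X] ⧸ Ideal.span {P})) →ₗ[F] V}
    (h : ∀ r s, S (quotMk Q r, quotMk P s) = T (quotMk Q r, quotMk P s)) : S = T := by
  refine LinearMap.ext fun ⟨x, y⟩ => ?_
  obtain ⟨r, rfl⟩ := quotMk_surjective Q x
  obtain ⟨s, rfl⟩ := quotMk_surjective P y
  exact h r s

lemma hasCyclicVector_polyBlock {κ α γ η c₀ : F} (hα : α ≠ 0) (hc₀ : c₀ ≠ 0)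
    (hκ : κ ≠ 0) (L : List F) (j : ℕ) {P Q a b d : F[X]}
    (hP : P = (L.map fun τ => X - C ((τ - γ) / α)).prod) (hQ : Q = X ^ j * P)
    (hb : Q ∣ b * P) (hc : P ∣ C c₀ * Q) (htr : a + d = C α * X + C γ)
    (hdet : a * d - b * C c₀ = C κ)
    (hη : ∃ r s, aeval (polyBlock P Q a b (C c₀) d hb hc) ((X - C η) ^ j) (quotMk Q 1, quotMk P 0) =
      (quotMk Q (X ^ j * r), quotMk P s)) :
    HasCyclicVector (polyBlock P Q a b (C c₀) d hb hc) (quotMk Q 1, quotMk P 0)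
      (quadProd κ L * (X - C η) ^ j) := by
  set T := polyBlock P Q a b (C c₀) d hb hc with hT
  have hPm : P.Monic := hP ▸ monic_linProd L _
  have hQm : Q.Monic := hQ ▸ (monic_X_pow j).mul hPm
  have := finiteDimensional_quotient hPm
  have := finiteDimensional_quotient hQm
  -- the Cayley-Hamilton relation
  have hTT : ∀ r s, T (T (quotMk Q r, quotMk P s)) =
      T (quotMk Q ((C α * X + C γ) * r), quotMk P ((C α * X + C γ) * s)) -
        κ • (quotMk Q r, quotMk P s) := by
    intro r s
    simp only [hT, polyBlock_mk, Prod.smul_mk, smul_quotMk, Prod.mk_sub_mk, ← quotMk_sub]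
    refine Prod.ext (congrArg (quotMk Q) ?_) (congrArg (quotMk P) ?_)
    · linear_combination (a * r + b * s) * htr - r * hdet
    · linear_combination (C c₀ * r + d * s) * htr - s * hdet
  have hquad : ∀ (L : List F) (r s : F[X]), ∃ (m : ℕ) (u : F),
      aeval T (quadProd κ L) (quotMk Q r, quotMk P s) =
        (T ^ m) (quotMk Q (C u * (L.map fun τ => X - C ((τ - γ) / α)).prod * r),
          quotMk P (C u * (L.map fun τ => X - C ((τ - γ) / α)).prod * s)) := by
    intro L
    induction L with
    | nil => intro r s; exact ⟨0, 1, by simp [quadProd]⟩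
    | cons τ L ih =>
      intro r s
      have hstep : aeval T (X ^ 2 - C τ * X + C κ) (quotMk Q r, quotMk P s) =
          T (quotMk Q (C α * (X - C ((τ - γ) / α)) * r),
            quotMk P (C α * (X - C ((τ - γ) / α)) * s)) := by
        have h1 : aeval T (X ^ 2 - C τ * X + C κ) (quotMk Q r, quotMk P s) =
            T (T (quotMk Q r, quotMk P s)) - τ • T (quotMk Q r, quotMk P s) +
              κ • (quotMk Q r, quotMk P s) := by
          simp [pow_two, Module.algebraMap_end_apply]
        have h2 : C α * C ((τ - γ) / α) = C τ - C γ := by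
          rw [← C_mul, mul_div_cancel₀ _ hα, C_sub]
        rw [h1, hTT, sub_right_comm, sub_add_cancel, ← map_smul, ← map_sub]
        simp only [Prod.smul_mk, smul_quotMk, Prod.mk_sub_mk, ← quotMk_sub]
        refine congrArg T (Prod.ext (congrArg (quotMk Q) ?_) (congrArg (quotMk P) ?_))
        · linear_combination r * h2
        · linear_combination s * h2
      obtain ⟨m, u, hm⟩ := ih (C α * (X - C ((τ - γ) / α)) * r) (C α * (X - C ((τ - γ) / α)) * s)
      refine ⟨m + 1, u * α, ?_⟩
      rw [quadProd_cons, mul_comm, aeval_mul_apply, hstep, aeval_apply_comm, hm, pow_succ',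
        Module.End.mul_apply]
      refine congrArg T (congrArg (T ^ m)
        (Prod.ext (congrArg (quotMk Q) ?_) (congrArg (quotMk P) ?_))) <;>
      · rw [List.map_cons, List.prod_cons, C_mul]
        ring
  refine ⟨(monic_quadProd κ L).mul ((monic_X_sub_C _).pow _), ?_, ?_, ?_⟩
  · rw [finrank_prod, finrank_quotient_span_eq_natDegree, finrank_quotient_span_eq_natDegree, hQ,
      (monic_X_pow j).natDegree_mul hPm, hP, natDegree_linProd,
      (monic_quadProd κ L).natDegree_mul ((monic_X_sub_C _).pow _), natDegree_quadProd,
      (monic_X_sub_C η).natDegree_pow, natDegree_X_sub_C, natDegree_X_pow]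
    ring
  · obtain ⟨r, s, hrs⟩ := hη
    rw [aeval_mul_apply, hrs]
    obtain ⟨m, u, hm⟩ := hquad L (X ^ j * r) s
    rw [hm, ← hP, (quotMk_eq_zero_iff _ _).2, (quotMk_eq_zero_iff _ _).2]
    · exact map_zero _
    · exact ⟨C u * s, by ring⟩
    · exact ⟨C u * r, by rw [hQ]; ring⟩
  · intro M hM hinv
    have hinj : Function.Injective T := by
      rw [injective_iff_map_eq_zero]
      rintro ⟨x, y⟩ hxy
      obtain ⟨r, rfl⟩ := quotMk_surjective Q x
      obtain ⟨s, rfl⟩ := quotMk_surjective P y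
      have hadj : polyBlock P Q d (-b) (-C c₀) a (by simpa using hb) (by simpa using hc)
          (T (quotMk Q r, quotMk P s)) = κ • (quotMk Q r, quotMk P s) := by
        simp only [hT, polyBlock_mk, Prod.smul_mk, smul_quotMk]
        refine Prod.ext (congrArg (quotMk Q) ?_) (congrArg (quotMk P) ?_)
        · linear_combination r * hdet
        · linear_combination s * hdet
      rw [hxy, map_zero] at hadj
      exact (smul_eq_zero.1 hadj.symm).resolve_left hκ
    have hXM : ∀ r s, (quotMk Q r, quotMk P s) ∈ M →
        (quotMk Q (X * r), quotMk P (X * s)) ∈ M := by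
      intro r s hrs
      have h1 : (quotMk Q ((C α * X + C γ) * r), quotMk P ((C α * X + C γ) * s)) ∈ M := by
        refine mem_of_apply_mem_of_injective hinj hinv ?_
        have := M.add_mem (hinv _ (hinv _ hrs)) (M.smul_mem κ hrs)
        rwa [hTT, sub_add_cancel] at this
      have h2 := M.smul_mem α⁻¹ (M.sub_mem h1 (M.smul_mem γ hrs))
      simp only [Prod.smul_mk, smul_quotMk, Prod.mk_sub_mk, ← quotMk_sub] at h2
      have h3 : C α⁻¹ * C α = (1 : F[X]) := by rw [← C_mul, inv_mul_cancel₀ hα, C_1]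
      convert h2 using 2
      · refine congrArg (quotMk Q) ?_
        linear_combination -(X * r) * h3
      · refine congrArg (quotMk P) ?_
        linear_combination -(X * s) * h3
    have h1 : ∀ p r s, (quotMk Q r, quotMk P s) ∈ M →
        (quotMk Q (p * r), quotMk P (p * s)) ∈ M := by
      intro p r s hrs
      induction p using Polynomial.induction_on' with
      | add p q hp hq =>
        have := M.add_mem hp hq
        simpa only [Prod.mk_add_mk, ← quotMk_add, ← add_mul] using this
      | monomial n u =>
        induction n with
        | zero =>
          have := M.smul_mem u hrs
          simpa only [Prod.smul_mk, smul_quotMk, monomial_zero_left] using this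
        | succ n ih =>
          have := hXM _ _ ih
          simpa only [← mul_assoc, X_mul_monomial] using this
    have h2 : ∀ p, (quotMk Q p, quotMk P 0) ∈ M := fun p => by
      simpa using h1 p 1 0 hM
    have h3 : ∀ p, (quotMk Q 0, quotMk P p) ∈ M := fun p => by
      have h4 : (quotMk Q 0, quotMk P (C c₀)) ∈ M := by
        have := M.sub_mem (hinv _ hM) (h2 a)
        rw [hT, polyBlock_mk, Prod.mk_sub_mk, ← quotMk_sub, ← quotMk_sub] at this
        simpa using this
      have h5 := h1 (p * C c₀⁻¹) _ _ h4
      rwa [mul_zero, mul_assoc, ← C_mul, inv_mul_cancel₀ hc₀, C_1, mul_one] at h5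
    rw [eq_top_iff]
    rintro ⟨x, y⟩ -
    obtain ⟨r, rfl⟩ := quotMk_surjective Q x
    obtain ⟨s, rfl⟩ := quotMk_surjective P y
    simpa [quotMk_zero] using M.add_mem (h2 r) (h3 s)

end Models

section Models

variable {F : Type*} [Field F]

open Module

lemma exists_isDoubleProd_one_one (L : List F) {j : ℕ} (hj : j ≤ 1) :
    ∃ (P Q : F[X]) (_ : P.Monic) (_ : Q.Monic)
      (T : End F ((F[X] ⧸ Ideal.span {Q}) × (F[X] ⧸ Ideal.span {P}))) (w : _),
      HasCyclicVector T w (quadProd 1 L * (X - C 1) ^ j) ∧ IsDoubleProd (1 : F) 1 T := by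
  set P := (L.map fun τ => X - C ((τ - 2) / 1)).prod with hP
  set Q := X ^ j * P with hQ
  have hPm : P.Monic := monic_linProd L _
  have hQm : Q.Monic := (monic_X_pow j).mul hPm
  have hb : Q ∣ X * P := mul_dvd_mul_right (pow_dvd_pow X hj |>.trans (by simp)) P
  have hc : P ∣ C 1 * Q := ⟨X ^ j, by rw [hQ, C_1]; ring⟩
  refine ⟨P, Q, hPm, hQm, polyBlock P Q 1 X (C 1) (1 + X) hb hc, (quotMk Q 1, quotMk P 0),
    hasCyclicVector_polyBlock (α := 1) (γ := 2) one_ne_zero one_ne_zero one_ne_zero L j hP hQ hb hc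
      ?_ ?_ ?_, polyBlock P Q 1 0 (C 1) 1 (by simp) hc, polyBlock P Q 1 X 0 1 hb (by simp), ?_, ?_,
      ?_⟩
  · rw [C_1, show (C 2 : F[X]) = 2 from rfl]; ring
  · rw [C_1]; ring
  · interval_cases j
    · exact ⟨1, 0, by simp⟩
    · refine ⟨0, 1, ?_⟩
      simp only [pow_one, map_sub, aeval_X, aeval_C, LinearMap.sub_apply, polyBlock_mk,
        Module.algebraMap_end_apply, Prod.smul_mk, smul_quotMk, Prod.mk_sub_mk, ← quotMk_sub]
      simp
  · rw [isQuad_one_iff]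
    refine end_prod_quotient_ext fun r s => ?_
    simp only [Module.End.mul_apply, LinearMap.sub_apply, polyBlock_mk, Module.End.one_apply,
      Prod.mk_sub_mk, ← quotMk_sub]
    refine Prod.ext (congrArg (quotMk Q) ?_) (congrArg (quotMk P) ?_) <;> ring
  · rw [isQuad_one_iff]
    refine end_prod_quotient_ext fun r s => ?_
    simp only [Module.End.mul_apply, LinearMap.sub_apply, polyBlock_mk, Module.End.one_apply,
      Prod.mk_sub_mk, ← quotMk_sub]
    refine Prod.ext (congrArg (quotMk Q) ?_) (congrArg (quotMk P) ?_) <;> ring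
  · refine end_prod_quotient_ext fun r s => ?_
    simp only [Module.End.mul_apply, polyBlock_mk]
    refine Prod.ext (congrArg (quotMk Q) ?_) (congrArg (quotMk P) ?_)
    · ring
    · rw [C_1]; ring

lemma exists_isDoubleProd_neg_one_one (h2 : (2 : F) ≠ 0) {η : F} (hη : η * η = 1) (L : List F)
    {j : ℕ} (hj : j ≤ 2) :
    ∃ (P Q : F[X]) (_ : P.Monic) (_ : Q.Monic)
      (T : End F ((F[X] ⧸ Ideal.span {Q}) × (F[X] ⧸ Ideal.span {P}))) (w : _),
      HasCyclicVector T w (quadProd (-1) L * (X - C η) ^ j) ∧ IsDoubleProd (-1 : F) 1 T := by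
  set P := (L.map fun τ => X - C ((τ - 0) / (2 * η))).prod with hP
  set Q := X ^ j * P with hQ
  have hη0 : η ≠ 0 := left_ne_zero_of_mul_eq_one hη
  have hηC : C η * C η = (1 : F[X]) := by rw [← C_mul, hη, C_1]
  have hPm : P.Monic := monic_linProd L _
  have hQm : Q.Monic := (monic_X_pow j).mul hPm
  have hX : Q ∣ X ^ 2 * P := mul_dvd_mul_right (pow_dvd_pow X hj) P
  have hb : Q ∣ -(C η * X ^ 2) * P := by
    rw [neg_mul, mul_assoc, dvd_neg]
    exact hX.mul_left _
  have hb' : Q ∣ -X ^ 2 * P := by rw [neg_mul, dvd_neg]; exact hX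
  have hc : P ∣ C (-η) * Q := ⟨C (-η) * X ^ j, by rw [hQ]; ring⟩
  have hc' : P ∣ 1 * Q := ⟨X ^ j, by rw [hQ]; ring⟩
  refine ⟨P, Q, hPm, hQm,
    polyBlock P Q (C η * (1 + X)) (-(C η * X ^ 2)) (C (-η)) (C η * (X - 1)) hb hc,
    (quotMk Q 1, quotMk P 0),
    hasCyclicVector_polyBlock (α := 2 * η) (γ := 0) (mul_ne_zero h2 hη0) (neg_ne_zero.2 hη0)
      (neg_ne_zero.2 one_ne_zero) L j hP hQ hb hc ?_ ?_ ?_,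
    polyBlock P Q (C η) 0 0 (-C η) (by simp) (by simp),
    polyBlock P Q (1 + X) (-X ^ 2) 1 (1 - X) hb' hc', ?_, ?_, ?_⟩
  · rw [C_0, C_mul, show (C 2 : F[X]) = 2 from rfl]; ring
  · rw [C_neg, C_neg, C_1]; linear_combination -hηC
  · interval_cases j
    · exact ⟨1, 0, by simp⟩
    · refine ⟨C η, C (-η), ?_⟩
      simp only [pow_one, map_sub, aeval_X, aeval_C, LinearMap.sub_apply, polyBlock_mk,
        Module.algebraMap_end_apply, Prod.smul_mk, smul_quotMk, Prod.mk_sub_mk, ← quotMk_sub]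
      refine Prod.ext (congrArg (quotMk Q) ?_) (congrArg (quotMk P) ?_) <;> ring
    · refine ⟨2, 2 - 2 * X, ?_⟩
      simp only [pow_two, map_mul, map_sub, aeval_X, aeval_C, LinearMap.sub_apply, polyBlock_mk,
        Module.End.mul_apply,
        Module.algebraMap_end_apply, Prod.smul_mk, smul_quotMk, Prod.mk_sub_mk, ← quotMk_sub]
      refine Prod.ext (congrArg (quotMk Q) ?_) (congrArg (quotMk P) ?_)
      · rw [C_neg]; linear_combination (2 * X ^ 2) * hηC
      · rw [C_neg]; linear_combination (2 - 2 * X) * hηC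
  · rw [isQuad_neg_one_iff]
    refine end_prod_quotient_ext fun r s => ?_
    simp only [Module.End.mul_apply, polyBlock_mk, Module.End.one_apply]
    refine Prod.ext (congrArg (quotMk Q) ?_) (congrArg (quotMk P) ?_)
    · linear_combination r * hηC
    · linear_combination s * hηC
  · rw [isQuad_one_iff]
    refine end_prod_quotient_ext fun r s => ?_
    simp only [Module.End.mul_apply, LinearMap.sub_apply, polyBlock_mk, Module.End.one_apply,
      Prod.mk_sub_mk, ← quotMk_sub]
    refine Prod.ext (congrArg (quotMk Q) ?_) (congrArg (quotMk P) ?_) <;> ring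
  · refine end_prod_quotient_ext fun r s => ?_
    simp only [Module.End.mul_apply, polyBlock_mk]
    refine Prod.ext (congrArg (quotMk Q) ?_) (congrArg (quotMk P) ?_)
    · ring
    · rw [C_neg]; ring

end Models

section Involutions

variable {F : Type*} [Field F]

open Module

lemma aeval_quadProd_one_dvd {R : Type*} [CommRing R] [Algebra F R] {x y : R} (h : x * y = 1)
    (L : List F) : aeval x (quadProd 1 L) ∣ aeval y (quadProd 1 L) := by
  induction L with
  | nil => simp [quadProd]
  | cons τ L ih =>
    rw [quadProd_cons, map_mul, map_mul]
    refine mul_dvd_mul ⟨y ^ 2, ?_⟩ ih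
    simp only [map_add, map_sub, map_mul, aeval_X, aeval_C, map_pow, map_one]
    linear_combination (algebraMap F R τ * y - x * y - 1) * h

lemma aeval_X_sub_C_dvd {R : Type*} [CommRing R] [Algebra F R] {x y : R} (h : x * y = 1)
    {e : F} (he : e * e = 1) : aeval x (X - C e) ∣ aeval y (X - C e) := by
  have he' := congrArg (algebraMap F R) he
  rw [map_mul, map_one] at he'
  refine ⟨-(algebraMap F R e) * y, ?_⟩
  simp only [map_sub, aeval_X, aeval_C]
  linear_combination (algebraMap F R e) * h - y * he'

lemma hasCyclicVector_mulLeft_root {f : F[X]} (hf : f.Monic) :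
    HasCyclicVector (LinearMap.mulLeft F (AdjoinRoot.root f)) 1 f := by
  have h1 : ∀ p, aeval (LinearMap.mulLeft F (AdjoinRoot.root f)) p 1 = AdjoinRoot.mk f p := by
    intro p
    have : aeval (LinearMap.mulLeft F (AdjoinRoot.root f)) p =
        LinearMap.mulLeft F (AdjoinRoot.mk f p) := by
      have := aeval_algHom_apply (Algebra.lmul F (AdjoinRoot f)) (AdjoinRoot.root f) p
      rwa [AdjoinRoot.aeval_eq] at this
    rw [this]; simp
  refine ⟨hf, (finrank_quotient_span_eq_natDegree).symm, by rw [h1, AdjoinRoot.mk_self], ?_⟩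
  intro M hM hinv
  rw [eq_top_iff]
  rintro x -
  obtain ⟨p, rfl⟩ := AdjoinRoot.mk_surjective x
  rw [← h1]
  exact aeval_mem_of_invariant hinv hM p

lemma exists_isDoubleProd_adjoinRoot {f : F[X]} (hf : f.Monic) {ρ : AdjoinRoot f}
    (hρ : AdjoinRoot.root f * ρ = 1) (hfρ : aeval ρ f = 0) :
    ∃ (T : End F (AdjoinRoot f)) (w : _), HasCyclicVector T w f ∧
      IsDoubleProd (-1 : F) (-1) T := by
  let σ : AdjoinRoot f →ₐ[F] AdjoinRoot f := AdjoinRoot.liftAlgHom f (Algebra.ofId ..) ρ hfρ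
  have hσ : σ (AdjoinRoot.root f) = ρ := AdjoinRoot.liftAlgHom_root ..
  have hσρ : σ ρ = AdjoinRoot.root f := by
    have h1 := congrArg σ hρ
    rw [map_mul, hσ, map_one] at h1
    linear_combination (-σ ρ) * hρ + AdjoinRoot.root f * h1
  have hσσ : ∀ x, σ (σ x) = x := by
    have : σ.comp σ = AlgHom.id F _ := AdjoinRoot.algHom_ext (by simp [hσ, hσρ])
    exact fun x => DFunLike.congr_fun this x
  let T : End F (AdjoinRoot f) := LinearMap.mulLeft F (AdjoinRoot.root f)
  have hT : ∀ x, T x = AdjoinRoot.root f * x := fun x => rfl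
  refine ⟨T, 1, hasCyclicVector_mulLeft_root hf, σ.toLinearMap, σ.toLinearMap * T, ?_, ?_, ?_⟩
  · rw [isQuad_neg_one_iff]
    ext x
    simpa using hσσ x
  · rw [isQuad_neg_one_iff]
    ext x
    simp only [Module.End.mul_apply, AlgHom.toLinearMap_apply, hT, map_mul, hσ, hσσ, hσρ,
      Module.End.one_apply]
    linear_combination x * hρ
  · ext x
    simp [hσσ]

lemma coeff_zero_quadProd_one (L : List F) : (quadProd 1 L).coeff 0 = 1 := by
  induction L with
  | nil => simp [quadProd]
  | cons τ L ih => rw [quadProd_cons, mul_coeff_zero, ih]; simp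

lemma exists_isDoubleProd_neg_one_neg_one {e : F} (he : e * e = 1) (L : List F) (p : ℕ) :
    ∃ (f : F[X]) (_ : f.Monic) (T : End F (AdjoinRoot f)) (w : _),
      HasCyclicVector T w ((X - C e) * quadProd 1 L * (X - C 1) ^ p) ∧
      IsDoubleProd (-1 : F) (-1) T := by
  set f := (X - C e) * quadProd 1 L * (X - C 1) ^ p with hf
  have hfm : f.Monic := ((monic_X_sub_C e).mul (monic_quadProd 1 L)).mul ((monic_X_sub_C _).pow _)
  refine ⟨f, hfm, ?_⟩
  have hroot : aeval (AdjoinRoot.root f) f = 0 := by simp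
  have h0 : f.coeff 0 ≠ 0 := by
    have he0 : e ≠ 0 := left_ne_zero_of_mul_eq_one he
    rw [hf, mul_coeff_zero, mul_coeff_zero, coeff_zero_quadProd_one]
    simp [coeff_zero_eq_eval_zero, he0]
  have hρ : AdjoinRoot.root f * (-(f.coeff 0)⁻¹ • AdjoinRoot.mk f f.divX) = 1 := by
    have h1 : AdjoinRoot.mk f f = 0 := AdjoinRoot.mk_self
    have h3 : AdjoinRoot.mk f (X * f.divX + C (f.coeff 0)) = 0 := by rw [X_mul_divX_add, h1]
    rw [map_add, map_mul, AdjoinRoot.mk_X, AdjoinRoot.mk_C] at h3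
    rw [neg_smul, Algebra.smul_def, ← AdjoinRoot.algebraMap_eq] at *
    have h4 := congrArg (algebraMap F (AdjoinRoot f)) (mul_inv_cancel₀ h0)
    rw [map_mul, map_one] at h4
    linear_combination (-algebraMap F (AdjoinRoot f) (f.coeff 0)⁻¹) * h3 + h4
  refine exists_isDoubleProd_adjoinRoot hfm hρ ?_
  refine zero_dvd_iff.1 (hroot ▸ ?_)
  simp only [hf, map_mul, map_pow]
  exact mul_dvd_mul (mul_dvd_mul (aeval_X_sub_C_dvd hρ he) (aeval_quadProd_one_dvd hρ L))
    (pow_dvd_pow_of_dvd (aeval_X_sub_C_dvd hρ (one_mul 1)) p)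

end Involutions

section TripleProduct

variable {F : Type*} [Field F]

open Module

lemma exists_isPeeling_prodMap_of_mul_self_eq_one {n : ℕ} (q : Fin n → F[X])
    (hq : ∀ i, (q i).Monic) (hdeg : ∀ i, 2 ≤ (q i).natDegree) {q₀ : F[X]} (hq₀ : q₀.Monic)
    (hdeg₀ : 0 < q₀.natDegree) {D : F}
    (hD : (-1) ^ q₀.natDegree * q₀.coeff 0 * ∏ j, (-1) ^ (q j).natDegree * (q j).coeff 0 = D)
    (hDD : D * D = 1) {ε κ : F} (hε : ε * ε = 1) (hκ : κ * κ = 1) :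
    ∃ e p L B H v, e * e = 1 ∧ p ≤ 1 ∧ (ε = 1 → κ = 1 → e = D) ∧
      IsPeeling ε ((shiftMod q₀ hq₀ rfl).prodMap (blockShift q hq)) B H v
        ((X - C e) * quadProd κ L * (X - C 1) ^ p) := by
  have hD0 : D ≠ 0 := left_ne_zero_of_mul_eq_one hDD
  have h0₀ : q₀.coeff 0 ≠ 0 := by
    rintro h
    rw [h, mul_zero, zero_mul] at hD
    exact hD0 hD.symm
  have h0 : ∀ i, (q i).coeff 0 ≠ 0 := by
    intro i h
    rw [Finset.prod_eq_zero (Finset.mem_univ i) (by rw [h, mul_zero]), mul_zero] at hD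
    exact hD0 hD.symm
  obtain ⟨p, i, L, B, H, v, hp, h⟩ := exists_isPeeling_prodMap hε hκ q hq hdeg h0 hq₀ hdeg₀ h0₀
  refine ⟨_, p, L, B, H, v, ?_, hp, ?_, C_1 (R := F) ▸ h⟩
  · rw [Finset.prod_mul_distrib, Finset.prod_const, Finset.card_fin]
    calc _ = (κ * κ) ^ i * (ε * ε) * (ε * ε) ^ n * (((-1) ^ q₀.natDegree * q₀.coeff 0 *
          ∏ j, (-1) ^ (q j).natDegree * (q j).coeff 0) * ((-1) ^ q₀.natDegree * q₀.coeff 0 *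
          ∏ j, (-1) ^ (q j).natDegree * (q j).coeff 0)) := by ring
      _ = 1 := by rw [hD, hDD, hε, hκ]; simp
  · rintro rfl rfl
    simpa using hD

lemma isTripleProd_prodMap_neg_one_neg_one {n : ℕ} (q : Fin n → F[X])
    (hq : ∀ i, (q i).Monic) (hdeg : ∀ i, 2 ≤ (q i).natDegree) {q₀ : F[X]} (hq₀ : q₀.Monic)
    (hdeg₀ : 0 < q₀.natDegree) {D : F}
    (hD : (-1) ^ q₀.natDegree * q₀.coeff 0 * ∏ j, (-1) ^ (q j).natDegree * (q j).coeff 0 = D)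
    (hDD : D * D = 1) {ε : F} (hε : ε * ε = 1) :
    IsTripleProd ε (-1) (-1) ((shiftMod q₀ hq₀ rfl).prodMap (blockShift q hq)) := by
  obtain ⟨e, p, L, B, H, v, he, hp, -, h⟩ :=
    exists_isPeeling_prodMap_of_mul_self_eq_one q hq hdeg hq₀ hdeg₀ hD hDD hε (one_mul 1)
  obtain ⟨f, hf, T, w, hT, hT'⟩ := exists_isDoubleProd_neg_one_neg_one he L p
  have := hf.finite_adjoinRoot
  exact h.isTripleProd hT hT'

lemma isTripleProd_prodMap_one_neg_one_one {n : ℕ} (q : Fin n → F[X])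
    (hq : ∀ i, (q i).Monic) (hdeg : ∀ i, 2 ≤ (q i).natDegree) {q₀ : F[X]} (hq₀ : q₀.Monic)
    (hdeg₀ : 0 < q₀.natDegree) {D : F}
    (hD : (-1) ^ q₀.natDegree * q₀.coeff 0 * ∏ j, (-1) ^ (q j).natDegree * (q j).coeff 0 = D)
    (hDD : D * D = 1) :
    IsTripleProd (1 : F) (-1) 1 ((shiftMod q₀ hq₀ rfl).prodMap (blockShift q hq)) := by
  by_cases h2 : (2 : F) = 0
  · have h1 : (1 : F) = -1 := by linear_combination h2
    have := isTripleProd_prodMap_neg_one_neg_one q hq hdeg hq₀ hdeg₀ hD hDD (ε := -1) (by ring)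
    simpa only [← h1] using this
  obtain ⟨e, p, L, B, H, v, he, hp, -, h⟩ :=
    exists_isPeeling_prodMap_of_mul_self_eq_one q hq hdeg hq₀ hdeg₀ hD hDD (one_mul 1)
      (κ := -1) (by ring)
  obtain ⟨η, j, L', hη, hj, hf⟩ : ∃ (η : F) (j : ℕ) (L' : List F), η * η = 1 ∧ j ≤ 2 ∧
      (X - C e) * quadProd (-1) L * (X - C 1) ^ p = quadProd (-1) L' * (X - C η) ^ j := by
    interval_cases p
    · exact ⟨e, 1, L, he, by omega, by ring⟩
    · rcases mul_self_eq_one_iff.1 he with rfl | rfl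
      · exact ⟨1, 2, L, he, le_rfl, by ring⟩
      · refine ⟨1, 0, 0 :: L, one_mul 1, by omega, ?_⟩
        rw [quadProd_cons, C_0, C_neg, C_1]
        ring
  rw [hf] at h
  obtain ⟨P, Q, hP, hQ, T, w, hT, hT'⟩ := exists_isDoubleProd_neg_one_one h2 hη L' hj
  have := finiteDimensional_quotient hP
  have := finiteDimensional_quotient hQ
  exact h.isTripleProd hT hT'

lemma isTripleProd_prodMap_one_one_one {n : ℕ} (q : Fin n → F[X])
    (hq : ∀ i, (q i).Monic) (hdeg : ∀ i, 2 ≤ (q i).natDegree) {q₀ : F[X]} (hq₀ : q₀.Monic)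
    (hdeg₀ : 0 < q₀.natDegree) {D : F}
    (hD : (-1) ^ q₀.natDegree * q₀.coeff 0 * ∏ j, (-1) ^ (q j).natDegree * (q j).coeff 0 = D)
    (hD1 : D = 1) :
    IsTripleProd (1 : F) 1 1 ((shiftMod q₀ hq₀ rfl).prodMap (blockShift q hq)) := by
  obtain ⟨e, p, L, B, H, v, -, hp, he, h⟩ :=
    exists_isPeeling_prodMap_of_mul_self_eq_one q hq hdeg hq₀ hdeg₀ hD (by rw [hD1, one_mul])
      (one_mul 1) (one_mul 1)
  obtain rfl : e = 1 := (he rfl rfl).trans hD1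
  obtain ⟨j, L', hj, hf⟩ : ∃ (j : ℕ) (L' : List F), j ≤ 1 ∧
      (X - C 1) * quadProd 1 L * (X - C 1) ^ p = quadProd 1 L' * (X - C 1) ^ j := by
    interval_cases p
    · exact ⟨1, L, le_rfl, by ring⟩
    · refine ⟨0, 2 :: L, by omega, ?_⟩
      rw [quadProd_cons, C_1, show (C 2 : F[X]) = 2 from rfl]
      ring
  rw [hf] at h
  obtain ⟨P, Q, hP, hQ, T, w, hT, hT'⟩ := exists_isDoubleProd_one_one L' hj
  have := finiteDimensional_quotient hP
  have := finiteDimensional_quotient hQ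
  exact h.isTripleProd hT hT'

end TripleProduct

section Reduction

variable {F : Type*} [Field F]

open Module

/-- `x` is a product of `k` U2-elements and `3 - k` involutions for `k = 0, 1, 2`, and also for
`k = 3` if `D = 1`. -/
def IsAllTripleProd {R : Type*} [Ring R] [Algebra F R] (D : F) (x : R) : Prop :=
  IsTripleProd (-1 : F) (-1) (-1) x ∧ IsTripleProd (1 : F) (-1) (-1) x ∧
    IsTripleProd (1 : F) (-1) 1 x ∧ (D = 1 → IsTripleProd (1 : F) 1 1 x)

lemma IsAllTripleProd.map {R S : Type*} [Ring R] [Algebra F R] [Ring S] [Algebra F S] {D : F}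
    {x : R} (h : IsAllTripleProd D x) (φ : R →ₐ[F] S) : IsAllTripleProd D (φ x) :=
  ⟨h.1.map φ, h.2.1.map φ, h.2.2.1.map φ, fun hD => (h.2.2.2 hD).map φ⟩

lemma isTripleProd_of_subsingleton {R : Type*} [Ring R] [Algebra F R] [Subsingleton R]
    (a b c : F) (x : R) : IsTripleProd a b c x :=
  ⟨0, 0, 0, Subsingleton.elim _ _, Subsingleton.elim _ _, Subsingleton.elim _ _,
    Subsingleton.elim _ _⟩

variable {V V' : Type*} [AddCommGroup V] [Module F V] [AddCommGroup V'] [Module F V']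

lemma IsAllTripleProd.of_equiv {D : F} {A : End F V} {A' : End F V'} (h : IsAllTripleProd D A')
    (e : V ≃ₗ[F] V') (he : ∀ x, e (A x) = A' (e x)) : IsAllTripleProd D A := by
  have := h.map (e.symm.conjAlgEquiv F).toAlgHom
  convert this
  ext x
  simp [← he]

lemma subsingleton_degreeLT_zero : Subsingleton (degreeLT F 0) :=
  (degreeLTEquiv F 0).toEquiv.subsingleton

lemma isAllTripleProd_prodMap {n : ℕ} (q : Fin n → F[X]) (hq : ∀ i, (q i).Monic)
    (hdeg : ∀ i, 2 ≤ (q i).natDegree) {q₀ : F[X]} (hq₀ : q₀.Monic) {D : F}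
    (hD : (-1) ^ q₀.natDegree * q₀.coeff 0 * ∏ j, (-1) ^ (q j).natDegree * (q j).coeff 0 = D)
    (hDD : D * D = 1) :
    IsAllTripleProd D ((shiftMod q₀ hq₀ rfl).prodMap (blockShift q hq)) := by
  have key : ∀ {n : ℕ} (q : Fin n → F[X]) (hq : ∀ i, (q i).Monic)
      (_ : ∀ i, 2 ≤ (q i).natDegree) {q₀ : F[X]} (hq₀ : q₀.Monic)
      (_ : (-1) ^ q₀.natDegree * q₀.coeff 0 * ∏ j, (-1) ^ (q j).natDegree * (q j).coeff 0 = D)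
      (_ : 0 < q₀.natDegree),
      IsAllTripleProd D ((shiftMod q₀ hq₀ rfl).prodMap (blockShift q hq)) :=
    fun q hq hdeg _ hq₀ hD h =>
      ⟨isTripleProd_prodMap_neg_one_neg_one q hq hdeg hq₀ h hD hDD (by ring),
        isTripleProd_prodMap_neg_one_neg_one q hq hdeg hq₀ h hD hDD (by ring),
        isTripleProd_prodMap_one_neg_one_one q hq hdeg hq₀ h hD hDD,
        isTripleProd_prodMap_one_one_one q hq hdeg hq₀ h hD⟩
  rcases Nat.eq_zero_or_pos q₀.natDegree with h | h
  · have hsub : Subsingleton (degreeLT F q₀.natDegree) := h ▸ subsingleton_degreeLT_zero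
    cases n with
    | zero =>
      have : Subsingleton (degreeLT F q₀.natDegree × ∀ i : Fin 0, degreeLT F (q i).natDegree) :=
        inferInstance
      exact ⟨isTripleProd_of_subsingleton _ _ _ _, isTripleProd_of_subsingleton _ _ _ _,
        isTripleProd_of_subsingleton _ _ _ _, fun _ => isTripleProd_of_subsingleton _ _ _ _⟩
    | succ n =>
      obtain rfl : q₀ = 1 := hq₀.natDegree_eq_zero.1 h
      refine (key (fun i => q (Fin.succAbove 0 i)) (fun i => hq _) (fun i => hdeg _) (hq 0) ?_
        (by have := hdeg 0; omega)).of_equiv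
        ({ LinearMap.snd F _ _ with
            invFun := fun x => (0, x)
            left_inv := fun x => Prod.ext (Subsingleton.elim _ _) rfl
            right_inv := fun x => rfl } ≪≫ₗ
          piSuccAboveEquiv F (fun i => degreeLT F (q i).natDegree) 0) fun x => rfl
      rw [← hD, Fin.prod_univ_succAbove _ 0]
      simp
  · exact key q hq hdeg hq₀ hD h

lemma hasCyclicVector_prodMap_shiftMod {p q : F[X]} (hp : p.Monic) (hq : q.Monic)
    (hpq : IsCoprime p q) :
    ∃ v, HasCyclicVector ((shiftMod p hp rfl).prodMap (shiftMod q hq rfl)) v (p * q) := by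
  have hmem : ∀ {p : F[X]} (hp : p.Monic), 1 %ₘ p ∈ degreeLT F p.natDegree := fun hp => by
    rw [mem_degreeLT, ← degree_eq_natDegree hp.ne_zero]
    exact degree_modByMonic_lt _ hp
  let vp : degreeLT F p.natDegree := ⟨1 %ₘ p, hmem hp⟩
  let vq : degreeLT F q.natDegree := ⟨1 %ₘ q, hmem hq⟩
  have hP := hasCyclicVector_shiftMod p hp rfl vp rfl
  have hQ := hasCyclicVector_shiftMod q hq rfl vq rfl
  have haev : ∀ (f : F[X]) x, aeval ((shiftMod p hp rfl).prodMap (shiftMod q hq rfl)) f x =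
      (aeval (shiftMod p hp rfl) f x.1, aeval (shiftMod q hq rfl) f x.2) := by
    intro f
    induction f using Polynomial.induction_on' with
    | add f g hf hg => intro x; simp [hf, hg]
    | monomial n a =>
      induction n with
      | zero => intro x; simp [Module.algebraMap_end_apply]; rfl
      | succ n ih =>
        intro x
        rw [← X_mul_monomial]
        simp only [aeval_X_mul_apply, ih]
        rfl
  refine ⟨(vp, vq), hp.mul hq, ?_, ?_, ?_⟩
  · rw [hp.natDegree_mul hq, finrank_prod]
    exact congrArg₂ (· + ·) hP.natDegree_eq hQ.natDegree_eq
  · rw [haev]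
    refine Prod.ext ?_ ?_
    · change aeval (shiftMod p hp rfl) (p * q) vp = 0
      rw [mul_comm, aeval_mul_apply, hP.aeval_eq_zero, map_zero]
    · change aeval (shiftMod q hq rfl) (p * q) vq = 0
      rw [aeval_mul_apply, hQ.aeval_eq_zero, map_zero]
  · intro M hM hinv
    obtain ⟨a, b, hab⟩ := hpq
    have h1 : aeval (shiftMod p hp rfl) (b * q) vp = vp := by
      rw [eq_sub_of_add_eq' hab, map_sub, LinearMap.sub_apply, aeval_mul_apply, hP.aeval_eq_zero]
      simp
    have h2 : aeval (shiftMod q hq rfl) (a * p) vq = vq := by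
      rw [eq_sub_of_add_eq hab, map_sub, LinearMap.sub_apply, aeval_mul_apply, hQ.aeval_eq_zero]
      simp
    have h3 : ((vp, 0) : _ × degreeLT F q.natDegree) ∈ M := by
      have := aeval_mem_of_invariant hinv hM (b * q)
      rwa [haev, h1, aeval_mul_apply, hQ.aeval_eq_zero, map_zero] at this
    have h4 : ((0, vq) : degreeLT F p.natDegree × _) ∈ M := by
      have := aeval_mem_of_invariant hinv hM (a * p)
      rwa [haev, h2, aeval_mul_apply, hP.aeval_eq_zero, map_zero] at this
    have h5 := hP.eq_top (M.comap (LinearMap.inl F _ _)) h3 fun x hx => by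
      simpa using hinv _ hx
    have h6 := hQ.eq_top (M.comap (LinearMap.inr F _ _)) h4 fun x hx => by
      simpa using hinv _ hx
    rw [eq_top_iff]
    rintro ⟨x, y⟩ -
    have hx : x ∈ M.comap (LinearMap.inl F _ _) := h5 ▸ Submodule.mem_top
    have hy : y ∈ M.comap (LinearMap.inr F _ _) := h6 ▸ Submodule.mem_top
    simpa using M.add_mem hx hy

lemma isAllTripleProd_blockShift {N : ℕ} (q : Fin N → F[X]) (hq : ∀ i, (q i).Monic) {i₀ i₁ : Fin N}
    (hi₀ : (i₀ : ℕ) = 0) (hi₁ : (i₁ : ℕ) + 1 = N) (hi : i₀ ≠ i₁)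
    (hdeg : ∀ i, i ≠ i₀ → i ≠ i₁ → 2 ≤ (q i).natDegree)
    (hcop : IsCoprime (q i₀) (q i₁)) {D : F}
    (hD : ∏ j, (-1) ^ (q j).natDegree * (q j).coeff 0 = D) (hDD : D * D = 1) :
    IsAllTripleProd D (blockShift q hq) := by
  obtain ⟨m, rfl⟩ : ∃ m, N = m + 2 := ⟨N - 2, by have := Fin.val_ne_of_ne hi; omega⟩
  obtain rfl : i₀ = 0 := Fin.ext hi₀
  obtain rfl : i₁ = Fin.last _ := Fin.ext (Nat.succ.inj hi₁)
  obtain ⟨v, hv⟩ := hasCyclicVector_prodMap_shiftMod (hq 0) (hq (Fin.last _)) hcop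
  obtain ⟨e, he⟩ := hv.exists_equiv_shiftMod rfl
  have h := isAllTripleProd_prodMap (fun i => q (Fin.succAbove 0 ((Fin.last m).succAbove i)))
    (fun i => hq _) (fun i => hdeg _ ?_ ?_) hv.monic (D := D) ?_ hDD
  · let e₁ := piSuccAboveEquiv F (fun i => degreeLT F (q i).natDegree) 0
    let e₂ :=
      piSuccAboveEquiv F (fun i => degreeLT F (q (Fin.succAbove 0 i)).natDegree) (Fin.last m)
    refine h.of_equiv (e₁ ≪≫ₗ (LinearEquiv.refl F _).prodCongr e₂ ≪≫ₗ
      (LinearEquiv.prodAssoc F _ _ _).symm ≪≫ₗ e.symm.prodCongr (LinearEquiv.refl F _)) fun x => ?_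
    refine Prod.ext ?_ rfl
    apply e.injective
    change
      e (e.symm (shiftMod (q 0) (hq 0) rfl (x 0), shiftMod (q (Fin.last _)) (hq _) rfl (x _))) =
      e (shiftMod _ hv.monic rfl (e.symm (x 0, x (Fin.last _))))
    rw [he, e.apply_symm_apply, e.apply_symm_apply]
    rfl
  · simp
  · simp [Fin.ext_iff]
    omega
  · rw [← hD, Fin.prod_univ_succAbove _ 0, Fin.prod_univ_succAbove _ (Fin.last m),
      (hq 0).natDegree_mul (hq _), mul_coeff_zero, pow_add]
    simp only [Fin.zero_succAbove, Fin.succ_last]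
    ring

end Reduction

section Matrices

variable {F : Type*} [Field F]

open Module

lemma det_shiftMod {q : F[X]} (hq : q.Monic) :
    LinearMap.det (shiftMod q hq rfl) = (-1) ^ q.natDegree * q.coeff 0 := by
  have := hq.finite_adjoinRoot
  obtain ⟨e, he⟩ := (hasCyclicVector_mulLeft_root hq).exists_equiv_shiftMod rfl
  have h := Algebra.PowerBasis.norm_gen_eq_coeff_zero_minpoly (AdjoinRoot.powerBasis hq.ne_zero)
  rw [AdjoinRoot.minpoly_powerBasis_gen_of_monic hq, AdjoinRoot.powerBasis_dim,
    AdjoinRoot.powerBasis_gen, Algebra.norm_apply] at h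
  rw [← h, ← LinearMap.det_conj (shiftMod q hq rfl) e]
  congr 1
  ext x
  obtain ⟨y, rfl⟩ := e.surjective x
  simpa using he y

lemma det_blockShift {n : ℕ} (q : Fin n → F[X]) (hq : ∀ i, (q i).Monic) :
    LinearMap.det (blockShift q hq) = ∏ i, (-1) ^ (q i).natDegree * (q i).coeff 0 := by
  induction n with
  | zero =>
    rw [LinearMap.det_eq_one_of_subsingleton, Fin.prod_univ_zero]
  | succ n ih =>
    rw [Fin.prod_univ_succAbove _ 0, ← ih _ fun i => hq _, ← det_shiftMod (hq 0),
      ← LinearMap.det_prodMap, ← LinearMap.det_conj (blockShift q hq)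
        (piSuccAboveEquiv F (fun i => degreeLT F (q i).natDegree) 0)]
    congr 1

lemma companion_mulVec {q : F[X]} (hq : q.Monic) (p : degreeLT F q.natDegree) :
    companion q *ᵥ degreeLTEquiv F q.natDegree p =
      degreeLTEquiv F q.natDegree (shiftMod q hq rfl p) := by
  ext i
  have hd : 0 < q.natDegree := i.pos
  change ∑ j, companion q i j * (p : F[X]).coeff j = (shiftMod q hq rfl p : F[X]).coeff i
  simp only [companion, Matrix.of_apply, add_mul, Finset.sum_add_distrib, ite_mul, one_mul,
    zero_mul]
  rw [shiftMod_coe, coeff_sub, coeff_C_mul, sub_eq_add_neg]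
  congr 1
  · obtain ⟨i, hi⟩ := i
    cases i with
    | zero => simp
    | succ i =>
      rw [Finset.sum_eq_single ⟨i, by omega⟩] <;> simp [Fin.ext_iff, eq_comm]
      exact fun b h₁ h₂ => absurd h₂ h₁
  · rw [Finset.sum_eq_single ⟨q.natDegree - 1, by omega⟩]
    · simp [mul_comm]
    · intro j _ hj
      rw [if_neg fun h => hj (Fin.ext h)]
    · simp

lemma exists_equiv_blockShift {N n : ℕ} (q : Fin N → F[X]) (hq : ∀ i, (q i).Monic)
    (σ : (Σ k, Fin (q k).natDegree) ≃ Fin n) :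
    ∃ e : (Fin n → F) ≃ₗ[F] ∀ k, degreeLT F (q k).natDegree, ∀ x,
      e (Matrix.reindex σ σ (Matrix.blockDiagonal' fun k => companion (q k)) *ᵥ x) =
        blockShift q hq (e x) := by
  refine ⟨LinearEquiv.funCongrLeft F F σ ≪≫ₗ LinearEquiv.piCurry F (fun _ _ => F) ≪≫ₗ
    LinearEquiv.piCongrRight fun k => (degreeLTEquiv F (q k).natDegree).symm, fun x => ?_⟩
  funext k
  apply (degreeLTEquiv F (q k).natDegree).injective
  change degreeLTEquiv F _ ((degreeLTEquiv F _).symm _) =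
    degreeLTEquiv F _ (shiftMod _ (hq k) rfl ((degreeLTEquiv F _).symm fun i => x (σ ⟨k, i⟩)))
  rw [← companion_mulVec, LinearEquiv.apply_symm_apply, LinearEquiv.apply_symm_apply]
  funext i
  change (Matrix.reindex σ σ (Matrix.blockDiagonal' fun k => companion (q k)) *ᵥ x) (σ ⟨k, i⟩) =
    ∑ j, companion (q k) i j * x (σ ⟨k, j⟩)
  rw [Matrix.mulVec, dotProduct, ← σ.sum_comp, Fintype.sum_sigma, Finset.sum_eq_single k]
  · simp [Matrix.blockDiagonal'_apply_eq]
  · intro j _ hj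
    refine Finset.sum_eq_zero fun l _ => ?_
    simp [Matrix.blockDiagonal'_apply_ne _ _ _ hj.symm]
  · simp

lemma isAllTripleProd_of_isWellPartitioned {n : ℕ} {A W : Matrix (Fin n) (Fin n) F}
    (hdet : A.det * A.det = 1) (hW : IsWellPartitioned W) (hAW : SimilarMat A W) :
    IsAllTripleProd A.det A := by
  obtain ⟨r, s, hr, hs, p, q, hp, hq, hpd, hqd, hcop, hn, rfl⟩ := hW
  obtain ⟨P, hP, hAP⟩ := hAW
  have hm : ∀ k, (Fin.append p q k).Monic := Fin.addCases (by simpa using hp) (by simpa using hq)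
  obtain ⟨e, he⟩ :=
    exists_equiv_blockShift (Fin.append p q) hm ((finSigmaEquiv _).trans (finCongr hn))
  let ψ : (Fin n → F) ≃ₗ[F] (Fin n → F) := Matrix.toLinearEquiv' P hP.invertible
  have hψ : ∀ x, ψ x = P *ᵥ x := fun x => rfl
  let Φ : Matrix (Fin n) (Fin n) F ≃ₐ[F] End F (∀ k, degreeLT F (Fin.append p q k).natDegree) :=
    Matrix.toLinAlgEquiv'.trans ((ψ.symm ≪≫ₗ e).conjAlgEquiv F)
  have hΦ : Φ A = blockShift _ hm := by
    refine LinearMap.ext fun x => ?_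
    obtain ⟨y, rfl⟩ := e.surjective x
    rw [← he]
    change e (ψ.symm (A *ᵥ ψ (e.symm (e y)))) = _
    rw [e.symm_apply_apply, hψ, Matrix.mulVec_mulVec, hAP, ← Matrix.mulVec_mulVec, ← hψ,
      ψ.symm_apply_apply]
    rfl
  have hdetA : ∏ i, (-1) ^ (Fin.append p q i).natDegree * (Fin.append p q i).coeff 0 = A.det := by
    have hΦ' : Φ A = (ψ.symm ≪≫ₗ e).toLinearMap ∘ₗ toLin' A ∘ₗ
        (ψ.symm ≪≫ₗ e).symm.toLinearMap := rfl
    rw [← det_blockShift _ hm, ← hΦ, hΦ', LinearMap.det_conj, LinearMap.det_toLin']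
  have hs' : s - 1 < s := by omega
  have h := isAllTripleProd_blockShift (Fin.append p q) hm (i₀ := Fin.castAdd s ⟨0, hr⟩)
    (i₁ := Fin.natAdd r ⟨s - 1, hs'⟩) rfl ?_ ?_ ?_ ?_ hdetA hdet
  · have := h.map Φ.symm.toAlgHom
    rw [← hΦ] at this
    simpa using this
  · change r + (s - 1) + 1 = r + s
    omega
  · exact Fin.ne_of_val_ne (by change 0 ≠ r + (s - 1); omega)
  · intro i
    refine Fin.addCases (fun i h₀ _ => ?_) (fun i _ h₁ => ?_) i
    · rw [Fin.append_left]
      refine hpd i fun h => h₀ (Fin.ext h)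
    · rw [Fin.append_right]
      refine hqd i fun h => h₁ (Fin.ext ?_)
      change r + (i : ℕ) = r + (s - 1)
      omega
  · rw [Fin.append_left, Fin.append_right]
    exact hcop _ _

end Matrices

/-- **Proposition `wellpartdecomp`.**
Let `A ∈ GLₙ(F)` with `det A = ±1` be similar to a well-partitioned matrix. Then for every
`k ∈ {0, 1, 2}`, the matrix `A` is a product of `k` U2-matrices and `3 − k` involutions;
moreover, if `det A = 1` then `A` is a product of three U2-matrices. -/
theorem stmt14 {F : Type*} [Field F] {n : ℕ}
    (A : Matrix (Fin n) (Fin n) F) (hA : IsUnit A)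
    (hdet : A.det = 1 ∨ A.det = -1)
    (hsim : ∃ W : Matrix (Fin n) (Fin n) F, IsWellPartitioned W ∧ SimilarMat A W) :
    (∀ k : ℕ, k ∈ ({0, 1, 2} : Set ℕ) →
      ∃ (B : Fin 3 → Matrix (Fin n) (Fin n) F) (s : Finset (Fin 3)),
        s.card = k ∧
        (∀ j ∈ s, (B j - 1) * (B j - 1) = 0) ∧
        (∀ j ∉ s, B j * B j = 1) ∧
        A = B 0 * B 1 * B 2) ∧
    (A.det = 1 →
      ∃ U₁ U₂ U₃ : Matrix (Fin n) (Fin n) F,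
        (U₁ - 1) * (U₁ - 1) = 0 ∧ (U₂ - 1) * (U₂ - 1) = 0 ∧ (U₃ - 1) * (U₃ - 1) = 0 ∧
        A = U₁ * U₂ * U₃) := by
  obtain ⟨W, hW, hAW⟩ := hsim
  obtain ⟨⟨x₁, x₂, x₃, hx₁, hx₂, hx₃, hx⟩, ⟨y₁, y₂, y₃, hy₁, hy₂, hy₃, hy⟩,
    ⟨z₁, z₂, z₃, hz₁, hz₂, hz₃, hz⟩, h⟩ :=
    isAllTripleProd_of_isWellPartitioned (mul_self_eq_one_iff.2 hdet) hW hAW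
  rw [isQuad_neg_one_iff] at hx₁ hx₂ hx₃ hy₂ hy₃ hz₂
  rw [isQuad_one_iff] at hy₁ hz₁ hz₃
  refine ⟨?_, fun hA1 => ?_⟩
  · rintro k (rfl | rfl | rfl)
    · exact ⟨![x₁, x₂, x₃], ∅, rfl, by simp, by simp [Fin.forall_fin_succ, hx₁, hx₂, hx₃], hx⟩
    · exact ⟨![y₁, y₂, y₃], {0}, rfl, by simp [hy₁], by simp [Fin.forall_fin_succ, hy₂, hy₃], hy⟩
    · exact ⟨![z₁, z₂, z₃], {0, 2}, rfl, by simp [hz₁, hz₃], by simp [Fin.forall_fin_succ, hz₂],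
        hz⟩
  · obtain ⟨u₁, u₂, u₃, hu₁, hu₂, hu₃, hu⟩ := h hA1
    exact ⟨u₁, u₂, u₃, isQuad_one_iff.1 hu₁, isQuad_one_iff.1 hu₂, isQuad_one_iff.1 hu₃, hu⟩
end

section
/- Let F be a field and let M ∈ GL_n(F) be an invertible matrix that is neither scalar (i.e., not of the form λI_n for some λ ∈ F) nor cyclic. Then M is u-adjacent to a well-partitioned matrix: there exist a U2-matrix U ∈ GL_n(F) and a well-partitioned matrix W such that UM is similar to W. -/
open Matrix Polynomial

/-- `X` is a cyclic vector for `A` when the iterates `(Aᵏ X)` span the whole space. -/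
def IsCyclicVec {F : Type*} [Field F] {n : ℕ} (A : Matrix (Fin n) (Fin n) F)
    (X : Fin n → F) : Prop :=
  Submodule.span F (Set.range fun k : ℕ => (A ^ k) *ᵥ X) = ⊤

/-- A matrix is cyclic when it admits a cyclic vector. -/
def IsCyclicMat {F : Type*} [Field F] {n : ℕ} (A : Matrix (Fin n) (Fin n) F) : Prop :=
  ∃ X : Fin n → F, IsCyclicVec A X

open Module

/-- `g` acts on `V` as the direct sum of the companion matrices of the polynomials `q i`. -/
def IsCompanionSum {F V ι : Type*} [Field F] [AddCommGroup V] [Module F V]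
    (q : ι → F[X]) (g : End F V) : Prop :=
  ∃ e : V ≃ₗ[F] ((i : ι) → Fin (q i).natDegree → F),
    ∀ v i, e (g v) i = companion (q i) *ᵥ e v i

/-- `g` acts on `V` as the companion matrix of `p`. -/
def IsCompanionBlock {F V : Type*} [Field F] [AddCommGroup V] [Module F V]
    (p : F[X]) (g : End F V) : Prop :=
  ∃ e : V ≃ₗ[F] (Fin p.natDegree → F), ∀ v, e (g v) = companion p *ᵥ e v

section

variable {F : Type*} {V : Type*} [Field F] [AddCommGroup V] [Module F V]

theorem IsCompanionBlock.isCompanionSum {p : F[X]} {g : End F V} (h : IsCompanionBlock p g) :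
    IsCompanionSum (fun _ : Fin 1 => p) g := by
  obtain ⟨e, he⟩ := h
  exact ⟨e.trans (LinearEquiv.funUnique (Fin 1) F (Fin p.natDegree → F)).symm,
    fun v i => by simpa using he v⟩

theorem IsCompanionSum.comp_equiv {ι κ : Type*} {q : ι → F[X]} {g : End F V}
    (h : IsCompanionSum q g) (σ : κ ≃ ι) : IsCompanionSum (q ∘ σ) g := by
  obtain ⟨e, he⟩ := h
  exact ⟨e.trans (LinearEquiv.piCongrLeft F (fun i => Fin (q i).natDegree → F) σ).symm,
    fun v i => he v (σ i)⟩

theorem aeval_restrict_apply {W : Submodule F V} {f : End F V} (h : ∀ v ∈ W, f v ∈ W)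
    (p : F[X]) (w : W) : ((aeval (f.restrict h) p w : W) : V) = aeval f p (w : V) := by
  induction p using Polynomial.induction_on' with
  | add p q hp hq => simp [hp, hq]
  | monomial n a =>
    rw [aeval_monomial, aeval_monomial, Module.End.pow_restrict n h]
    simp [Module.algebraMap_end_apply]

theorem aeval_restrict_eq_zero {W : Submodule F V} {f : End F V} (h : ∀ v ∈ W, f v ∈ W)
    {p : F[X]} (hp : aeval f p = 0) : aeval (f.restrict h) p = 0 := by
  ext w
  simp [aeval_restrict_apply, hp]

/-- A vector whose first `deg p` iterates form a basis and which is killed by `p` exhibits the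
endomorphism as the companion matrix of `p`. -/
theorem isCompanionBlock_of_linearIndependent [FiniteDimensional F V] {g : End F V} {p : F[X]}
    (hp : p.Monic) {x : V} (hli : LinearIndependent F fun i : Fin p.natDegree => (g ^ (i : ℕ)) x)
    (hd : finrank F V = p.natDegree) (hx : aeval g p x = 0) : IsCompanionBlock p g := by
  let b := Basis.mk hli (hli.span_eq_top_of_card_eq_finrank' (by simp [hd])).ge
  have hb : ∀ i, b i = (g ^ (i : ℕ)) x := fun i => by simp [b]
  have hlast : (g ^ p.natDegree) x = ∑ i : Fin p.natDegree, (-p.coeff (i : ℕ)) • b i := by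
    rw [aeval_eq_sum_range, Finset.sum_range_succ, hp.coeff_natDegree, one_smul,
      LinearMap.add_apply, LinearMap.sum_apply] at hx
    rw [eq_neg_of_add_eq_zero_right hx, ← Fin.sum_univ_eq_sum_range
      (fun i => (p.coeff i • g ^ i) x) p.natDegree, ← Finset.sum_neg_distrib]
    exact Finset.sum_congr rfl fun i _ => by simp [hb]
  have hM : LinearMap.toMatrix b b g = companion p := by
    ext i j
    rw [LinearMap.toMatrix_apply, hb, ← Module.End.mul_apply, ← pow_succ']
    simp only [companion, Matrix.of_apply]
    by_cases hj : (j : ℕ) + 1 < p.natDegree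
    · rw [← hb ⟨j + 1, hj⟩, b.repr_self, Finsupp.single_apply,
        if_neg (by omega : ¬ (j : ℕ) = p.natDegree - 1), add_zero]
      simp [Fin.ext_iff, eq_comm]
    · have : (j : ℕ) + 1 = p.natDegree := by omega
      rw [this, hlast, b.repr_sum_self, if_neg (by omega), if_pos (by omega), zero_add]
  refine ⟨b.equivFun, fun v => ?_⟩
  rw [← hM]
  exact (LinearMap.toMatrix_mulVec_repr b b g v).symm

theorem IsCompanionBlock.exists_cons {V₁ N : Submodule F V} (hc : IsCompl V₁ N)
    {f : End F V} (h₁ : ∀ v ∈ V₁, f v ∈ V₁) (hN : ∀ v ∈ N, f v ∈ N)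
    {u₁ : End F V₁} {u₂ : End F N} (hu₁ : (u₁ - 1) * (u₁ - 1) = 0) (hu₂ : (u₂ - 1) * (u₂ - 1) = 0)
    {p : F[X]} {s : ℕ} {q : Fin s → F[X]} (hp : IsCompanionBlock p (u₁ * f.restrict h₁))
    (hq : IsCompanionSum q (u₂ * f.restrict hN)) :
    ∃ u : End F V, (u - 1) * (u - 1) = 0 ∧
      IsCompanionSum (Fin.cons p q : Fin (s + 1) → F[X]) (u * f) := by
  obtain ⟨e₁, he₁⟩ := hp
  obtain ⟨e₂, he₂⟩ := hq
  let E := Submodule.prodEquivOfIsCompl V₁ N hc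
  have hf : ∀ w, f (E w) = E (f.restrict h₁ w.1, f.restrict hN w.2) := fun w => by
    simp [E]
  let u : End F V := E.toLinearMap ∘ₗ (u₁.prodMap u₂) ∘ₗ E.symm.toLinearMap
  have hu : ∀ w, u (E w) = E (u₁ w.1, u₂ w.2) := fun w => by simp [u]
  refine ⟨u, ?_, (E.symm.trans (e₁.prodCongr e₂)).trans
    (Fin.consLinearEquiv F fun i => Fin ((Fin.cons p q : Fin (s + 1) → F[X]) i).natDegree → F),
    ?_⟩
  · ext v
    obtain ⟨w, rfl⟩ := E.surjective v
    have hw : ∀ w, (u - 1) (E w) = E ((u₁ - 1) w.1, (u₂ - 1) w.2) := fun w => by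
      simp only [LinearMap.sub_apply, hu, Module.End.one_apply, ← map_sub]
      rfl
    rw [Module.End.mul_apply, hw, hw, ← Module.End.mul_apply, ← Module.End.mul_apply, hu₁, hu₂]
    exact map_zero E
  · intro v i
    obtain ⟨w, rfl⟩ := E.surjective v
    rw [Module.End.mul_apply, hf, hu]
    refine Fin.cases ?_ (fun j => ?_) i
    · change e₁ (E.symm (E _)).1 = companion p *ᵥ e₁ (E.symm (E w)).1
      rw [E.symm_apply_apply, E.symm_apply_apply]
      exact he₁ w.1
    · change e₂ (E.symm (E _)).2 j = companion (q j) *ᵥ e₂ (E.symm (E w)).2 j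
      rw [E.symm_apply_apply, E.symm_apply_apply]
      exact he₂ w.2 j

theorem exists_linearIndependent_pow_minpoly [FiniteDimensional F V] (f : End F V) :
    ∃ x : V, LinearIndependent F fun i : Fin (minpoly F f).natDegree => (f ^ (i : ℕ)) x := by
  obtain ⟨x, hx⟩ := exists_ker_toSpanSingleton_eq_annihilator F[X] (AEval' f)
  obtain ⟨x, rfl⟩ := (AEval'.of f).surjective x
  rw [← span_minpoly_eq_annihilator] at hx
  have key : ∀ p : F[X], aeval f p x = 0 → minpoly F f ∣ p := fun p hp => by
    rw [← Ideal.mem_span_singleton, ← hx, LinearMap.mem_ker, LinearMap.toSpanSingleton_apply]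
    have : p • AEval'.of f x = AEval'.of f (aeval f p x) := by
      rfl
    rw [this, hp, map_zero]
  refine ⟨x, Fintype.linearIndependent_iff.2 fun c hc i => ?_⟩
  let P : F[X] := ∑ i : Fin (minpoly F f).natDegree, C (c i) * X ^ (i : ℕ)
  have hP : P = 0 := by
    refine eq_zero_of_dvd_of_degree_lt (key P ?_) ?_
    · simpa [P, map_sum, Module.algebraMap_end_apply] using hc
    · rw [degree_eq_natDegree (minpoly.ne_zero (Algebra.IsIntegral.isIntegral f))]
      exact degree_sum_fin_lt c
  have := congrArg (fun Q => Q.coeff (i : ℕ)) hP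
  simpa [P, finsetSum_coeff, coeff_X_pow, Fin.val_inj] using this

theorem exists_isCompl_cyclic [FiniteDimensional F V] (f : End F V)
    (hd : 0 < (minpoly F f).natDegree) :
    ∃ (V₁ N : Submodule F V) (h₁ : ∀ v ∈ V₁, f v ∈ V₁) (_ : ∀ v ∈ N, f v ∈ N) (x : V₁),
      IsCompl V₁ N ∧ finrank F V₁ = (minpoly F f).natDegree ∧
      LinearIndependent F
        fun i : Fin (minpoly F f).natDegree => ((f.restrict h₁) ^ (i : ℕ)) x := by
  obtain ⟨x, hx⟩ := exists_linearIndependent_pow_minpoly f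
  have hmonic : (minpoly F f).Monic := minpoly.monic (Algebra.IsIntegral.isIntegral f)
  have hmod : ∀ p : F[X], aeval f (p %ₘ minpoly F f) = aeval f p := fun p =>
    aeval_modByMonic_eq_self_of_root (minpoly.aeval F f)
  have hlt : ∀ p : F[X], (p %ₘ minpoly F f).natDegree < (minpoly F f).natDegree := fun p =>
    natDegree_modByMonic_lt p hmonic fun h => by simp [h] at hd
  generalize (minpoly F f).natDegree = d at *
  obtain ⟨r, hr⟩ := LinearMap.exists_leftInverse_of_injective
    (Fintype.linearCombination F fun i : Fin d => (f ^ (i : ℕ)) x)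
    (LinearMap.ker_eq_bot.2 hx.fintypeLinearCombination_injective)
  let φ : V →ₗ[F] F := LinearMap.proj ⟨d - 1, by omega⟩ ∘ₗ r
  have hφ : ∀ p : F[X], p.natDegree < d → φ (aeval f p x) = p.coeff (d - 1) := fun p hp => by
    have : aeval f p x = Fintype.linearCombination F (fun i : Fin d => (f ^ (i : ℕ)) x)
        fun i => p.coeff i := by
      rw [aeval_eq_sum_range' hp, Fintype.linearCombination_apply, LinearMap.sum_apply,
        ← Fin.sum_univ_eq_sum_range (fun i => (p.coeff i • f ^ i) x)]
      rfl
    simp only [φ, LinearMap.comp_apply, this, LinearMap.proj_apply]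
    rw [← LinearMap.comp_apply, hr]
    rfl
  let T : V →ₗ[F] (Fin d → F) := LinearMap.pi fun i => φ ∘ₗ (f ^ (i : ℕ))
  have hN : ∀ v, v ∈ LinearMap.ker T ↔ ∀ p : F[X], φ (aeval f p v) = 0 := fun v => by
    refine ⟨fun hv p => ?_, fun hv => ?_⟩
    · rw [← hmod p, aeval_eq_sum_range' (hlt p), LinearMap.sum_apply, map_sum]
      refine Finset.sum_eq_zero fun i hi => ?_
      have := congrFun (LinearMap.mem_ker.1 hv) ⟨i, Finset.mem_range.1 hi⟩
      have h0 : φ ((f ^ i) v) = 0 := this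
      simp [h0]
    · rw [LinearMap.mem_ker]
      ext i
      have := hv (X ^ (i : ℕ))
      rwa [map_pow, aeval_X] at this
  let V₁ : Submodule F V := LinearMap.range (LinearMap.applyₗ x ∘ₗ (aeval f).toLinearMap)
  have hV₁ : ∀ v, v ∈ V₁ ↔ ∃ p : F[X], aeval f p x = v := fun v => Iff.rfl
  have h₁ : ∀ v ∈ V₁, f v ∈ V₁ := fun v hv => by
    obtain ⟨p, rfl⟩ := (hV₁ v).1 hv
    exact (hV₁ _).2 ⟨X * p, by simp⟩
  have h₂ : ∀ v ∈ LinearMap.ker T, f v ∈ LinearMap.ker T := fun v hv =>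
    (hN _).2 fun p => by
      have := (hN v).1 hv (p * X)
      rwa [map_mul, aeval_X, Module.End.mul_apply] at this
  have hx₁ : x ∈ V₁ := (hV₁ x).2 ⟨1, by simp⟩
  have hdisj : Disjoint V₁ (LinearMap.ker T) := by
    refine Submodule.disjoint_def.2 fun v hv hv' => ?_
    obtain ⟨p, rfl⟩ := (hV₁ v).1 hv
    rw [← hmod p] at hv' ⊢
    have hlt' := hlt p
    generalize p %ₘ minpoly F f = q at *
    by_contra hq
    have hq0 : q ≠ 0 := fun h => hq (by simp [h])
    have h0 := (hN _).1 hv' (X ^ (d - 1 - q.natDegree))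
    rw [← Module.End.mul_apply, ← map_mul, hφ _ (by rw [natDegree_X_pow_mul _ hq0]; omega),
      coeff_X_pow_mul', if_pos (by omega),
      show d - 1 - (d - 1 - q.natDegree) = q.natDegree by omega] at h0
    exact hq0 (leadingCoeff_eq_zero.1 h0)
  have hli : LinearIndependent F fun i : Fin d => ((f.restrict h₁) ^ (i : ℕ)) ⟨x, hx₁⟩ := by
    refine LinearIndependent.of_comp V₁.subtype ?_
    convert hx using 2 with i
    simp only [Function.comp_apply]
    rw [Module.End.pow_restrict (i : ℕ) h₁]
    rfl
  have hge : d ≤ finrank F V₁ := by simpa using hli.fintype_card_le_finrank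
  have hsum := LinearMap.finrank_range_add_finrank_ker T
  have hT : finrank F (LinearMap.range T) ≤ d := by
    simpa using Submodule.finrank_le (LinearMap.range T)
  have hle := Submodule.finrank_add_finrank_le_of_disjoint hdisj
  exact ⟨V₁, LinearMap.ker T, h₁, h₂, ⟨x, hx₁⟩,
    (Submodule.isCompl_iff_disjoint _ _ (by omega)).2 hdisj, by omega, hli⟩

/-- An endomorphism with a cyclic vector of order `μ` becomes, after left multiplication by a
suitable unipotent `u`, the companion matrix of `μ + X`. -/
theorem exists_isCompanionBlock_add_X [FiniteDimensional F V] {f : End F V}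
    (hf : Function.Injective f) {μ : F[X]} (hμ : μ.Monic) (hd : 2 ≤ μ.natDegree) {x : V}
    (hli : LinearIndependent F fun i : Fin μ.natDegree => (f ^ (i : ℕ)) x)
    (hdim : finrank F V = μ.natDegree) (hx : aeval f μ x = 0) :
    ∃ u : End F V, (u - 1) * (u - 1) = 0 ∧ IsCompanionBlock (μ + X) (u * f) := by
  have hdeg : (X : F[X]).degree < μ.degree := by
    rw [degree_X, degree_eq_natDegree hμ.ne_zero]
    exact_mod_cast hd
  have hnat : (μ + X).natDegree = μ.natDegree := natDegree_add_eq_left_of_degree_lt hdeg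
  generalize hdd : μ.natDegree = d at *
  obtain ⟨d, rfl⟩ : ∃ k, d = k + 2 := ⟨d - 2, by omega⟩
  let b := Basis.mk hli (hli.span_eq_top_of_card_eq_finrank' (by simp [hdim])).ge
  have hb : ∀ i, b i = (f ^ (i : ℕ)) x := fun i => by simp [b]
  let e : V ≃ₗ[F] V := LinearEquiv.ofInjectiveEndo f hf
  have he : ∀ v, e.symm (f v) = v := fun v => e.symm_apply_apply v
  let φ : V →ₗ[F] F := b.coord (Fin.last (d + 1)) ∘ₗ e.symm.toLinearMap
  have hφ : ∀ i : Fin (d + 2), φ ((f ^ ((i : ℕ) + 1)) x) = if i = Fin.last (d + 1) then 1 else 0 :=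
    fun i => by
      rw [pow_succ', Module.End.mul_apply, ← hb]
      simp [φ, he, Finsupp.single_apply]
  let u : End F V := 1 - φ.smulRight (f x)
  have hu : ∀ v, u v = v - φ v • f x := fun v => by simp [u]
  have hpow : ∀ i < d + 2, ((u * f) ^ i) x = (f ^ i) x := fun i hi => by
    induction i with
    | zero => simp
    | succ i ih =>
      rw [pow_succ', Module.End.mul_apply, ih (by omega), Module.End.mul_apply, hu,
        ← Module.End.mul_apply, ← pow_succ', hφ ⟨i, by omega⟩, if_neg (by simp [Fin.ext_iff]; omega)]
      simp
  refine ⟨u, ?_, isCompanionBlock_of_linearIndependent (hμ.add_of_left hdeg) (x := x) ?_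
    (by rw [hdim, hnat]) ?_⟩
  · have h0 : φ (f x) = 0 := by simpa [Fin.ext_iff] using hφ 0
    ext v
    simp [u, h0]
  · rw [hnat]
    convert hli using 2 with i
    exact hpow i i.2
  · have hlast : ((u * f) ^ (d + 2)) x = (f ^ (d + 2)) x - f x := by
      rw [pow_succ', Module.End.mul_apply, hpow _ (by omega), Module.End.mul_apply, hu,
        ← Module.End.mul_apply, ← pow_succ', show φ ((f ^ (d + 1 + 1)) x) = 1 by
          simpa using hφ (Fin.last (d + 1)), one_smul]
    have h1 := hpow 1 (by omega)
    rw [pow_one, pow_one] at h1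
    rw [aeval_eq_sum_range, hdd, Finset.sum_range_succ, LinearMap.add_apply,
      LinearMap.sum_apply] at hx
    rw [map_add, aeval_X, LinearMap.add_apply, h1, aeval_eq_sum_range, hdd,
      Finset.sum_range_succ, LinearMap.add_apply, LinearMap.sum_apply, LinearMap.smul_apply, hlast,
      Finset.sum_congr rfl fun i hi => by
        rw [LinearMap.smul_apply, hpow i (Finset.mem_range.1 hi), ← LinearMap.smul_apply]]
    have : μ.coeff (d + 2) = 1 := by rw [← hdd]; exact hμ.coeff_natDegree
    rw [this, one_smul] at hx ⊢
    rw [← hx]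
    abel

theorem exists_isCompanionBlock_of_scalar [FiniteDimensional F V] (hV : finrank F V = 2)
    {f : End F V} {c : F} (hf : ∀ v, f v = c • v) (hc : c ≠ 0) :
    ∃ u : End F V, (u - 1) * (u - 1) = 0 ∧ IsCompanionBlock ((X - C c) ^ 2) (u * f) := by
  let b := finBasisOfFinrankEq F V hV
  let u : End F V := 1 + (b.coord 0).smulRight (c⁻¹ • b 1)
  have hu : ∀ v, (u * f) v = c • v + b.coord 0 v • b 1 := fun v => by
    simp [u, hf, smul_smul, hc, mul_comm]
  have hnat : ((X - C c) ^ 2).natDegree = 2 := by simp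
  have h0 : (u * f) (b 0) = c • b 0 + b 1 := by simp [hu]
  have h1 : (u * f) (b 1) = c • b 1 := by simp [hu]
  refine ⟨u, ?_, isCompanionBlock_of_linearIndependent ((monic_X_sub_C c).pow 2) (x := b 0) ?_
    (by rw [hV, hnat]) ?_⟩
  · ext v
    simp [u]
  · rw [hnat, Fintype.linearIndependent_iff]
    intro a ha
    simp only [Fin.sum_univ_two, Fin.val_zero, Fin.val_one, pow_zero, pow_one,
      Module.End.one_apply, h0] at ha
    have ha0 := congrArg (b.coord 0) ha
    have ha1 := congrArg (b.coord 1) ha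
    simp at ha0 ha1
    rw [Fin.forall_fin_two]
    simp_all
  · have hk : ∀ v, (u * f - algebraMap F (End F V) c) v = (u * f) v - c • v := fun v => by
      simp [Module.algebraMap_end_apply]
    rw [map_pow, map_sub, aeval_X, aeval_C, pow_two, Module.End.mul_apply, hk, hk, h0,
      add_sub_cancel_left, h1, sub_self]

theorem isCompanionBlock_X_sub_C [FiniteDimensional F V] (hV : finrank F V = 1)
    {f : End F V} {c : F} (hf : ∀ v, f v = c • v) : IsCompanionBlock (X - C c) f := by
  have : Nontrivial V := nontrivial_of_finrank_pos (R := F) (by omega)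
  obtain ⟨x, hx⟩ := exists_ne (0 : V)
  refine isCompanionBlock_of_linearIndependent (monic_X_sub_C c) (x := x) ?_ (by simp [hV]) ?_
  · rw [natDegree_X_sub_C]
    exact LinearIndependent.of_subsingleton 0 (by simpa using hx)
  · simp [hf, Module.algebraMap_end_apply]

theorem exists_eq_smul_of_natDegree_minpoly_lt_two [FiniteDimensional F V] {f : End F V}
    (h : (minpoly F f).natDegree < 2) : ∃ c : F, ∀ v, f v = c • v := by
  have hmonic : (minpoly F f).Monic := minpoly.monic (Algebra.IsIntegral.isIntegral f)
  have h0 := minpoly.aeval F f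
  obtain h | h : (minpoly F f).natDegree = 0 ∨ (minpoly F f).natDegree = 1 := by omega
  · rw [hmonic.natDegree_eq_zero.1 h, map_one] at h0
    refine ⟨0, fun v => ?_⟩
    have hv : v = 0 := LinearMap.congr_fun h0 v
    simp [hv]
  · rw [hmonic.eq_X_add_C h, map_add, aeval_X, aeval_C] at h0
    refine ⟨-(minpoly F f).coeff 0, fun v => ?_⟩
    have hv := LinearMap.congr_fun h0 v
    rw [LinearMap.add_apply, Module.algebraMap_end_apply, LinearMap.zero_apply] at hv
    rw [neg_smul]
    exact eq_neg_of_add_eq_zero_left hv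

end

/-- Every injective endomorphism `f` killed by a polynomial `m` can be multiplied on the left by
some `u` with `(u - 1)² = 0` to obtain a direct sum of companion matrices of polynomials coprime to
a given polynomial coprime to `m`, of which all but the last have degree at least `2`. -/
theorem exists_isCompanionSum {F : Type*} [Field F] {p m : F[X]} (hpm : IsCoprime p m) (n : ℕ) :
    ∀ {V : Type*} [AddCommGroup V] [Module F V] [FiniteDimensional F V] (_ : finrank F V = n)
      {f : End F V} (_ : Function.Injective f) (_ : aeval f m = 0),
    ∃ (u : End F V) (s : ℕ) (q : Fin s → F[X]), (u - 1) * (u - 1) = 0 ∧ (∀ j, (q j).Monic) ∧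
      (∀ j : Fin s, (j : ℕ) + 1 ≠ s → 2 ≤ (q j).natDegree) ∧ (∀ j, IsCoprime p (q j)) ∧
      IsCompanionSum q (u * f) := by
  induction n using Nat.strong_induction_on with
  | _ n ih =>
  intro V _ _ _ hn f hf hm
  have step : ∀ {V₁ N : Submodule F V} (_ : IsCompl V₁ N) (h₁ : ∀ v ∈ V₁, f v ∈ V₁)
      (_ : ∀ v ∈ N, f v ∈ N) (_ : 0 < finrank F V₁) {q₁ : F[X]} (_ : q₁.Monic)
      (_ : 2 ≤ q₁.natDegree) (_ : IsCoprime p q₁)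
      (_ : ∃ u₁ : End F V₁, (u₁ - 1) * (u₁ - 1) = 0 ∧ IsCompanionBlock q₁ (u₁ * f.restrict h₁)),
      ∃ (u : End F V) (s : ℕ) (q : Fin s → F[X]), (u - 1) * (u - 1) = 0 ∧ (∀ j, (q j).Monic) ∧
      (∀ j : Fin s, (j : ℕ) + 1 ≠ s → 2 ≤ (q j).natDegree) ∧ (∀ j, IsCoprime p (q j)) ∧
      IsCompanionSum q (u * f) := by
    rintro V₁ N hc h₁ hN hV₁ q₁ hq₁ hd₁ hp₁ ⟨u₁, hu₁, hb₁⟩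
    have hdim := Submodule.finrank_add_eq_of_isCompl hc
    obtain ⟨u₂, s, q, hu₂, hq, hd, hp, hs⟩ := ih (finrank F N) (by omega) rfl
      (f := f.restrict hN) (fun a b h => Subtype.ext (hf (congrArg Subtype.val h)))
      (aeval_restrict_eq_zero hN hm)
    obtain ⟨u, hu, hsum⟩ := hb₁.exists_cons hc h₁ hN hu₁ hu₂ hs
    refine ⟨u, s + 1, Fin.cons q₁ q, hu, Fin.cases hq₁ hq, Fin.cases (fun _ => hd₁) fun j hj => ?_,
      Fin.cases hp₁ hp, hsum⟩
    exact hd j (by simpa using hj)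
  by_cases hscalar : ∃ c : F, ∀ v, f v = c • v
  · obtain ⟨c, hc⟩ := hscalar
    obtain h | h : finrank F V = 0 ∨ 0 < finrank F V := by omega
    · have : Subsingleton V := finrank_zero_iff.1 h
      exact ⟨1, 0, Fin.elim0, by simp, fun j => j.elim0, fun j => j.elim0, fun j => j.elim0,
        0, fun v j => j.elim0⟩
    have : Nontrivial V := nontrivial_of_finrank_pos h
    obtain ⟨x, hx⟩ := exists_ne (0 : V)
    have hc0 : c ≠ 0 := by
      rintro rfl
      exact hx (hf (by simp [hc]))
    have hcop : IsCoprime p (X - C c) := by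
      refine hpm.of_isCoprime_of_dvd_right (dvd_iff_isRoot.2 ?_)
      have h0 : aeval f m x = m.eval c • x :=
        Module.End.aeval_apply_of_hasEigenvector ⟨Module.End.mem_eigenspace_iff.2 (hc x), hx⟩
      rw [hm, LinearMap.zero_apply, eq_comm, smul_eq_zero] at h0
      exact h0.resolve_right hx
    obtain h1 | h2 : finrank F V = 1 ∨ 2 ≤ finrank F V := by omega
    · exact ⟨1, 1, fun _ => X - C c, by simp, fun _ => monic_X_sub_C c, fun j hj => by omega,
        fun _ => hcop, by simpa using (isCompanionBlock_X_sub_C h1 hc).isCompanionSum⟩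
    · obtain ⟨y, hy⟩ := exists_linearIndependent_of_le_finrank (R := F) (M := V) h2
      obtain ⟨V₁, hV₁⟩ : ∃ V₁ : Submodule F V, finrank F V₁ = 2 :=
        ⟨_, by simpa using finrank_span_eq_card hy⟩
      obtain ⟨N, hN⟩ := V₁.exists_isCompl
      have hinv : ∀ (W : Submodule F V), ∀ v ∈ W, f v ∈ W := fun W v hv => by
        rw [hc]
        exact W.smul_mem c hv
      refine step hN (hinv V₁) (hinv N) (by omega) ((monic_X_sub_C c).pow 2) (by simp)
        hcop.pow_right (exists_isCompanionBlock_of_scalar hV₁ (fun v => Subtype.ext (hc v)) hc0)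
  · have hd : 2 ≤ (minpoly F f).natDegree := by
      by_contra h
      exact hscalar (exists_eq_smul_of_natDegree_minpoly_lt_two (by omega))
    obtain ⟨V₁, N, h₁, hN, x, hc, hfin, hli⟩ := exists_isCompl_cyclic f (by omega)
    have hmonic : (minpoly F f).Monic := minpoly.monic (Algebra.IsIntegral.isIntegral f)
    refine step hc h₁ hN (by omega) hmonic hd
      (hpm.of_isCoprime_of_dvd_right (minpoly.dvd F f hm)) ⟨1, by simp, ?_⟩
    rw [one_mul]
    exact isCompanionBlock_of_linearIndependent hmonic hli hfin
      (by rw [aeval_restrict_eq_zero h₁ (minpoly.aeval F f), LinearMap.zero_apply])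

theorem IsCompanionSum.exists_similarMat {F : Type*} [Field F] {n r s : ℕ}
    {p : Fin r → F[X]} {q : Fin s → F[X]} {A : Matrix (Fin n) (Fin n) F}
    (h : IsCompanionSum (Fin.append p q) (Matrix.toLin' A)) :
    ∃ hn : (∑ k : Fin (r + s), (Fin.append p q k).natDegree) = n,
      SimilarMat A (Matrix.reindex (finCongr hn) (finCongr hn) (companionDirectSum p q)) := by
  obtain ⟨e, he⟩ := h
  have hn : (∑ k : Fin (r + s), (Fin.append p q k).natDegree) = n := by
    simpa [finrank_pi_fintype] using e.finrank_eq.symm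
  refine ⟨hn, ?_⟩
  let σ : (Σ k, Fin (Fin.append p q k).natDegree) ≃ Fin n :=
    (finSigmaEquiv _).trans (finCongr hn)
  let b : Basis (Fin n) F (Fin n → F) :=
    ((Pi.basis fun k => Pi.basisFun F (Fin (Fin.append p q k).natDegree)).map e.symm).reindex σ
  have hb : LinearMap.toMatrix b b (Matrix.toLin' A) =
      Matrix.reindex (finCongr hn) (finCongr hn) (companionDirectSum p q) := by
    ext i j
    obtain ⟨⟨i, a⟩, rfl⟩ := σ.surjective i
    obtain ⟨⟨j, c⟩, rfl⟩ := σ.surjective j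
    have hR : Matrix.reindex (finCongr hn) (finCongr hn) (companionDirectSum p q) (σ ⟨i, a⟩)
        (σ ⟨j, c⟩) = blockDiagonal' (fun k => companion (Fin.append p q k)) ⟨i, a⟩ ⟨j, c⟩ := by
      simp [companionDirectSum, σ]
    have hrepr : ∀ v, b.repr v (σ ⟨i, a⟩) = e v i a := fun v => by simp [b]
    have hbasis : e (b (σ ⟨j, c⟩)) = Pi.single j (Pi.single c 1) := by simp [b]
    rw [hR, LinearMap.toMatrix_apply, hrepr, he, hbasis]
    by_cases hij : i = j
    · subst hij
      simp
    · rw [Pi.single_eq_of_ne hij, blockDiagonal'_apply_ne _ _ _ hij]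
      simp
  refine ⟨(Pi.basisFun F (Fin n)).toMatrix b, ?_, ?_⟩
  · have := (Pi.basisFun F (Fin n)).invertibleToMatrix b
    exact isUnit_of_invertible _
  · rw [← hb, basis_toMatrix_mul_linearMap_toMatrix]
    nth_rw 1 [← LinearMap.toMatrix'_toLin' A, ← LinearMap.toMatrix_eq_toMatrix']
    exact linearMap_toMatrix_mul_basis_toMatrix ..

/-- **Proposition `adj4prop`.**
Let `M ∈ GLₙ(F)` be an invertible matrix that is neither scalar nor cyclic. Then `M` is
u-adjacent to a well-partitioned matrix: there are a U2-matrix `U` and a well-partitioned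
matrix `W` such that `U * M` is similar to `W`. -/
theorem stmt15 {F : Type*} [Field F] {n : ℕ}
    (M : Matrix (Fin n) (Fin n) F) (hM : IsUnit M)
    (hscalar : ¬ ∃ c : F, M = c • (1 : Matrix (Fin n) (Fin n) F))
    (hcyc : ¬ IsCyclicMat M) :
    ∃ (U W : Matrix (Fin n) (Fin n) F),
      (U - 1) * (U - 1) = 0 ∧ IsWellPartitioned W ∧ SimilarMat (U * M) W := by
  let f : End F (Fin n → F) := Matrix.toLin' M
  have hf : Function.Injective f := Matrix.mulVec_injective_of_isUnit hM
  have hint : IsIntegral F f := Algebra.IsIntegral.isIntegral f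
  have hmonic : (minpoly F f).Monic := minpoly.monic hint
  have hd : 2 ≤ (minpoly F f).natDegree := by
    by_contra h
    obtain ⟨c, hc⟩ := exists_eq_smul_of_natDegree_minpoly_lt_two (f := f) (by omega)
    refine hscalar ⟨c, Matrix.toLin'.injective (LinearMap.ext fun v => ?_)⟩
    simpa [f] using hc v
  have hX : IsCoprime (X : F[X]) (minpoly F f) := by
    rw [irreducible_X.coprime_iff_not_dvd]
    rintro ⟨g, hg⟩
    have h0 := minpoly.aeval F f
    rw [hg, map_mul, aeval_X] at h0
    have hg0 : aeval f g = 0 := LinearMap.ext fun v => hf (by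
      simpa using LinearMap.congr_fun h0 v)
    have hne : g ≠ 0 := fun h => hmonic.ne_zero (by rw [hg, h, mul_zero])
    have := natDegree_le_of_dvd (minpoly.dvd F f hg0) hne
    rw [hg, natDegree_X_mul hne] at this
    omega
  have hcop : IsCoprime (minpoly F f + X) (minpoly F f) := by
    simpa [add_comm] using hX.add_mul_left_left 1
  obtain ⟨V₁, N, h₁, hN, x, hc, hfin, hli⟩ := exists_isCompl_cyclic f (by omega)
  obtain ⟨u₁, hu₁, hb₁⟩ := exists_isCompanionBlock_add_X (f := f.restrict h₁)
    (fun a b h => Subtype.ext (hf (congrArg Subtype.val h))) hmonic hd hli hfin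
    (by rw [aeval_restrict_eq_zero h₁ (minpoly.aeval F f), LinearMap.zero_apply])
  obtain ⟨u₂, s, q, hu₂, hq, hdq, hpq, hs⟩ := exists_isCompanionSum hcop _ rfl
    (f := f.restrict hN) (fun a b h => Subtype.ext (hf (congrArg Subtype.val h)))
    (aeval_restrict_eq_zero hN (minpoly.aeval F f))
  have hspos : 1 ≤ s := by
    by_contra h
    obtain rfl : s = 0 := by omega
    obtain ⟨e, -⟩ := hs
    have hNbot : N = ⊥ := by
      have := e.toEquiv.subsingleton
      exact Submodule.subsingleton_iff_eq_bot.1 this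
    have hfr := Submodule.finrank_add_eq_of_isCompl hc
    rw [hNbot, finrank_bot, hfin] at hfr
    have hspan := (hli.map' V₁.subtype V₁.ker_subtype).span_eq_top_of_card_eq_finrank'
      (by simpa using hfr)
    refine hcyc ⟨x, top_le_iff.1 (hspan.ge.trans (Submodule.span_mono ?_))⟩
    rintro _ ⟨i, rfl⟩
    refine ⟨i, ?_⟩
    simp only [Function.comp_apply]
    rw [Module.End.pow_restrict (i : ℕ) h₁, ← Matrix.toLin'_apply, Matrix.toLin'_pow]
    rfl
  obtain ⟨u, hu, hsum⟩ := hb₁.exists_cons hc h₁ hN hu₁ hu₂ hs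
  have happ : Fin.append (fun _ : Fin 1 => minpoly F f + X) q =
      (Fin.cons (minpoly F f + X) q : Fin (s + 1) → F[X]) ∘ finCongr (Nat.add_comm 1 s) := by
    rw [Fin.append_left_eq_cons]
    rfl
  have hsum' := hsum.comp_equiv (finCongr (Nat.add_comm 1 s))
  rw [← happ, show u * f = Matrix.toLin' (LinearMap.toMatrix' u * M) by
    rw [Matrix.toLin'_mul, Matrix.toLin'_toMatrix']; rfl] at hsum'
  obtain ⟨hn, hsim⟩ := hsum'.exists_similarMat
  have hdeg : (X : F[X]).degree < (minpoly F f).degree := by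
    rw [degree_X, degree_eq_natDegree hmonic.ne_zero]
    exact_mod_cast hd
  refine ⟨LinearMap.toMatrix' u, _, ?_, ⟨1, s, le_rfl, hspos, _, q, fun _ => hmonic.add_of_left hdeg,
    hq, fun i hi => by omega, hdq, fun _ => hpq, hn, rfl⟩, hsim⟩
  rw [← LinearMap.toMatrix'_one, ← map_sub, ← LinearMap.toMatrix'_mul, hu, map_zero]
end

section
/- Let F be a field, let α ∈ F be nonzero, and let n ≥ 1 be an integer such that αⁿ = 1 or αⁿ = −1. Then the scalar matrix αI_n is a product of four involutions of GL_n(F), and it is also a product of two involutions and two U2-matrices of GL_n(F). -/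
section DiagonalFactorizations

variable {ι F : Type*} [Fintype ι] [DecidableEq ι] [Field F]

/-- The permutation matrix of an involution exists as an involutory matrix which intertwines
diagonal matrices. -/
theorem exists_involution_mul_diagonal (σ : ι → ι) (hσ : Function.Involutive σ) :
    ∃ P : Matrix ι ι F, P * P = 1 ∧
      ∀ b : ι → F, P * Matrix.diagonal b = Matrix.diagonal (b ∘ σ) * P := by
  refine ⟨Matrix.of fun i j => if σ i = j then 1 else 0, ?_, fun b => ?_⟩
  · ext i j
    rw [Matrix.mul_apply, Fintype.sum_eq_single (σ i) fun k hk => by simp [hk.symm]]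
    simp [Matrix.one_apply, hσ i]
  · ext i j
    by_cases hij : σ i = j <;> simp [hij]

/-- A diagonal matrix whose entries are inverted by an involution of the index set is a product
of two involutions. -/
theorem diagonal_eq_mul_involutions (b : ι → F) (σ : ι → ι) (hσ : Function.Involutive σ)
    (hb : ∀ i, b (σ i) * b i = 1) :
    ∃ S T : Matrix ι ι F, S * S = 1 ∧ T * T = 1 ∧ Matrix.diagonal b = S * T := by
  obtain ⟨P, hP, hc⟩ := exists_involution_mul_diagonal (F := F) σ hσ
  refine ⟨P, P * Matrix.diagonal b, hP, ?_, by rw [← mul_assoc, hP, one_mul]⟩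
  calc P * Matrix.diagonal b * (P * Matrix.diagonal b)
      = Matrix.diagonal (b ∘ σ) * (P * P) * Matrix.diagonal b := by
        nth_rewrite 1 [hc]; simp only [mul_assoc]
    _ = 1 := by simp [hP, Matrix.diagonal_mul_diagonal, hb]

/-- A diagonal matrix whose entries are inverted by an involution of the index set, and which does
not have the eigenvalue `-1` unless `-1 = 1`, is a product of two U2-matrices. -/
theorem diagonal_eq_mul_unipotents (b : ι → F) (σ : ι → ι) (hσ : Function.Involutive σ)
    (hb : ∀ i, b (σ i) * b i = 1) (hne : ∀ i, b i = -1 → (1 : F) = -1) :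
    ∃ U V : Matrix ι ι F, (U - 1) * (U - 1) = 0 ∧ (V - 1) * (V - 1) = 0 ∧
      Matrix.diagonal b = U * V := by
  obtain ⟨P, hP, hc⟩ := exists_involution_mul_diagonal (F := F) σ hσ
  set p : ι → F := fun i => (b i - 1) / (b i + 1) with hp
  have hpb (i : ι) : p i * (b i + 1) = b i - 1 := by
    by_cases h : b i + 1 = 0
    · have h1 : b i = -1 := eq_neg_of_add_eq_zero_left h
      rw [h, mul_zero, h1, ← hne i h1, sub_self]
    · exact div_mul_cancel₀ _ h
  have hpσ (i : ι) : p (σ i) = -p i := by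
    have h0 : b i ≠ 0 := right_ne_zero_of_mul_eq_one (hb i)
    have h1 : b (σ i) = (b i)⁻¹ := eq_inv_of_mul_eq_one_left (hb i)
    simp only [hp, h1]
    rw [← mul_div_mul_right ((b i)⁻¹ - 1) ((b i)⁻¹ + 1) h0, sub_mul, add_mul,
      inv_mul_cancel₀ h0, one_mul, ← neg_div, neg_sub, add_comm 1]
  set M := Matrix.diagonal b
  set M' := Matrix.diagonal (b ∘ σ)
  set D := Matrix.diagonal p
  have hPD : P * D = -(D * P) := by
    rw [hc, show p ∘ σ = fun i => -p i from funext hpσ, ← Matrix.diagonal_neg, neg_mul]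
  have hPM : P * M = M' * P := hc b
  have hMM : M' * M = 1 := by simp [M, M', Matrix.diagonal_mul_diagonal, hb]
  have hDM : D * M + D = M - 1 := by
    ext i j
    by_cases hij : i = j
    · subst hij; simpa [D, M, mul_add] using hpb i
    · simp [D, M, hij]
  have hDM' : M' * D = D * M' := by
    simp [M', D, Matrix.diagonal_mul_diagonal, mul_comm]
  have hN : D * (1 + P) * (D * (1 + P)) = 0 := by
    calc D * (1 + P) * (D * (1 + P)) = D * (D + P * D) * (1 + P) := by noncomm_ring
      _ = D * D * (1 - P * P) := by rw [hPD]; noncomm_ring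
      _ = 0 := by rw [hP, sub_self, mul_zero]
  have hV : (1 - D * (1 + P)) * M - 1 = D * (1 - M' * P) := by
    calc (1 - D * (1 + P)) * M - 1 = (M - 1) - D * M - D * (P * M) := by noncomm_ring
      _ = D * (1 - M' * P) := by rw [← hDM, hPM]; noncomm_ring
  have hQ : M' * P * (M' * P) = 1 := by
    calc M' * P * (M' * P) = M' * P * (P * M) := by rw [hPM]
      _ = M' * (P * P) * M := by noncomm_ring
      _ = 1 := by rw [hP, mul_one, hMM]
  have hQD : M' * P * D = -(D * (M' * P)) := by
    rw [mul_assoc, hPD, mul_neg, ← mul_assoc, hDM', mul_assoc]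
  refine ⟨1 + D * (1 + P), (1 - D * (1 + P)) * M, by rwa [add_sub_cancel_left], ?_, ?_⟩
  · rw [hV]
    calc D * (1 - M' * P) * (D * (1 - M' * P))
        = D * (D - M' * P * D) * (1 - M' * P) := by noncomm_ring
      _ = D * D * (1 - M' * P * (M' * P)) := by rw [hQD]; noncomm_ring
      _ = 0 := by rw [hQ, sub_self, mul_zero]
  · calc M = (1 - D * (1 + P) * (D * (1 + P))) * M := by rw [hN, sub_zero, one_mul]
      _ = (1 + D * (1 + P)) * ((1 - D * (1 + P)) * M) := by noncomm_ring

end DiagonalFactorizations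


/-- **Lemma `scalar4lemma1`.**
Let `F` be a field, `α ∈ F` nonzero, and `n ≥ 1` with `αⁿ = ±1`. Then the scalar matrix
`α Iₙ` is a product of four involutions, and also a product of two involutions and two
U2-matrices. -/
theorem stmt16 {F : Type*} [Field F] (α : F) (hα : α ≠ 0)
    (n : ℕ) (hn : 1 ≤ n) (h : α ^ n = 1 ∨ α ^ n = -1) :
    (∃ S : Fin 4 → Matrix (Fin n) (Fin n) F,
        (∀ j, S j * S j = 1) ∧
        α • (1 : Matrix (Fin n) (Fin n) F) = S 0 * S 1 * S 2 * S 3) ∧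
    (∃ (B : Fin 4 → Matrix (Fin n) (Fin n) F) (s : Finset (Fin 4)),
        s.card = 2 ∧
        (∀ j ∈ s, B j * B j = 1) ∧
        (∀ j ∉ s, (B j - 1) * (B j - 1) = 0) ∧
        α • (1 : Matrix (Fin n) (Fin n) F) = B 0 * B 1 * B 2 * B 3) := by
  have : NeZero n := ⟨by omega⟩
  have h2 : (α ^ 2) ^ n = 1 := by
    rw [← pow_mul, mul_comm, pow_mul]
    rcases h with h | h <;> simp [h]
  let b : Fin n → F := fun k => α * (α ^ 2) ^ (k : ℕ)
  let c : Fin n → F := fun k => ((α ^ 2) ^ (k : ℕ))⁻¹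
  have hb (k : Fin n) : b (Fin.rev k) * b k = 1 := by
    have hk : (Fin.rev k : ℕ) + k + 1 = n := by rw [Fin.val_rev]; omega
    calc b (Fin.rev k) * b k = (α ^ 2) ^ ((Fin.rev k : ℕ) + k + 1) := by simp only [b]; ring
      _ = 1 := by rw [hk, h2]
  have hc (k : Fin n) : c (-k) * c k = 1 := by
    simp only [c]
    rw [← mul_inv, Fin.val_neg', ← pow_eq_pow_mod _ h2, ← pow_add,
      Nat.sub_add_cancel k.isLt.le, h2, inv_one]
  have hbc : α • (1 : Matrix (Fin n) (Fin n) F) = Matrix.diagonal b * Matrix.diagonal c := by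
    rw [Matrix.diagonal_mul_diagonal, Matrix.smul_one_eq_diagonal]
    congr 1
    funext k
    exact (mul_inv_cancel_right₀ (pow_ne_zero _ (pow_ne_zero _ hα)) α).symm
  obtain ⟨S, T, hS, hT, hST⟩ := diagonal_eq_mul_involutions b Fin.rev Fin.rev_involutive hb
  obtain ⟨S', T', hS', hT', hST'⟩ := diagonal_eq_mul_involutions c (-·) neg_involutive hc
  constructor
  · refine ⟨![S, T, S', T'], ?_, ?_⟩
    · simp [Fin.forall_fin_succ, hS, hT, hS', hT']
    · simp [hbc, hST, hST', mul_assoc]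
  by_cases hne : ∀ k, b k = -1 → (1 : F) = -1
  · obtain ⟨U, V, hU, hV, hUV⟩ := diagonal_eq_mul_unipotents b Fin.rev Fin.rev_involutive hb hne
    refine ⟨![U, V, S', T'], {2, 3}, rfl, ?_, ?_, ?_⟩
    · simp [hS', hT']
    · simp [Fin.forall_fin_succ, hU, hV]
    · simp [hbc, hUV, hST', mul_assoc]
  · have hne' (l : Fin n) (hl : c l = -1) : (1 : F) = -1 := by
      push Not at hne
      obtain ⟨k, hk, -⟩ := hne
      have hl' : (α ^ 2) ^ (l : ℕ) = -1 := by rw [← inv_inj, inv_neg_one]; exact hl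
      have hk' : α ^ (2 * (k : ℕ) + 1) = -1 := by rw [← hk]; simp only [b]; ring
      calc (1 : F) = (α ^ (2 * (k : ℕ) + 1)) ^ (2 * (l : ℕ)) := by rw [hk', pow_mul]; simp
        _ = ((α ^ 2) ^ (l : ℕ)) ^ (2 * (k : ℕ) + 1) := by ring
        _ = -1 := by rw [hl', Odd.neg_one_pow ⟨k, rfl⟩]
    obtain ⟨U, V, hU, hV, hUV⟩ := diagonal_eq_mul_unipotents c (-·) neg_involutive hc hne'
    refine ⟨![S, T, U, V], {0, 1}, rfl, ?_, ?_, ?_⟩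
    · simp [hS, hT]
    · simp [Fin.forall_fin_succ, hU, hV]
    · simp [hbc, hUV, hST, mul_assoc]
end

section
/- Let F be a field, let α ∈ F be nonzero, and let n ≥ 1 be an integer such that αⁿ = 1. Then the scalar matrix αI_n is a product of four U2-matrices of GL_n(F). -/
section Palindrome

variable {A : Type*} [CommRing A]

/-- The Laurent palindrome `y ^ i + ⋯ + y + 1 + x + ⋯ + x ^ i`, used when `x * y = 1`. -/
def palindrome (x y : A) : ℕ → A
  | 0 => 1
  | i + 1 => palindrome x y i + (x ^ (i + 1) + y ^ (i + 1))

theorem sub_one_mul_palindrome {x y : A} (hxy : x * y = 1) (i : ℕ) :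
    (x - 1) * palindrome x y i = x ^ (i + 1) - y ^ i := by
  induction i with
  | zero => simp [palindrome]
  | succ i ih =>
    rw [palindrome, mul_add, ih]
    linear_combination y ^ i * hxy

theorem add_mul_palindrome_zero (x y : A) :
    (x + y) * palindrome x y 0 = palindrome x y 1 - palindrome x y 0 := by
  simp [palindrome]

theorem add_mul_palindrome_succ {x y : A} (hxy : x * y = 1) (i : ℕ) :
    (x + y) * palindrome x y (i + 1) = palindrome x y (i + 2) + palindrome x y i := by
  induction i with
  | zero =>
    simp only [palindrome]
    linear_combination 2 * hxy
  | succ i ih =>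
    rw [palindrome, mul_add, ih, palindrome.eq_2 x y (i + 2), palindrome.eq_2 x y i]
    linear_combination (x ^ (i + 1) + y ^ (i + 1)) * hxy

variable {F : Type*} [Field F] [Algebra F A]

/-- The span of the first `⌈n / 2⌉` palindromes. -/
def palindromeSpan (F : Type*) [Field F] [Algebra F A] (x y : A) (n : ℕ) : Submodule F A :=
  Submodule.span F (Set.range fun i : Fin ((n + 1) / 2) ↦ palindrome x y i)

theorem palindrome_mem_of_lt (x y : A) {n i : ℕ} (hi : i < (n + 1) / 2) :
    palindrome x y i ∈ palindromeSpan F x y n :=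
  Submodule.subset_span ⟨⟨i, hi⟩, rfl⟩

theorem one_mem_palindromeSpan (x y : A) {n : ℕ} (hn : 1 ≤ n) :
    1 ∈ palindromeSpan F x y n :=
  palindrome_mem_of_lt x y (i := 0) (by lia)

theorem palindrome_mem {x y : A} (hxy : x * y = 1) {n : ℕ} (hn : 1 ≤ n)
    (hx : x ^ n = (-1) ^ (n - 1)) {i : ℕ} (hi : i ≤ (n + 1) / 2) :
    palindrome x y i ∈ palindromeSpan F x y n := by
  obtain hi | rfl := hi.lt_or_eq
  · exact palindrome_mem_of_lt x y hi
  have hpow (m : ℕ) : x ^ m * y ^ m = 1 := by rw [← mul_pow, hxy, one_pow]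
  obtain ⟨m, rfl | rfl⟩ := n.even_or_odd'
  · obtain ⟨m, rfl⟩ : ∃ k, m = k + 1 := ⟨m - 1, by lia⟩
    have e : x ^ (m + 1) + y ^ (m + 1) = 0 := by
      have h : x ^ (2 * (m + 1)) = -1 := by
        rw [hx, Odd.neg_one_pow ⟨m, by lia⟩]
      linear_combination y ^ (m + 1) * h - x ^ (m + 1) * hpow (m + 1)
    rw [show (2 * (m + 1) + 1) / 2 = m + 1 by lia, palindrome, e, add_zero]
    exact palindrome_mem_of_lt x y (by lia)
  · have h : x ^ (2 * m + 1) = 1 := by rw [hx, Even.neg_one_pow ⟨m, by lia⟩]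
    have e₁ : x ^ (m + 1) = y ^ m := by
      linear_combination y ^ m * h - x ^ (m + 1) * hpow m
    have e₂ : y ^ (m + 1) = x ^ m := by
      linear_combination x ^ m * hpow (m + 1) - y ^ (m + 1) * h
    rw [show (2 * m + 1 + 1) / 2 = m + 1 by lia]
    have hm : palindrome x y m ∈ palindromeSpan F x y (2 * m + 1) :=
      palindrome_mem_of_lt x y (by lia)
    obtain _ | m := m
    · rw [palindrome, e₁, e₂, pow_zero, pow_zero]
      exact add_mem hm (add_mem hm hm)
    · have e : palindrome x y (m + 1 + 1) =
          palindrome x y (m + 1) + (palindrome x y (m + 1) - palindrome x y m) := by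
        rw [palindrome, e₁, e₂, palindrome]
        ring
      rw [e]
      exact add_mem hm (sub_mem hm (palindrome_mem_of_lt x y (by lia)))

theorem add_mul_mem_palindromeSpan {x y : A} (hxy : x * y = 1) {n : ℕ} (hn : 1 ≤ n)
    (hx : x ^ n = (-1) ^ (n - 1)) {a : A} (ha : a ∈ palindromeSpan F x y n) :
    (x + y) * a ∈ palindromeSpan F x y n := by
  induction ha using Submodule.span_induction with
  | zero => simp
  | add a b _ _ iha ihb => rw [mul_add]; exact add_mem iha ihb
  | smul c a _ ih => rw [mul_smul_comm]; exact Submodule.smul_mem _ c ih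
  | mem a ha =>
    obtain ⟨⟨i, hi⟩, rfl⟩ := ha
    have mem {j : ℕ} (hj : j ≤ (n + 1) / 2) := palindrome_mem (F := F) hxy hn hx hj
    obtain _ | i := i
    · simp only [add_mul_palindrome_zero]
      exact sub_mem (mem (by lia)) (mem (by lia))
    · simp only [add_mul_palindrome_succ hxy]
      exact add_mem (mem (by lia)) (mem (by lia))

/-- The image of the span of palindromes under multiplication by `x - 1`. -/
def antipalindromeSpan (F : Type*) [Field F] [Algebra F A] (x y : A) (n : ℕ) : Submodule F A :=
  (palindromeSpan F x y n).map (LinearMap.mulLeft F (x - 1))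

theorem sub_one_mul_mem_antipalindromeSpan {x y : A} {n : ℕ} {a : A}
    (ha : a ∈ palindromeSpan F x y n) : (x - 1) * a ∈ antipalindromeSpan F x y n :=
  ⟨a, ha, rfl⟩

theorem one_sub_mul_mem_palindromeSpan {x y : A} (hxy : x * y = 1) {n : ℕ} (hn : 1 ≤ n)
    (hx : x ^ n = (-1) ^ (n - 1)) {a : A} (ha : a ∈ antipalindromeSpan F x y n) :
    (1 - y) * a ∈ palindromeSpan F x y n := by
  obtain ⟨b, hb, rfl⟩ := ha
  have e : (1 - y) * (x - 1) * b = (x + y) * b - b - b := by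
    linear_combination -b * hxy
  rw [LinearMap.mulLeft_apply, ← mul_assoc, e]
  exact sub_mem (sub_mem (add_mul_mem_palindromeSpan hxy hn hx hb) hb) hb

theorem mul_mem_sup_antipalindromeSpan {x y : A} (hxy : x * y = 1) {n : ℕ} (hn : 1 ≤ n)
    (hx : x ^ n = (-1) ^ (n - 1)) {a : A}
    (ha : a ∈ palindromeSpan F x y n ⊔ antipalindromeSpan F x y n) :
    x * a ∈ palindromeSpan F x y n ⊔ antipalindromeSpan F x y n := by
  obtain ⟨b, hb, _, ⟨c, hc, rfl⟩, rfl⟩ := Submodule.mem_sup.1 ha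
  have hc' := add_mul_mem_palindromeSpan hxy hn hx hc
  have e : x * (b + (x - 1) * c) =
      (b + ((x + y) * c - c - c)) + ((x - 1) * (b + ((x + y) * c - c))) := by
    linear_combination -c * hxy
  rw [LinearMap.mulLeft_apply, e]
  exact Submodule.add_mem_sup (add_mem hb (sub_mem (sub_mem hc' hc) hc))
    (sub_one_mul_mem_antipalindromeSpan (add_mem hb (sub_mem hc' hc)))

theorem sup_antipalindromeSpan_eq_top {x y : A} (hxy : x * y = 1) {n : ℕ} (hn : 1 ≤ n)
    (hx : x ^ n = (-1) ^ (n - 1)) (hgen : ∀ a : A, ∃ p : Polynomial F, Polynomial.aeval x p = a) :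
    palindromeSpan F x y n ⊔ antipalindromeSpan F x y n = ⊤ := by
  refine Submodule.eq_top_iff'.2 fun a ↦ ?_
  obtain ⟨p, rfl⟩ := hgen a
  have hpow (k : ℕ) : x ^ k ∈ palindromeSpan F x y n ⊔ antipalindromeSpan F x y n := by
    induction k with
    | zero => simpa using Submodule.mem_sup_left (one_mem_palindromeSpan x y hn)
    | succ k ih =>
      rw [pow_succ']
      exact mul_mem_sup_antipalindromeSpan hxy hn hx ih
  rw [Polynomial.aeval_eq_sum_range]
  exact Submodule.sum_mem _ fun k _ ↦ Submodule.smul_mem _ _ (hpow k)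

theorem finrank_antipalindromeSpan_le {x y : A} (hxy : x * y = 1) {n : ℕ}
    (hx : x ^ n = (-1) ^ (n - 1)) :
    Module.finrank F (antipalindromeSpan F x y n) ≤ n / 2 := by
  let v : Fin (n / 2) → A := fun i ↦ (x - 1) * palindrome x y i
  have hle : antipalindromeSpan F x y n ≤ Submodule.span F (Set.range v) := by
    rw [antipalindromeSpan, palindromeSpan, Submodule.map_span, Submodule.span_le]
    rintro _ ⟨_, ⟨⟨i, hi⟩, rfl⟩, rfl⟩
    by_cases hi' : i < n / 2
    · exact Submodule.subset_span ⟨⟨i, hi'⟩, rfl⟩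
    · obtain rfl : n = 2 * i + 1 := by lia
      have h : x ^ (2 * i + 1) = 1 := by rw [hx, Even.neg_one_pow ⟨i, by lia⟩]
      have hpow : x ^ i * y ^ i = 1 := by rw [← mul_pow, hxy, one_pow]
      have e : (x - 1) * palindrome x y i = 0 := by
        rw [sub_one_mul_palindrome hxy]
        linear_combination y ^ i * h - x ^ (i + 1) * hpow
      simp [e]
  have : Module.Finite F (Submodule.span F (Set.range v)) :=
    FiniteDimensional.span_of_finite F (Set.finite_range v)
  calc _ ≤ Module.finrank F (Submodule.span F (Set.range v)) := Submodule.finrank_mono hle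
    _ ≤ n / 2 := (finrank_range_le_card (R := F) v).trans_eq (Fintype.card_fin _)

theorem isCompl_antipalindromeSpan {x y : A} (hxy : x * y = 1) {n : ℕ} (hn : 1 ≤ n)
    (hx : x ^ n = (-1) ^ (n - 1)) (hgen : ∀ a : A, ∃ p : Polynomial F, Polynomial.aeval x p = a)
    [Module.Finite F A] (hrank : Module.finrank F A = n) :
    IsCompl (palindromeSpan F x y n) (antipalindromeSpan F x y n) := by
  have htop := sup_antipalindromeSpan_eq_top hxy hn hx hgen
  refine ⟨?_, codisjoint_iff.2 htop⟩
  have h₁ : Module.finrank F (palindromeSpan F x y n) ≤ (n + 1) / 2 := by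
    simpa using! finrank_range_le_card (R := F) fun i : Fin ((n + 1) / 2) ↦ palindrome x y i
  have h₂ := finrank_antipalindromeSpan_le (F := F) hxy hx
  have h := Submodule.finrank_sup_add_finrank_inf_eq
    (palindromeSpan F x y n) (antipalindromeSpan F x y n)
  rw [htop, finrank_top, hrank] at h
  exact disjoint_iff.2 (Submodule.finrank_eq_zero.1 (by lia))

theorem exists_mulLeft_eq_one_add_mul_one_add {x y : A} (hxy : x * y = 1) {n : ℕ} (hn : 1 ≤ n)
    (hx : x ^ n = (-1) ^ (n - 1)) (hgen : ∀ a : A, ∃ p : Polynomial F, Polynomial.aeval x p = a)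
    [Module.Finite F A] (hrank : Module.finrank F A = n) :
    ∃ N M : Module.End F A, N * N = 0 ∧ M * M = 0 ∧
      LinearMap.mulLeft F x = (1 + N) * (1 + M) := by
  have hc := isCompl_antipalindromeSpan hxy hn hx hgen hrank
  let P : Module.End F A := Submodule.projection _ _ hc
  let Q : Module.End F A := Submodule.projection _ _ hc.symm
  have hPQ : P + Q = 1 := by
    ext a
    exact Submodule.projection_add_projection_eq_self hc a
  have hN : LinearMap.mulLeft F (x - 1) * P * (LinearMap.mulLeft F (x - 1) * P) = 0 := by
    ext a
    have h : P ((x - 1) * P a) = 0 := (Submodule.projection_apply_eq_zero_iff hc).2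
      (sub_one_mul_mem_antipalindromeSpan (Submodule.projection_apply_mem hc a))
    simp [h]
  have hM : LinearMap.mulLeft F (1 - y) * Q * (LinearMap.mulLeft F (1 - y) * Q) = 0 := by
    ext a
    have h : Q ((1 - y) * Q a) = 0 := (Submodule.projection_apply_eq_zero_iff hc.symm).2
      (one_sub_mul_mem_palindromeSpan hxy hn hx (Submodule.projection_apply_mem hc.symm a))
    simp [h]
  refine ⟨_, _, hN, hM, ?_⟩
  have e : 1 + LinearMap.mulLeft F (x - 1) * P =
      LinearMap.mulLeft F x * (1 - LinearMap.mulLeft F (1 - y) * Q) := by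
    ext a
    have ha : P a + Q a = a := DFunLike.congr_fun hPQ a
    simp only [LinearMap.add_apply, Module.End.one_apply, Module.End.mul_apply,
      LinearMap.mulLeft_apply, LinearMap.sub_apply]
    linear_combination (x - 1) * ha - Q a * hxy
  have e' (T : Module.End F A) (hT : T * T = 0) : (1 - T) * (1 + T) = 1 := by
    simp [sub_mul, mul_add, hT]
  rw [e, mul_assoc, e' _ hM, mul_one]

end Palindrome

theorem exists_four_unipotent_of_conj {F E : Type*} [CommRing F] [Ring E] [Algebra F E] {α : F}
    {N M D D' : E} (hN : N * N = 0) (hM : M * M = 0) (hD : D' * D = 1)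
    (hconj : D * ((1 + N) * (1 + M)) * D' = α • ((1 + N) * (1 + M))) (hD' : D * D' = 1) :
    ∃ U₁ U₂ U₃ U₄ : E,
      (U₁ - 1) * (U₁ - 1) = 0 ∧ (U₂ - 1) * (U₂ - 1) = 0 ∧
      (U₃ - 1) * (U₃ - 1) = 0 ∧ (U₄ - 1) * (U₄ - 1) = 0 ∧
      α • (1 : E) = U₁ * U₂ * U₃ * U₄ := by
  have conj_mul (S T : E) : D * S * D' * (D * T * D') = D * (S * T) * D' := by
    rw [show D * S * D' * (D * T * D') = D * S * (D' * D) * T * D' by noncomm_ring, hD]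
    noncomm_ring
  have conj_sub (T : E) : D * (1 + T) * D' - 1 = D * T * D' := by
    rw [mul_add, add_mul, mul_one, hD', add_sub_cancel_left]
  have inv (T : E) (hT : T * T = 0) : (1 + T) * (1 - T) = 1 := by
    rw [show (1 + T) * (1 - T) = 1 - T * T by noncomm_ring, hT, sub_zero]
  refine ⟨D * (1 + N) * D', D * (1 + M) * D', 1 - M, 1 - N, ?_, ?_, ?_, ?_, ?_⟩
  · rw [conj_sub, conj_mul, hN, mul_zero, zero_mul]
  · rw [conj_sub, conj_mul, hM, mul_zero, zero_mul]
  · simpa using hM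
  · simpa using hN
  · rw [conj_mul, hconj, smul_mul_assoc, smul_mul_assoc, mul_assoc (1 + N), inv M hM, mul_one,
      inv N hN]

theorem root_X_pow_sub_C_pow_eq {F : Type*} [Field F] (n : ℕ) (c : F) :
    AdjoinRoot.root (Polynomial.X ^ n - Polynomial.C c) ^ n = algebraMap F _ c := by
  have h := AdjoinRoot.eval₂_root (Polynomial.X ^ n - Polynomial.C c)
  rwa [Polynomial.eval₂_sub, Polynomial.eval₂_X_pow, Polynomial.eval₂_C, sub_eq_zero] at h

/-- The automorphism of `F[X] / (X ^ n - c)` scaling the root by an `n`-th root of unity. -/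
theorem exists_algEquiv_root_eq_smul {F : Type*} [Field F] {α : F} (hα : α ≠ 0) {n : ℕ}
    (h : α ^ n = 1) (c : F) :
    ∃ σ : AdjoinRoot (Polynomial.X ^ n - Polynomial.C c) ≃ₐ[F]
        AdjoinRoot (Polynomial.X ^ n - Polynomial.C c),
      σ (AdjoinRoot.root _) = α • AdjoinRoot.root _ := by
  set f : Polynomial F := Polynomial.X ^ n - Polynomial.C c
  have hroot : AdjoinRoot.root f ^ n = algebraMap F _ c := root_X_pow_sub_C_pow_eq n c
  have hβ {β : F} (hβ : β ^ n = 1) :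
      f.eval₂ (Algebra.ofId F (AdjoinRoot f) : F →+* AdjoinRoot f) (β • AdjoinRoot.root f) = 0 := by
    simp [f, smul_pow, hβ, hroot]
  have hinv : α⁻¹ ^ n = 1 := by rw [inv_pow, h, inv_one]
  refine ⟨AlgEquiv.ofAlgHom (AdjoinRoot.liftAlgHom f (Algebra.ofId F _) _ (hβ h))
    (AdjoinRoot.liftAlgHom f (Algebra.ofId F _) _ (hβ hinv)) ?_ ?_, ?_⟩
  · exact AdjoinRoot.algHom_ext (by simp [smul_smul, hα])
  · exact AdjoinRoot.algHom_ext (by simp [smul_smul, hα])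
  · simp

/-- **Lemma `scalar4lemma2`.**
Let `F` be a field, `α ∈ F` nonzero, and `n ≥ 1` with `αⁿ = 1`. Then the scalar matrix
`α Iₙ` is a product of four U2-matrices. -/
theorem stmt17 {F : Type*} [Field F] (α : F) (hα : α ≠ 0)
    (n : ℕ) (hn : 1 ≤ n) (h : α ^ n = 1) :
    ∃ U₁ U₂ U₃ U₄ : Matrix (Fin n) (Fin n) F,
      (U₁ - 1) * (U₁ - 1) = 0 ∧ (U₂ - 1) * (U₂ - 1) = 0 ∧
      (U₃ - 1) * (U₃ - 1) = 0 ∧ (U₄ - 1) * (U₄ - 1) = 0 ∧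
      α • (1 : Matrix (Fin n) (Fin n) F) = U₁ * U₂ * U₃ * U₄ := by
  let f : Polynomial F := Polynomial.X ^ n - Polynomial.C ((-1) ^ (n - 1))
  obtain ⟨σ, hσ⟩ : ∃ σ : AdjoinRoot f ≃ₐ[F] AdjoinRoot f,
      σ (AdjoinRoot.root f) = α • AdjoinRoot.root f := exists_algEquiv_root_eq_smul hα h _
  have hmonic : f.Monic := Polynomial.monic_X_pow_sub_C _ (by lia)
  have hx : AdjoinRoot.root f ^ n = (-1) ^ (n - 1) := by
    rw [root_X_pow_sub_C_pow_eq, map_pow, map_neg, map_one]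
  let pb := AdjoinRoot.powerBasis' hmonic
  have : Module.Finite F (AdjoinRoot f) := pb.finite
  have hrank : Module.finrank F (AdjoinRoot f) = n :=
    pb.finrank.trans Polynomial.natDegree_X_pow_sub_C
  have hxy : AdjoinRoot.root f * ((-1) ^ (n - 1) * AdjoinRoot.root f ^ (n - 1)) = 1 := by
    rw [mul_left_comm, ← pow_succ', Nat.sub_add_cancel hn, hx, ← mul_pow]
    simp
  obtain ⟨N, M, hN, hM, e⟩ := exists_mulLeft_eq_one_add_mul_one_add hxy hn hx
    (fun a ↦ by
      obtain ⟨p, rfl⟩ := AdjoinRoot.mk_surjective a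
      exact ⟨p, AdjoinRoot.aeval_eq p⟩) hrank
  obtain ⟨U₁, U₂, U₃, U₄, h₁, h₂, h₃, h₄, hU⟩ :=
    exists_four_unipotent_of_conj (F := F) (α := α) (D := σ.toLinearMap)
      (D' := σ.symm.toLinearMap) hN hM (by ext; simp)
      (by
        rw [← e]
        refine LinearMap.ext fun a ↦ ?_
        simp [hσ]) (by ext; simp)
  let φ := LinearMap.toMatrixAlgEquiv (Module.finBasisOfFinrankEq F (AdjoinRoot f) hrank)
  refine ⟨φ U₁, φ U₂, φ U₃, φ U₄, ?_, ?_, ?_, ?_, ?_⟩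
  · rw [← map_one φ, ← map_sub, ← map_mul, h₁, map_zero]
  · rw [← map_one φ, ← map_sub, ← map_mul, h₂, map_zero]
  · rw [← map_one φ, ← map_sub, ← map_mul, h₃, map_zero]
  · rw [← map_one φ, ← map_sub, ← map_mul, h₄, map_zero]
  · rw [← map_one φ, ← map_smul, hU, map_mul, map_mul, map_mul]
end
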